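/- arXiv:0807.4996 — 4 statements merged into one kernel-verified Lean document; each statement's English description precedes it below -/
import Mathlib

section
/- Let S = {x, 1 − x, y, x² − y} ⊆ ℝ[x,y]. Then the preordering T_S of ℝ[x,y] generated by S is saturated: every polynomial f ∈ ℝ[x,y] that is nonnegative on the compact set K_S = {(a,b) ∈ ℝ² : a ≥ 0, 1 − a ≥ 0, b ≥ 0, a² − b ≥ 0} belongs to T_S. -/
noncomputable section

open MvPolynomial

/-- The preordering of a commutative ring `A` generated by a subset `S`:
the smallest subsemiring of `A` containing `S` together with all squares. -/
def preorderingGen {A : Type*} [CommRing A] (S : Set A) : Set A :=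
  (Subsemiring.closure (S ∪ {a | ∃ b, a = b ^ 2}) : Set A)

end

noncomputable section
namespace Sat
open Polynomial

/-- bivariate polynomials -/
abbrev P2 := Polynomial (Polynomial ℝ)

def xx : P2 := C X
def yy : P2 := X
def cst (r : ℝ) : P2 := C (C r)

def cstHom : ℝ →+* P2 := (C : Polynomial ℝ →+* P2).comp (C : ℝ →+* Polynomial ℝ)
lemma cst_eq (r : ℝ) : cst r = cstHom r := rfl
lemma cst_add (r s : ℝ) : cst (r + s) = cst r + cst s := by simp [cst_eq]
lemma cst_sub (r s : ℝ) : cst (r - s) = cst r - cst s := by simp [cst_eq]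
lemma cst_mul (r s : ℝ) : cst (r * s) = cst r * cst s := by simp [cst_eq]
lemma cst_neg (r : ℝ) : cst (-r) = - cst r := by simp [cst_eq]
lemma cst_pow (r : ℝ) (n : ℕ) : cst (r ^ n) = cst r ^ n := by simp [cst_eq]
@[simp] lemma cst_one : cst 1 = 1 := by simp [cst_eq]
@[simp] lemma cst_zero : cst 0 = 0 := by simp [cst_eq]

/-- evaluation at a point -/
def ev (a b : ℝ) : P2 →+* ℝ := (evalRingHom a).comp (evalRingHom (C b))

@[simp] lemma ev_xx (a b : ℝ) : ev a b xx = a := by simp [ev, xx]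
@[simp] lemma ev_yy (a b : ℝ) : ev a b yy = b := by simp [ev, yy]
@[simp] lemma ev_cst (a b r : ℝ) : ev a b (cst r) = r := by simp [ev, cst]
lemma ev_C (a b : ℝ) (p : Polynomial ℝ) : ev a b (C p) = p.eval a := by simp [ev]

def inK (a b : ℝ) : Prop := 0 ≤ a ∧ a ≤ 1 ∧ 0 ≤ b ∧ b ≤ a ^ 2

/-- the preordering in bivariate polynomials -/
def T : Subsemiring P2 :=
  Subsemiring.closure ({xx, 1 - xx, yy, xx ^ 2 - yy} ∪ {a | ∃ b, a = b ^ 2})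

lemma T_sq (b : P2) : b ^ 2 ∈ T := Subsemiring.subset_closure (Or.inr ⟨b, rfl⟩)
lemma T_x : xx ∈ T := Subsemiring.subset_closure (Or.inl (by simp))
lemma T_1x : 1 - xx ∈ T := Subsemiring.subset_closure (Or.inl (by simp))
lemma T_y : yy ∈ T := Subsemiring.subset_closure (Or.inl (by simp))
lemma T_xy : xx ^ 2 - yy ∈ T := Subsemiring.subset_closure (Or.inl (by simp))

lemma cst_mem {S : Subsemiring P2} (hS : ∀ b : P2, b ^ 2 ∈ S) {r : ℝ} (hr : 0 ≤ r) :
    cst r ∈ S := by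
  have := hS (cst (Real.sqrt r))
  rwa [← cst_pow, Real.sq_sqrt hr] at this

lemma T_cst {r : ℝ} (hr : 0 ≤ r) : cst r ∈ T := cst_mem T_sq hr

lemma half_mem {S : Subsemiring P2} (hS : ∀ b : P2, b ^ 2 ∈ S) {g : P2} (h : 2 * g ∈ S) :
    g ∈ S := by
  have h1 := S.mul_mem (cst_mem hS (r := 1/2) (by norm_num)) h
  have : cst (1/2) * (2 * g) = g := by
    have : cst (1/2) * 2 = 1 := by
      have : (2 : P2) = cst 2 := (map_ofNat cstHom 2).symm
      rw [this, ← cst_mul]; norm_num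
    rw [← mul_assoc, this, one_mul]
  rwa [this] at h1

/-- boundedness with respect to a semiring -/
def Bd (S : Subsemiring P2) (r : ℝ) (g : P2) : Prop := cst r - g ∈ S ∧ cst r + g ∈ S

lemma Bd.add {S : Subsemiring P2} {r s : ℝ} {g h : P2} (hg : Bd S r g) (hh : Bd S s h) :
    Bd S (r + s) (g + h) := by
  constructor
  · have := S.add_mem hg.1 hh.1
    rw [cst_add]; convert this using 1; ring
  · have := S.add_mem hg.2 hh.2
    rw [cst_add]; convert this using 1; ring

lemma Bd.mul {S : Subsemiring P2} (hS : ∀ b : P2, b ^ 2 ∈ S) {r s : ℝ} {g h : P2}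
    (hg : Bd S r g) (hh : Bd S s h) : Bd S (r * s) (g * h) := by
  constructor
  · apply half_mem hS
    have := S.add_mem (S.mul_mem hg.2 hh.1) (S.mul_mem hg.1 hh.2)
    rw [cst_mul]; convert this using 1; ring
  · apply half_mem hS
    have := S.add_mem (S.mul_mem hg.2 hh.2) (S.mul_mem hg.1 hh.1)
    rw [cst_mul]; convert this using 1; ring

lemma Bd_cst {S : Subsemiring P2} (hS : ∀ b : P2, b ^ 2 ∈ S) (r : ℝ) : Bd S |r| (cst r) := by
  constructor
  · rw [← cst_sub]; exact cst_mem hS (by linarith [le_abs_self r])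
  · rw [← cst_add]; exact cst_mem hS (by linarith [neg_abs_le r])

lemma P2_induction {p : P2 → Prop} (hc : ∀ r, p (cst r)) (hx : p xx) (hy : p yy)
    (hadd : ∀ g h, p g → p h → p (g + h)) (hmul : ∀ g h, p g → p h → p (g * h)) (g : P2) :
    p g := by
  have h1 : ∀ q : Polynomial ℝ, p (C q) := by
    intro q
    induction q using Polynomial.induction_on' with
    | add a b ha hb => rw [C_add]; exact hadd _ _ ha hb
    | monomial n a =>
      rw [← C_mul_X_pow_eq_monomial, C_mul, C_pow]
      refine hmul _ _ (hc a) ?_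
      induction n with
      | zero => simpa using hc 1
      | succ n ih => rw [pow_succ]; exact hmul _ _ ih hx
  induction g using Polynomial.induction_on' with
  | add a b ha hb => exact hadd _ _ ha hb
  | monomial n a =>
    rw [← C_mul_X_pow_eq_monomial]
    refine hmul _ _ (h1 a) ?_
    induction n with
    | zero => simpa using hc 1
    | succ n ih => rw [pow_succ]; exact hmul _ _ ih hy

lemma T_bd (g : P2) : ∃ r, Bd T r g := by
  induction g using P2_induction with
  | hc r => exact ⟨_, Bd_cst T_sq r⟩
  | hx =>
    refine ⟨1, by simpa using T_1x, ?_⟩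
    simpa using T.add_mem T.one_mem T_x
  | hy =>
    refine ⟨1, ?_, by simpa using T.add_mem T.one_mem T_y⟩
    have := T.add_mem (T.mul_mem T_1x (T.add_mem T.one_mem T_x)) T_xy
    convert this using 1; rw [cst_one]; ring
  | hadd g h hg hh => obtain ⟨r, hr⟩ := hg; obtain ⟨s, hs⟩ := hh; exact ⟨_, hr.add hs⟩
  | hmul g h hg hh => obtain ⟨r, hr⟩ := hg; obtain ⟨s, hs⟩ := hh; exact ⟨_, hr.mul T_sq hs⟩

/-- the semiring `S + a S` -/
def adj (S : Subsemiring P2) (hS : ∀ b : P2, b ^ 2 ∈ S) (a : P2) : Subsemiring P2 where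
  carrier := {g | ∃ s ∈ S, ∃ t ∈ S, g = s + a * t}
  mul_mem' := by
    rintro _ _ ⟨s, hs, t, ht, rfl⟩ ⟨s', hs', t', ht', rfl⟩
    refine ⟨s * s' + a ^ 2 * (t * t'), S.add_mem (S.mul_mem hs hs')
      (S.mul_mem (hS a) (S.mul_mem ht ht')), s * t' + t * s',
      S.add_mem (S.mul_mem hs ht') (S.mul_mem ht hs'), by ring⟩
  one_mem' := ⟨1, S.one_mem, 0, S.zero_mem, by ring⟩
  add_mem' := by
    rintro _ _ ⟨s, hs, t, ht, rfl⟩ ⟨s', hs', t', ht', rfl⟩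
    exact ⟨s + s', S.add_mem hs hs', t + t', S.add_mem ht ht', by ring⟩
  zero_mem' := ⟨0, S.zero_mem, 0, S.zero_mem, by ring⟩

lemma le_adj (S : Subsemiring P2) (hS : ∀ b : P2, b ^ 2 ∈ S) (a : P2) : S ≤ adj S hS a :=
  fun s hs => ⟨s, hs, 0, S.zero_mem, by ring⟩

lemma mem_adj (S : Subsemiring P2) (hS : ∀ b : P2, b ^ 2 ∈ S) (a : P2) : a ∈ adj S hS a :=
  ⟨0, S.zero_mem, 1, S.one_mem, by ring⟩

lemma exists_max (S0 : Subsemiring P2) (h0 : ∀ b : P2, b ^ 2 ∈ S0) (hn : (-1 : P2) ∉ S0) :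
    ∃ S : Subsemiring P2, S0 ≤ S ∧ (-1 : P2) ∉ S ∧ ∀ a, a ∈ S ∨ -a ∈ S := by
  obtain ⟨S, hle, hmax⟩ := zorn_le_nonempty₀ {S : Subsemiring P2 | S0 ≤ S ∧ (-1 : P2) ∉ S} (by
    intro c hc hchain y hy
    refine ⟨sSup c, ⟨(hc hy).1.trans (le_sSup hy), ?_⟩, fun z hz => le_sSup hz⟩
    rw [Subsemiring.mem_sSup_of_directedOn ⟨y, hy⟩ hchain.directedOn]
    rintro ⟨s, hs, h⟩
    exact (hc hs).2 h) S0 ⟨le_rfl, hn⟩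
  have hS : ∀ b : P2, b ^ 2 ∈ S := fun b => hle (h0 b)
  have key : ∀ a, a ∉ S → (-1 : P2) ∈ adj S hS a := by
    intro a ha
    by_contra h
    have := hmax.2 (y := adj S hS a) ⟨hle.trans (le_adj S hS a), h⟩ (le_adj S hS a)
    exact ha (this (mem_adj S hS a))
  refine ⟨S, hle, hmax.1.2, ?_⟩
  intro a
  by_contra hcon
  push Not at hcon
  obtain ⟨s, hs, t, ht, e1⟩ := key a hcon.1
  obtain ⟨s', hs', t', ht', e2⟩ := key (-a) hcon.2
  apply hmax.1.2
  have : (-1 : P2) = s + s' + s * s' + a ^ 2 * (t * t') := by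
    have e3 : a * t = -1 - s := by rw [e1]; ring
    have e4 : a * t' = 1 + s' := by linear_combination e2
    have : a ^ 2 * (t * t') = (-1 - s) * (1 + s') := by rw [← e3, ← e4]; ring
    rw [this]; ring
  rw [this]
  exact S.add_mem (S.add_mem (S.add_mem hs hs') (S.mul_mem hs hs'))
    (S.mul_mem (hS a) (S.mul_mem ht ht'))

lemma neg_cst_not_mem {S : Subsemiring P2} (hS : ∀ b : P2, b ^ 2 ∈ S) (hn : (-1 : P2) ∉ S)
    {r : ℝ} (hr : r < 0) : cst r ∉ S := by
  intro h
  apply hn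
  have := S.mul_mem (cst_mem hS (r := -r⁻¹) (by
    have := inv_lt_zero.mpr hr; linarith)) h
  rw [← cst_mul] at this
  have e : -r⁻¹ * r = -1 := by rw [neg_mul, inv_mul_cancel₀ hr.ne]
  rw [e, cst_neg, cst_one] at this
  exact this

lemma exists_std {S : Subsemiring P2} (hS : ∀ b : P2, b ^ 2 ∈ S) (hn : (-1 : P2) ∉ S)
    (hor : ∀ a, a ∈ S ∨ -a ∈ S) (g : P2) (hb : ∃ r, Bd S r g) :
    ∃ a : ℝ, ∀ ε > 0, Bd S ε (g - cst a) := by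
  obtain ⟨n, hb⟩ := hb
  let R : Set ℝ := {r | g - cst r ∈ S}
  have hne : R.Nonempty := ⟨-n, by
    change g - cst (-n) ∈ S
    have := hb.2; rw [cst_neg]; convert this using 1; ring⟩
  have hbd : BddAbove R := by
    refine ⟨n, fun r hr => ?_⟩
    by_contra hlt
    push Not at hlt
    have := S.add_mem hb.1 hr
    have e : cst n - g + (g - cst r) = cst (n - r) := by rw [cst_sub]; ring
    rw [e] at this
    exact neg_cst_not_mem hS hn (by linarith) this
  refine ⟨sSup R, fun ε hε => ⟨?_, ?_⟩⟩
  · have h1 : sSup R + ε ∉ R := fun h => by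
      have := le_csSup hbd h; linarith
    have h2 : g - cst (sSup R + ε) ∉ S := h1
    have h3 := (hor (g - cst (sSup R + ε))).resolve_left h2
    convert h3 using 1; rw [cst_add]; ring
  · obtain ⟨r, hr, hlt⟩ := exists_lt_of_lt_csSup hne (show sSup R - ε < sSup R by linarith)
    have h2 := S.add_mem hr (cst_mem hS (r := r - sSup R + ε) (by linarith))
    convert h2 using 1; rw [cst_add, cst_sub]; ring

theorem pss_aux (f : P2) (hf : ∀ a b, inK a b → 0 < ev a b f) :
    ∃ s ∈ T, ∃ t ∈ T, t * f = 1 + s := by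
  by_contra hcon
  have h1 : (-1 : P2) ∉ adj T T_sq (-f) := by
    rintro ⟨s, hs, t, ht, e⟩
    exact hcon ⟨s, hs, t, ht, by linear_combination e⟩
  obtain ⟨S, hle, hn, hor⟩ := exists_max _ (fun b => le_adj T T_sq (-f) (T_sq b)) h1
  have hTS : T ≤ S := (le_adj T T_sq (-f)).trans hle
  have hS : ∀ b : P2, b ^ 2 ∈ S := fun b => hTS (T_sq b)
  have hbd : ∀ g, ∃ r, Bd S r g := fun g => by
    obtain ⟨r, h⟩ := T_bd g
    exact ⟨r, hTS h.1, hTS h.2⟩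
  obtain ⟨a, ha⟩ := exists_std hS hn hor xx (hbd xx)
  obtain ⟨b, hb⟩ := exists_std hS hn hor yy (hbd yy)
  have hpos : ∀ g r, Bd S r g → ∃ r' > 0, Bd S r' g := by
    intro g r h
    refine ⟨|r| + 1, by positivity, ?_⟩
    have hc : cst (|r| + 1 - r) ∈ S := cst_mem hS (by linarith [le_abs_self r])
    constructor
    · have := S.add_mem h.1 hc
      convert this using 1; rw [cst_sub]; ring
    · have := S.add_mem h.2 hc
      convert this using 1; rw [cst_sub]; ring
  have key : ∀ g : P2, ∀ ε > 0, Bd S ε (g - cst (ev a b g)) := by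
    intro g
    induction g using P2_induction with
    | hc r => intro ε hε; simp [Bd, cst_mem hS hε.le]
    | hx => simpa using ha
    | hy => simpa using hb
    | hadd g h hg hh =>
      intro ε hε
      have := (hg (ε/2) (by positivity)).add (hh (ε/2) (by positivity))
      rw [add_halves] at this
      convert this using 1; rw [map_add, cst_add]; ring
    | hmul g h hg hh =>
      intro ε hε
      obtain ⟨r, hr⟩ := hbd h
      obtain ⟨r, hr0, hr⟩ := hpos _ _ hr
      obtain ⟨s, hs0, hs⟩ := hpos _ _ (Bd_cst hS (ev a b g))
      have h1 := (hg (ε / 2 / r) (by positivity)).mul hS hr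
      have h2 := hs.mul hS (hh (ε / 2 / s) (by positivity))
      have := h1.add h2
      have e : ε / 2 / r * r + s * (ε / 2 / s) = ε := by field_simp; ring
      rw [e] at this
      convert this using 1; rw [map_mul, cst_mul]; ring
  have nonneg : ∀ g ∈ S, 0 ≤ ev a b g := by
    intro g hg
    by_contra hlt
    push Not at hlt
    have h := (key g (-(ev a b g)/2) (by linarith)).1
    have := S.add_mem h hg
    have e : cst (-(ev a b g)/2) - (g - cst (ev a b g)) + g = cst (ev a b g / 2) := by
      rw [show cst (-(ev a b g)/2) = cst (ev a b g / 2 - ev a b g) by congr 1; ring, cst_sub]; ring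
    rw [e] at this
    exact neg_cst_not_mem hS hn (by linarith) this
  have hK : inK a b := by
    refine ⟨by simpa using nonneg _ (hTS T_x), by simpa using nonneg _ (hTS T_1x),
      by simpa using nonneg _ (hTS T_y), by simpa using nonneg _ (hTS T_xy)⟩
  have h2 := nonneg (-f) (hle (mem_adj T T_sq (-f)))
  have h3 := hf a b hK
  rw [map_neg] at h2; linarith

/-- Strict positivity implies membership. -/
theorem pss (f : P2) (hf : ∀ a b, inK a b → 0 < ev a b f) : f ∈ T := by
  obtain ⟨s, hs, t, ht, e⟩ := pss_aux f hf
  obtain ⟨k0, hk0⟩ := T_bd t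
  obtain ⟨r, hr⟩ := T_bd f
  obtain ⟨k, hk, hkt⟩ : ∃ k : ℝ, 0 < k ∧ cst k - t ∈ T := by
    refine ⟨|k0| + 1, by positivity, ?_⟩
    have := T.add_mem hk0.1 (T_cst (r := |k0| + 1 - k0) (by linarith [le_abs_self k0]))
    convert this using 1; rw [cst_sub]; ring
  have step : ∀ q : ℝ, 0 ≤ q → f + cst q ∈ T → f + cst (q - 1/k) ∈ T := by
    intro q hq h
    have h1 : cst (1/k) * ((cst k - t) * (f + cst q) + s + cst q * t) ∈ T :=
      T.mul_mem (T_cst (by positivity)) (T.add_mem (T.add_mem (T.mul_mem hkt h) hs)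
        (T.mul_mem (T_cst hq) ht))
    convert h1 using 1
    have e1 : cst (1/k) * cst k = 1 := by rw [← cst_mul, ← cst_one]; congr 1; field_simp
    rw [cst_sub]
    linear_combination (-f - cst q) * e1 + cst (1/k) * e
  have all : ∀ i : ℕ, f + cst (max (|r| - i * (1/k)) 0) ∈ T := by
    intro i
    induction i with
    | zero =>
      have := T.add_mem hr.2 (T_cst (r := |r| - r) (by linarith [le_abs_self r]))
      simp only [Nat.cast_zero, zero_mul, sub_zero]
      rw [max_eq_left (abs_nonneg r)]
      convert this using 1; rw [cst_sub]; ring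
    | succ i ih =>
      rcases le_total 0 (|r| - i * (1/k)) with h | h
      · rw [max_eq_left h] at ih
        have h1 := step _ h ih
        have h2 := T.add_mem h1 (T_cst (r := max (|r| - ((i+1 : ℕ):ℝ) * (1/k)) 0
          - (|r| - i * (1/k) - 1/k)) (by
            have := le_max_left (|r| - ((i+1 : ℕ):ℝ) * (1/k)) 0
            push_cast at this ⊢; linarith))
        convert h2 using 1; rw [cst_sub _ (|r| - i * (1/k) - 1/k)]; ring
      · rw [max_eq_right h] at ih
        rw [max_eq_right]; · exact ih
        push_cast
        have : 0 < 1/k := by positivity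
        linarith
  obtain ⟨i, hi⟩ := exists_nat_gt (|r| * k)
  have := all i
  rw [max_eq_right] at this
  · simpa using this
  · have : |r| ≤ i * (1/k) := by
      rw [mul_one_div, le_div_iff₀ hk]; exact hi.le
    linarith

end Sat

end

noncomputable section
namespace Sat
open Polynomial

lemma ev_cont (f : P2) : Continuous fun p : ℝ × ℝ => ev p.1 p.2 f := by
  induction f using P2_induction with
  | hc r => simp only [ev_cst]; fun_prop
  | hx => simp only [ev_xx]; fun_prop
  | hy => simp only [ev_yy]; fun_prop
  | hadd g h hg hh => simp only [map_add]; exact hg.add hh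
  | hmul g h hg hh => simp only [map_mul]; exact hg.mul hh

lemma isCompact_K : IsCompact {p : ℝ × ℝ | inK p.1 p.2} := by
  apply IsCompact.of_isClosed_subset (isCompact_Icc (a := ((0:ℝ),(0:ℝ))) (b := ((1:ℝ),(1:ℝ))))
  · have : {p : ℝ × ℝ | inK p.1 p.2} = {p | 0 ≤ p.1} ∩ {p | p.1 ≤ 1} ∩ {p | 0 ≤ p.2}
        ∩ {p | p.2 ≤ p.1 ^ 2} := by
      ext p; simp [inK, and_assoc]
    rw [this]
    refine IsClosed.inter (IsClosed.inter (IsClosed.inter ?_ ?_) ?_) ?_ <;>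
    exact isClosed_le (by fun_prop) (by fun_prop)
  · rintro ⟨a, b⟩ ⟨h1, h2, h3, h4⟩
    simp only at h1 h2 h3 h4
    exact ⟨⟨h1, h3⟩, ⟨h2, by simp only; nlinarith⟩⟩

lemma exists_lower (Z : Set (ℝ × ℝ)) (hZ : IsClosed Z) (g : P2)
    (hg : ∀ p ∈ Z, inK p.1 p.2 → 0 < ev p.1 p.2 g) :
    ∃ δ > 0, ∀ p ∈ Z, inK p.1 p.2 → δ ≤ ev p.1 p.2 g := by
  have hc : IsCompact ({p : ℝ × ℝ | inK p.1 p.2} ∩ Z) := isCompact_K.inter_right hZ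
  rcases Set.eq_empty_or_nonempty ({p : ℝ × ℝ | inK p.1 p.2} ∩ Z) with h | h
  · refine ⟨1, one_pos, fun p hp hK => ?_⟩
    have : p ∈ ({p : ℝ × ℝ | inK p.1 p.2} ∩ Z) := ⟨hK, hp⟩
    rw [h] at this; exact this.elim
  · obtain ⟨p, hp, hmin⟩ := hc.exists_isMinOn h (ev_cont g).continuousOn
    exact ⟨_, hg p hp.2 hp.1, fun r hr hK => hmin ⟨hK, hr⟩⟩

lemma exists_upper (g : P2) : ∃ M > 0, ∀ a b, inK a b → |ev a b g| ≤ M := by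
  obtain ⟨M, hM⟩ := isCompact_K.exists_bound_of_continuousOn (ev_cont g).continuousOn
  refine ⟨|M| + 1, by positivity, fun a b h => ?_⟩
  have := hM (a, b) h
  rw [Real.norm_eq_abs] at this
  exact this.trans (by linarith [le_abs_self M])

lemma C_sq_mem (q : Polynomial ℝ) : (C (q ^ 2) : P2) ∈ T := by
  rw [C_pow]; exact T_sq _

/-- final gluing -/
lemma final_glue (f : P2) (q0 : Polynomial ℝ) (k N : ℕ) (hkN : k < N) (hk : k ≠ 0) (c0 : ℝ)
    (hc0 : 0 ≤ c0)
    (h : f - C (q0 ^ 2) ^ k + cst c0 * C (q0 ^ 2) ^ N ∈ T)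
    (hf : ∀ a b, inK a b → 0 ≤ ev a b f)
    (hf' : ∀ a b, inK a b → q0.eval a ≠ 0 → 0 < ev a b f) : f ∈ T := by
  set q : P2 := C (q0 ^ 2) with hq
  have hevq : ∀ a b, ev a b q = (q0.eval a) ^ 2 := by
    intro a b; rw [hq, ev_C]; simp
  obtain ⟨Q, hQ0, hQ⟩ := exists_upper q
  have hq0 : ∀ a b, 0 ≤ ev a b q := fun a b => by rw [hevq]; positivity
  have hQ' : ∀ a b, inK a b → ev a b q < Q + 1 := fun a b hK => by
    have := hQ a b hK; have := le_abs_self (ev a b q); linarith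
  obtain ⟨N', rfl⟩ : ∃ N', N = k + (N' + 1) := ⟨N - k - 1, by omega⟩
  let Z : Set (ℝ × ℝ) := {p | 1 ≤ c0 * (ev p.1 p.2 q) ^ (N' + 1)}
  have hZ : IsClosed Z := isClosed_le continuous_const
    (continuous_const.mul ((ev_cont q).pow _))
  have hZq : ∀ p ∈ Z, ev p.1 p.2 q ≠ 0 := by
    intro p hp h0
    have : (1:ℝ) ≤ c0 * (ev p.1 p.2 q) ^ (N' + 1) := hp
    rw [h0] at this; simp at this; linarith
  obtain ⟨δ, hδ, hδ'⟩ := exists_lower Z hZ f (fun p hp hK => hf' _ _ hK (by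
    intro h0; apply hZq p hp; rw [hevq, h0]; simp))
  obtain ⟨η, hη, hη'⟩ := exists_lower Z hZ (q ^ k) (fun p hp hK => by
    rw [map_pow]; exact pow_pos (lt_of_le_of_ne (hq0 _ _) (hZq p hp).symm) _)
  let w : P2 := cst (1 / (Q+1) ^ k) * q ^ k
  have hQk : 0 < (Q+1)^k := by positivity
  have hw0 : ∀ a b, inK a b → 0 ≤ ev a b w ∧ ev a b w < 1 := by
    intro a b hK
    simp only [w, map_mul, ev_cst, map_pow]
    constructor
    · have := hq0 a b; positivity
    · rw [one_div, inv_mul_lt_iff₀ hQk, mul_one]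
      exact pow_lt_pow_left₀ (hQ' a b hK) (hq0 a b) hk
  have hwη : ∀ p ∈ Z, inK p.1 p.2 → η / (Q+1)^k ≤ ev p.1 p.2 w := by
    intro p hp hK
    simp only [w, map_mul, ev_cst]
    rw [one_div, div_eq_inv_mul]
    exact mul_le_mul_of_nonneg_left (hη' p hp hK) (by positivity)
  let C1 := c0 * (Q+1)^(N'+1)
  have hC1 : 0 ≤ C1 := by positivity
  obtain ⟨ε, hε, hε1⟩ : ∃ ε > 0, C1 * (Q+1)^k * ε + δ * ε < δ := by
    refine ⟨δ / (2 * (C1 * (Q+1)^k + δ)), by positivity, ?_⟩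
    have : (C1 * (Q+1)^k + δ) * (δ / (2 * (C1 * (Q+1)^k + δ))) = δ / 2 := by field_simp
    nlinarith
  have hη1 : 0 < η / (Q+1)^k := by positivity
  obtain ⟨M, hM⟩ : ∃ M : ℕ, ∀ p ∈ Z, inK p.1 p.2 → (1 - ev p.1 p.2 w) ^ M < ε := by
    rcases le_or_gt 1 (η / (Q+1)^k) with h1 | h1
    · refine ⟨0, fun p hp hK => ?_⟩
      have h2 := hwη p hp hK
      have h3 := (hw0 p.1 p.2 hK).2
      linarith
    · obtain ⟨M, hM⟩ := exists_pow_lt_of_lt_one hε (show 1 - η / (Q+1)^k < 1 by linarith)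
      refine ⟨M, fun p hp hK => lt_of_le_of_lt ?_ hM⟩
      exact pow_le_pow_left₀ (by linarith [(hw0 p.1 p.2 hK).2]) (by linarith [hwη p hp hK]) _
  let ψ : P2 := (1 - w) ^ M
  let θ : P2 := cst (1 / (Q+1)^k) * ∑ i ∈ Finset.range M, (1 - w) ^ i
  have hψθ : ψ + q ^ k * θ = 1 := by
    have h1 := Commute.geom_sum₂_mul (Commute.one_right (1 - w)) M
    have h2 := geom_sum_mul (1 - w) M
    simp only [ψ, θ]
    have e : q ^ k * (cst (1 / (Q+1)^k) * ∑ i ∈ Finset.range M, (1 - w) ^ i)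
      = w * ∑ i ∈ Finset.range M, (1 - w) ^ i := by simp only [w]; ring
    rw [e]
    linear_combination -h2
  have hψpos : ∀ a b, inK a b → 0 < ev a b ψ := by
    intro a b hK
    simp only [ψ, map_pow, map_sub, map_one]
    exact pow_pos (by linarith [(hw0 a b hK).2]) _
  have hψT : ψ ∈ T := pss _ hψpos
  have hev1 : ∀ a b, ev a b ψ + (ev a b q) ^ k * ev a b θ = 1 := by
    intro a b
    have := congrArg (ev a b) hψθ
    simpa using this
  have hθ0 : ∀ a b, inK a b → 0 ≤ ev a b θ := by
    intro a b hK
    simp only [θ, map_mul, ev_cst, map_sum, map_pow, map_sub, map_one]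
    apply mul_nonneg (by positivity)
    exact Finset.sum_nonneg fun i _ => pow_nonneg (by linarith [(hw0 a b hK).2]) _
  let B : P2 := ψ * (1 - cst c0 * q ^ (N' + 1)) + θ * f
  have hB : B ∈ T := by
    apply pss
    intro a b hK
    simp only [B, map_add, map_mul, map_sub, map_one, ev_cst, map_pow]
    by_cases hz : (a, b) ∈ Z
    · have h1 : ev a b ψ < ε := by
        have := hM (a, b) hz hK
        simpa [ψ] using this
      have h2 := hδ' (a, b) hz hK
      simp only at h2
      have h3 : c0 * ev a b q ^ (N' + 1) ≤ C1 :=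
        mul_le_mul_of_nonneg_left (pow_le_pow_left₀ (hq0 a b) (hQ' a b hK).le _) hc0
      have h4 : (ev a b q) ^ k ≤ (Q+1)^k := pow_le_pow_left₀ (hq0 a b) (hQ' a b hK).le _
      have h5 := hev1 a b
      have h6 := hψpos a b hK
      have h7 := hθ0 a b hK
      have h8 : 1 - ε < (Q+1)^k * ev a b θ := by nlinarith
      have h9 : δ * (1 - ε) < (Q+1)^k * (ev a b θ * ev a b f) := by
        calc δ * (1 - ε) < δ * ((Q+1)^k * ev a b θ) := by gcongr
          _ ≤ ev a b f * ((Q+1)^k * ev a b θ) := by gcongr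
          _ = _ := by ring
      have h10 : C1 * ε < ev a b θ * ev a b f := by
        have : (Q+1)^k * (C1 * ε) < (Q+1)^k * (ev a b θ * ev a b f) := by nlinarith
        exact lt_of_mul_lt_mul_left this hQk.le
      have h11 : ev a b ψ * (c0 * ev a b q ^ (N' + 1)) ≤ ε * C1 := by
        apply mul_le_mul h1.le h3 _ hε.le
        have := hq0 a b; positivity
      nlinarith
    · have h1 : c0 * ev a b q ^ (N' + 1) < 1 := not_le.mp hz
      have := hψpos a b hK
      have h3 := mul_nonneg (hθ0 a b hK) (hf a b hK)
      have : 0 < ev a b ψ * (1 - c0 * ev a b q ^ (N' + 1)) := mul_pos this (by linarith)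
      linarith
  have hfin := T.add_mem (T.mul_mem hψT h) (T.mul_mem (pow_mem (C_sq_mem q0) k) hB)
  convert hfin using 1
  rw [← hq]
  simp only [B]
  linear_combination (-f) * hψθ

lemma many_glue (f : P2) (S : Finset ℝ) (k N : ℕ)
    (h : ∀ r ∈ S, ∃ c : ℝ, 0 ≤ c ∧ f - C ((∏ s ∈ S, (X - C s)) ^ 2) ^ k
      + cst c * C ((X - C r) ^ 2) ^ N ∈ T) (hS : S.Nonempty) :
    ∃ c : ℝ, 0 ≤ c ∧ f - C ((∏ s ∈ S, (X - C s)) ^ 2) ^ k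
      + cst c * C ((∏ s ∈ S, (X - C s)) ^ 2) ^ N ∈ T := by
  classical
  set q0 : Polynomial ℝ := ∏ s ∈ S, (X - C s) with hq0
  choose! c hc0 hc using h
  let e : ℝ → Polynomial ℝ := fun r => (∏ s ∈ S.erase r, (X - C s)) ^ N
  let E : Polynomial ℝ := ∑ r ∈ S, e r ^ 2
  have he : ∀ r ∈ S, (e r) ^ 2 * ((X - C r) ^ 2) ^ N = (q0 ^ 2) ^ N := by
    intro r hr
    simp only [e]
    rw [hq0, ← Finset.mul_prod_erase S _ hr]
    generalize (X - C r : Polynomial ℝ) = u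
    generalize (∏ s ∈ S.erase r, (X - C s) : Polynomial ℝ) = w
    ring
  let c1 := ∑ r ∈ S, c r
  have h1 : C E * (f - C (q0 ^ 2) ^ k) + cst c1 * C (q0 ^ 2) ^ N ∈ T := by
    have : ∑ r ∈ S, C (e r ^ 2) * (f - C (q0 ^ 2) ^ k + cst (c r) * C ((X - C r) ^ 2) ^ N) ∈ T :=
      T.sum_mem fun r hr => T.mul_mem (C_sq_mem _) (hc r hr)
    convert this using 1
    have h3 : ∑ r ∈ S, C (e r ^ 2) * (f - C (q0 ^ 2) ^ k + cst (c r) * C ((X - C r) ^ 2) ^ N)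
      = ∑ r ∈ S, (C (e r ^ 2) * (f - C (q0 ^ 2) ^ k) + cst (c r) * C (q0 ^ 2) ^ N) := by
      refine Finset.sum_congr rfl fun r hr => ?_
      have := congrArg (C : Polynomial ℝ →+* P2) (he r hr)
      simp only [map_mul, map_pow] at this ⊢
      linear_combination cst (c r) * this
    rw [h3, Finset.sum_add_distrib, ← Finset.sum_mul, ← Finset.sum_mul]
    simp only [E, c1, map_sum, cst_eq]
  have hcop : IsCoprime E ((q0 ^ 2) ^ N) := by
    apply IsCoprime.pow_right
    apply IsCoprime.pow_right
    rw [hq0]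
    apply IsCoprime.prod_right
    intro r hr
    apply IsCoprime.symm
    rw [(irreducible_X_sub_C r).coprime_iff_not_dvd, dvd_iff_isRoot, IsRoot]
    simp only [E, eval_finsetSum, eval_pow]
    apply ne_of_gt
    apply Finset.sum_pos' (fun i _ => by positivity)
    refine ⟨r, hr, ?_⟩
    have : eval r (e r) ≠ 0 := by
      simp only [e, eval_pow, eval_prod]
      apply pow_ne_zero
      rw [Finset.prod_ne_zero_iff]
      intro s hs
      simp only [eval_sub, eval_X, eval_C]
      exact sub_ne_zero.mpr (Finset.ne_of_mem_erase hs).symm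
    positivity
  obtain ⟨r0, b, hrb⟩ := hcop
  have hET : (C E : P2) ∈ T := by
    simp only [E, map_sum]
    exact T.sum_mem fun r _ => C_sq_mem _
  have h2 := T.mul_mem (T.mul_mem (C_sq_mem r0) hET) h1
  let W : P2 := (-2 * C b + C b ^ 2 * C (q0 ^ 2) ^ N) * (f - C (q0 ^ 2) ^ k)
    + C (r0 ^ 2) * C E * cst c1
  have hW : C (r0 ^ 2) * C E * (C E * (f - C (q0 ^ 2) ^ k) + cst c1 * C (q0 ^ 2) ^ N)
    = f - C (q0 ^ 2) ^ k + C (q0 ^ 2) ^ N * W := by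
    have := congrArg (C : Polynomial ℝ →+* P2) hrb
    simp only [map_mul, map_pow, map_add, map_one] at this
    simp only [W, map_pow]
    linear_combination (f - (C q0 ^ 2) ^ k) * (C r0 * C E + (1 - C b * (C q0 ^ 2) ^ N)) * this
  rw [hW] at h2
  obtain ⟨m, hm⟩ := T_bd W
  refine ⟨|m|, abs_nonneg m, ?_⟩
  have h4 := T.add_mem h2 (T.mul_mem (pow_mem (C_sq_mem q0) N)
    (T.add_mem hm.1 (T_cst (r := |m| - m) (by linarith [le_abs_self m]))))
  convert h4 using 1
  rw [cst_sub]; ring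

end Sat

end

noncomputable section
namespace Sat
open Polynomial

section hensel
variable {k : Type*} [Field k]

def hs (f : ℕ → Polynomial k) (p q u a : Polynomial k) : ℕ → Polynomial k × Polynomial k
  | 0 => (p, q)
  | n + 1 =>
    let R := f (n + 1) - ∑ i : Fin n, (hs f p q u a (i.1 + 1)).1 * (hs f p q u a (n - i.1)).2
    ((a * R) %ₘ p, u * R + q * ((a * R) /ₘ p))
  termination_by n => n
  decreasing_by all_goals omega

theorem hensel (f : PowerSeries (Polynomial k)) (p q : Polynomial k) (hp : p.Monic)
    (hcop : IsCoprime p q) (h0 : PowerSeries.coeff 0 f = p * q) :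
    ∃ P Q : PowerSeries (Polynomial k), f = P * Q ∧ PowerSeries.coeff 0 P = p ∧
      PowerSeries.coeff 0 Q = q ∧ ∀ n, 0 < n → (PowerSeries.coeff n P).degree < p.degree := by
  obtain ⟨u, a, hua⟩ := hcop
  let F : ℕ → Polynomial k := fun n => PowerSeries.coeff n f
  let s := hs F p q u a
  refine ⟨PowerSeries.mk fun n => (s n).1, PowerSeries.mk fun n => (s n).2, ?_, ?_, ?_, ?_⟩
  · ext1 n
    rw [PowerSeries.coeff_mul]
    simp only [PowerSeries.coeff_mk]
    rw [Finset.Nat.sum_antidiagonal_eq_sum_range_succ (fun i j => (s i).1 * (s j).2)]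
    rcases n with _ | n
    · simp [s, hs, h0]
    · rw [Finset.sum_range_succ, Finset.sum_range_succ']
      have e1 : s 0 = (p, q) := by simp [s, hs]
      have e2 : ∀ i, n + 1 - (i + 1) = n - i := by intro i; omega
      have e3 : s (n + 1) = (let R := F (n + 1) - ∑ i : Fin n, (s (i.1 + 1)).1 * (s (n - i.1)).2
        ((a * R) %ₘ p, u * R + q * ((a * R) /ₘ p))) := by
        simp only [s]; rw [hs]
      simp only [e2, Nat.sub_self, Nat.sub_zero, e1]
      rw [e3]
      simp only
      rw [Finset.sum_range (fun i => (s (i + 1)).1 * (s (n - i)).2)]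
      set Sg := ∑ i : Fin n, (s (i.1 + 1)).1 * (s (n - i.1)).2
      have e4 := modByMonic_add_div (a * (F (n + 1) - Sg)) p
      change F (n + 1) = _
      linear_combination -(F (n + 1) - Sg) * hua - q * e4
  · simp [s, hs]
  · simp [s, hs]
  · intro n hn
    obtain ⟨n, rfl⟩ : ∃ m, n = m + 1 := ⟨n - 1, by omega⟩
    simp only [PowerSeries.coeff_mk, s]
    rw [hs]
    exact degree_modByMonic_lt _ hp

lemma coeff_mul_succ' {R : Type*} [CommRing R] (P Q : PowerSeries R) (n : ℕ) :
    PowerSeries.coeff (n + 1) (P * Q) = ∑ i ∈ Finset.range (n + 1),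
      PowerSeries.coeff (i + 1) P * PowerSeries.coeff (n + 1 - (i + 1)) Q +
      PowerSeries.coeff 0 P * PowerSeries.coeff (n + 1) Q := by
  rw [PowerSeries.coeff_mul, Finset.Nat.sum_antidiagonal_eq_sum_range_succ
      (fun i j => PowerSeries.coeff i P * PowerSeries.coeff j Q), Finset.sum_range_succ']
  simp

/-- swap of variables -/
def sw : Polynomial (PowerSeries k) →+* PowerSeries (Polynomial k) :=
  eval₂RingHom (PowerSeries.map (C : k →+* Polynomial k)) (PowerSeries.C X)

lemma coeff_sw (f : Polynomial (PowerSeries k)) (n j : ℕ) :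
    (PowerSeries.coeff n (sw f)).coeff j = PowerSeries.coeff n (f.coeff j) := by
  induction f using Polynomial.induction_on' with
  | add p q hp hq => simp [hp, hq]
  | monomial i a =>
    simp only [sw, coe_eval₂RingHom, eval₂_monomial]
    rw [← map_pow, mul_comm, PowerSeries.coeff_C_mul, PowerSeries.coeff_map, mul_comm,
      coeff_C_mul_X_pow, coeff_monomial]
    split_ifs with h1 h2 h2 <;> simp_all

lemma sw_inj {f g : Polynomial (PowerSeries k)} (h : sw f = sw g) : f = g := by
  ext j n
  rw [← coeff_sw, ← coeff_sw, h]

lemma sw_surj (P : PowerSeries (Polynomial k)) (d : ℕ) (hd : ∀ n, (PowerSeries.coeff n P).degree < d) :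
    ∃ A : Polynomial (PowerSeries k), sw A = P ∧ A.degree < d := by
  refine ⟨∑ j ∈ Finset.range d, monomial j (PowerSeries.mk fun n => (PowerSeries.coeff n P).coeff j),
    ?_, ?_⟩
  · ext n j
    rw [coeff_sw, finsetSum_coeff]
    simp only [coeff_monomial, Finset.sum_ite_eq', Finset.mem_range]
    split_ifs with h
    · simp
    · rw [map_zero, coeff_eq_zero_of_degree_lt]
      exact lt_of_lt_of_le (hd n) (by exact_mod_cast not_lt.mp h)
  · rw [degree_lt_iff_coeff_zero]
    intro m hm
    rw [finsetSum_coeff]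
    simp only [coeff_monomial, Finset.sum_ite_eq', Finset.mem_range]
    rw [if_neg (not_lt.mpr hm)]

lemma sw_surj_monic (P : PowerSeries (Polynomial k)) (p : Polynomial k) (hp : p.Monic)
    (h0 : PowerSeries.coeff 0 P = p)
    (hd : ∀ n, 0 < n → (PowerSeries.coeff n P).degree < p.degree) :
    ∃ A : Polynomial (PowerSeries k), sw A = P ∧ A.Monic ∧ A.natDegree = p.natDegree := by
  obtain ⟨B, hB, hBd⟩ := sw_surj (P - PowerSeries.C (X ^ p.natDegree)) p.natDegree (by
    intro n
    rw [← degree_eq_natDegree hp.ne_zero]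
    rcases Nat.eq_zero_or_pos n with rfl | hn
    · rw [map_sub, h0, PowerSeries.coeff_zero_C]
      apply degree_sub_lt_left
      · rw [degree_X_pow, degree_eq_natDegree hp.ne_zero]
      · exact hp.ne_zero
      · simp [hp.leadingCoeff]
    · rw [map_sub, PowerSeries.coeff_C, if_neg hn.ne', sub_zero]
      exact hd n hn)
  have hm : (X ^ p.natDegree + B).Monic := monic_X_pow_add hBd
  refine ⟨X ^ p.natDegree + B, ?_, hm, ?_⟩
  · rw [map_add, hB, map_pow]
    simp [sw]
  · apply natDegree_eq_of_degree_eq_some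
    rw [degree_add_eq_left_of_degree_lt (by rwa [degree_X_pow]), degree_X_pow]

lemma coeff_zero_sw (f : Polynomial (PowerSeries k)) :
    PowerSeries.coeff 0 (sw f) = f.map PowerSeries.constantCoeff := by
  ext j
  rw [coeff_sw, coeff_map]; simp

/-- Hensel factorization for monic polynomials over power series -/
theorem hensel_poly (f : Polynomial (PowerSeries k)) (hf : f.Monic) (p q : Polynomial k)
    (hp : p.Monic) (hq : q.Monic)
    (hcop : IsCoprime p q) (h0 : f.map PowerSeries.constantCoeff = p * q) :
    ∃ P Q : Polynomial (PowerSeries k), f = P * Q ∧ P.Monic ∧ Q.Monic ∧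
      P.natDegree = p.natDegree ∧ Q.natDegree = q.natDegree ∧
      P.map PowerSeries.constantCoeff = p ∧ Q.map PowerSeries.constantCoeff = q := by
  obtain ⟨P, Q, hPQ, hP0, hQ0, hPd⟩ := hensel (sw f) p q hp hcop (by rw [coeff_zero_sw, h0])
  obtain ⟨A, hA, hAm, hAd⟩ := sw_surj_monic P p hp hP0 hPd
  have hdeg : f.degree = p.degree + q.degree := by
    rw [← degree_mul, ← h0, hf.degree_map]
  have hfn : ∀ n, 0 < n → (PowerSeries.coeff n (sw f)).degree < f.degree := by
    intro n hn
    rw [degree_eq_natDegree hf.ne_zero, degree_lt_iff_coeff_zero]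
    intro m hm
    rw [coeff_sw]
    rcases hm.eq_or_lt with h | h
    · rw [← h, hf.coeff_natDegree, PowerSeries.coeff_one, if_neg hn.ne']
    · rw [coeff_eq_zero_of_natDegree_lt h, map_zero]
  have hQd : ∀ n, 0 < n → (PowerSeries.coeff n Q).degree < q.degree := by
    intro n
    induction n using Nat.strong_induction_on with
    | _ n ih =>
    intro hn
    obtain ⟨n, rfl⟩ : ∃ m, n = m + 1 := ⟨n - 1, by omega⟩
    have e := coeff_mul_succ' P Q n
    have hlt : (p * PowerSeries.coeff (n + 1) Q).degree < p.degree + q.degree := by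
      have e2 : p * PowerSeries.coeff (n + 1) Q = PowerSeries.coeff (n + 1) (sw f) -
        ∑ i ∈ Finset.range (n + 1), PowerSeries.coeff (i + 1) P * PowerSeries.coeff (n + 1 - (i + 1)) Q := by
        rw [hPQ, e, hP0]; simp
      rw [e2]
      apply lt_of_le_of_lt (degree_sub_le _ _)
      rw [max_lt_iff]
      refine ⟨hdeg ▸ hfn _ hn, ?_⟩
      have hbot : (⊥ : WithBot ℕ) < p.degree + q.degree := by
        rw [degree_eq_natDegree hp.ne_zero, degree_eq_natDegree hq.ne_zero, ← Nat.cast_add]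
        exact WithBot.bot_lt_coe _
      apply lt_of_le_of_lt (degree_sum_le _ _)
      rw [Finset.sup_lt_iff hbot]
      intro i hi
      rw [degree_mul]
      have h1 := hPd (i + 1) (by omega)
      have h2 : (PowerSeries.coeff (n + 1 - (i + 1)) Q).degree ≤ q.degree := by
        rcases Nat.eq_zero_or_pos (n + 1 - (i + 1)) with h | h
        · rw [h, hQ0]
        · exact (ih _ (by omega) h).le
      calc _ ≤ (PowerSeries.coeff (i + 1) P).degree + q.degree := by gcongr
        _ < _ := by
          apply WithBot.add_lt_add_right _ h1
          exact degree_ne_bot.mpr hq.ne_zero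
    rw [degree_mul] at hlt
    exact lt_of_add_lt_add_left hlt
  obtain ⟨B, hB, hBm, hBd⟩ := sw_surj_monic Q q hq hQ0 hQd
  refine ⟨A, B, ?_, hAm, hBm, hAd, hBd, ?_, ?_⟩
  · apply sw_inj
    rw [map_mul, hA, hB, hPQ]
  · rw [← coeff_zero_sw, hA, hP0]
  · rw [← coeff_zero_sw, hB, hQ0]

end hensel
end Sat

end

noncomputable section
namespace Sat
open Polynomial

section puiseux

lemma ps_factor {k : Type*} [Field k] (a : PowerSeries k) :
    ∃ (o : ℕ) (u : PowerSeries k), a = PowerSeries.X ^ o * u ∧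
      (a ≠ 0 → PowerSeries.constantCoeff u ≠ 0) ∧ (a = 0 → u = 0) := by
  classical
  by_cases h : a = 0
  · exact ⟨0, 0, by simp [h], fun h' => absurd h h', fun _ => rfl⟩
  have hex : ∃ n, PowerSeries.coeff n a ≠ 0 := by
    by_contra hh
    push Not at hh
    exact h (PowerSeries.ext fun n => by simp [hh n])
  have hd : PowerSeries.X ^ (Nat.find hex) ∣ a := by
    rw [PowerSeries.X_pow_dvd_iff]
    intro m hm
    by_contra hne
    exact Nat.find_min hex hm hne
  obtain ⟨u, hu⟩ := hd
  refine ⟨Nat.find hex, u, hu, fun _ => ?_, fun h' => absurd h' h⟩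
  have h1 := Nat.find_spec hex
  generalize Nat.find hex = z at hu h1
  rw [hu, PowerSeries.coeff_X_pow_mul'] at h1
  simpa using h1

abbrev exx {k : Type*} [Field k] (N : ℕ) (hN : N ≠ 0) : PowerSeries k →+* PowerSeries k :=
  (PowerSeries.expand N hN : PowerSeries k →ₐ[k] PowerSeries k).toRingHom

/-- having a Puiseux root -/
def HasP (Q : Polynomial (PowerSeries ℂ)) : Prop :=
  ∃ (N : ℕ) (hN : N ≠ 0) (φ : PowerSeries ℂ), eval₂ (exx N hN) φ Q = 0

lemma HasP.mul {A : Polynomial (PowerSeries ℂ)} (h : HasP A) (B : Polynomial (PowerSeries ℂ)) :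
    HasP (A * B) := by
  obtain ⟨N, hN, φ, h⟩ := h
  exact ⟨N, hN, φ, by rw [eval₂_mul, h, zero_mul]⟩

lemma HasP.of_taylor {Q : Polynomial (PowerSeries ℂ)} (s : PowerSeries ℂ) (h : HasP (taylor s Q)) :
    HasP Q := by
  obtain ⟨N, hN, φ, h⟩ := h
  rw [taylor_apply, eval₂_comp] at h
  exact ⟨N, hN, _, h⟩

lemma HasP.of_expand {Q : Polynomial (PowerSeries ℂ)} (q : ℕ) (hq : q ≠ 0)
    (h : HasP (Q.map (exx q hq))) : HasP Q := by
  obtain ⟨N, hN, φ, h⟩ := h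
  refine ⟨N * q, mul_ne_zero hN hq, φ, ?_⟩
  rw [eval₂_map] at h
  rw [← h]
  congr 1
  ext1 x
  exact PowerSeries.expand_mul N hN q hq x

lemma HasP.of_scale {Q : Polynomial (PowerSeries ℂ)} (s : PowerSeries ℂ) (h : HasP Q) :
    HasP (scaleRoots Q s) := by
  obtain ⟨N, hN, φ, h⟩ := h
  exact ⟨N, hN, _, scaleRoots_eval₂_eq_zero _ h⟩

lemma taylor_next (Q : Polynomial (PowerSeries ℂ)) (hQ : Q.Monic) (n : ℕ) (hn : Q.natDegree = n + 1)
    (s : PowerSeries ℂ) : (taylor s Q).coeff n = Q.coeff n + (n + 1) * s := by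
  rw [taylor_coeff, eval_eq_sum_range' (n := 2)]
  · simp only [Finset.sum_range_succ, hasseDeriv_coeff]
    simp
    left
    rw [add_comm 1 n, ← hn, hQ.coeff_natDegree]
    rw [hn, mul_one, Nat.choose_succ_self_right]; simp
  · have := natDegree_hasseDeriv_le Q n
    omega

theorem puiseux : ∀ (n : ℕ) (Q : Polynomial (PowerSeries ℂ)), 1 ≤ n → Q.Monic → Q.natDegree = n →
    HasP Q := by
  intro n
  induction n using Nat.strong_induction_on with
  | _ n ih =>
  intro Q0 hn hQ0 hd0
  obtain ⟨n, rfl⟩ : ∃ m, n = m + 1 := ⟨n - 1, by omega⟩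
  -- Tschirnhaus
  have hnu : ((n : ℂ) + 1) ≠ 0 := by exact_mod_cast Nat.succ_ne_zero n
  let s : PowerSeries ℂ := - PowerSeries.C (((n : ℂ) + 1)⁻¹) * Q0.coeff n
  apply HasP.of_taylor s
  set Q := taylor s Q0 with hQdef
  have hQ : Q.Monic := by rw [Monic, hQdef, leadingCoeff_taylor, hQ0]
  have hd : Q.natDegree = n + 1 := by rw [hQdef, natDegree_taylor, hd0]
  have hc : Q.coeff n = 0 := by
    rw [hQdef, taylor_next Q0 hQ0 n hd0]
    have : ((n : PowerSeries ℂ) + 1) * PowerSeries.C (((n : ℂ) + 1)⁻¹) = 1 := by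
      have e : ((n : PowerSeries ℂ) + 1) = PowerSeries.C ((n : ℂ) + 1) := by simp
      rw [e, ← map_mul, mul_inv_cancel₀ hnu, map_one]
    simp only [s]
    linear_combination - Q0.coeff n * this
  clear_value Q
  clear hQdef s hd0 hQ0 Q0
  by_cases hz : ∀ i < n + 1, Q.coeff i = 0
  · refine ⟨1, one_ne_zero, 0, ?_⟩
    rw [eval₂_eq_eval_map, ← coeff_zero_eq_eval_zero, coeff_map, hz 0 (by omega), map_zero]
  push Not at hz
  choose o u hou hu1 hu0 using fun i => ps_factor (Q.coeff i)
  obtain ⟨i0, hi0, hmin⟩ : ∃ i0, (i0 < n + 1 ∧ Q.coeff i0 ≠ 0) ∧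
      ∀ i, i < n + 1 → Q.coeff i ≠ 0 → o i0 * (n + 1 - i) ≤ o i * (n + 1 - i0) := by
    classical
    have hne : ((Finset.range (n + 1)).filter fun i => Q.coeff i ≠ 0).Nonempty := by
      obtain ⟨i, hi, h⟩ := hz
      exact ⟨i, by simp only [Finset.mem_filter, Finset.mem_range]; exact ⟨hi, h⟩⟩
    obtain ⟨i0, hi0, hmin⟩ := Finset.exists_min_image _
      (fun i => (o i : ℚ) / ((n + 1 - i : ℕ) : ℚ)) hne
    simp only [Finset.mem_filter, Finset.mem_range] at hi0 hmin
    refine ⟨i0, hi0, fun i hi hne => ?_⟩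
    have := hmin i ⟨hi, hne⟩
    rw [div_le_div_iff₀] at this
    · exact_mod_cast this
    · have := hi0.1
      exact_mod_cast (by omega : 0 < n + 1 - i0)
    · exact_mod_cast (by omega : 0 < n + 1 - i)
  set q := n + 1 - i0 with hq
  have hq0 : q ≠ 0 := by have := hi0.1; omega
  set p := o i0 with hp
  let b : ℕ → PowerSeries ℂ := fun i => PowerSeries.X ^ (q * o i - p * (n + 1 - i)) * exx q hq0 (u i)
  have hX : exx q hq0 (PowerSeries.X : PowerSeries ℂ) = PowerSeries.X ^ q :=
    PowerSeries.expand_X q hq0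
  have hb : ∀ i, i < n + 1 → exx q hq0 (Q.coeff i) = b i * (PowerSeries.X ^ p) ^ (n + 1 - i) := by
    intro i hi
    by_cases h0 : Q.coeff i = 0
    · simp [b, h0, hu0 i h0]
    · conv_lhs => rw [hou i]
      rw [map_mul, map_pow, hX, ← pow_mul, ← pow_mul]
      have := hmin i hi h0
      rw [mul_comm (o i)] at this
      have e : q * o i = (q * o i - p * (n + 1 - i)) + p * (n + 1 - i) := by omega
      conv_lhs => rw [e, pow_add]
      simp only [b]; ring
  let B : Polynomial (PowerSeries ℂ) := ∑ i ∈ Finset.range (n + 1), monomial i (b i)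
  have hBc : ∀ i, B.coeff i = if i < n + 1 then b i else 0 := by
    intro i
    simp only [B, finsetSum_coeff, coeff_monomial, Finset.sum_ite_eq', Finset.mem_range]
  have hBd : B.degree < ((n + 1 : ℕ) : WithBot ℕ) := by
    rw [degree_lt_iff_coeff_zero]
    intro m hm
    rw [hBc, if_neg (not_lt.mpr hm)]
  set Q' := X ^ (n + 1) + B with hQ'
  have hQ'm : Q'.Monic := monic_X_pow_add hBd
  have hQ'd : Q'.natDegree = n + 1 := by
    apply natDegree_eq_of_degree_eq_some
    rw [degree_add_eq_left_of_degree_lt (by rwa [degree_X_pow]), degree_X_pow]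
  have hQ'c : ∀ i, i < n + 1 → Q'.coeff i = b i := by
    intro i hi
    rw [hQ', coeff_add, coeff_X_pow, if_neg (by omega), hBc, if_pos hi, zero_add]
  apply HasP.of_expand q hq0
  have hsc : Q.map (exx q hq0) = scaleRoots Q' (PowerSeries.X ^ p) := by
    ext1 i
    rw [coeff_map, coeff_scaleRoots, hQ'd]
    rcases lt_trichotomy i (n + 1) with h | h | h
    · rw [hb i h, hQ'c i h]
    · rw [h]
      conv_lhs => rw [← hd, hQ.coeff_natDegree]
      conv_rhs => rw [← hQ'd, hQ'm.coeff_natDegree]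
      simp
    · rw [coeff_eq_zero_of_natDegree_lt (by omega), coeff_eq_zero_of_natDegree_lt (by omega)]
      simp
  rw [hsc]
  apply HasP.of_scale
  -- reduction mod t
  set g := Q'.map PowerSeries.constantCoeff with hg
  have hgm : g.Monic := hQ'm.map _
  have hgd : g.natDegree = n + 1 := by rw [hg, hQ'm.natDegree_map, hQ'd]
  have hgn : g.coeff n = 0 := by
    rw [hg, coeff_map, hQ'c n (by omega)]
    simp [b, hu0 n hc]
  have hgi : g.coeff i0 ≠ 0 := by
    rw [hg, coeff_map, hQ'c i0 hi0.1]
    simp only [b]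
    have : q * o i0 - p * (n + 1 - i0) = 0 := by rw [← hq, ← hp, mul_comm]; omega
    rw [this, pow_zero, one_mul]
    have := PowerSeries.constantCoeff_expand q hq0 (u i0)
    change PowerSeries.constantCoeff (PowerSeries.expand q hq0 (u i0)) ≠ 0
    rw [this]
    exact hu1 i0 hi0.2
  obtain ⟨c, hcr⟩ := Complex.exists_root (f := g) (by
    rw [← natDegree_pos_iff_degree_pos, hgd]; omega)
  obtain ⟨h, hgh, hnd⟩ := g.exists_eq_pow_rootMultiplicity_mul_and_not_dvd hgm.ne_zero c
  set m := g.rootMultiplicity c with hm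
  have hm1 : 0 < m := (rootMultiplicity_pos hgm.ne_zero).mpr hcr
  have hpm : ((X - C c) ^ m).Monic := (monic_X_sub_C c).pow m
  have hhm : h.Monic := by
    rw [hgh] at hgm
    exact hpm.of_mul_monic_left hgm
  have hdeg : n + 1 = m + h.natDegree := by
    rw [← hgd, hgh, hpm.natDegree_mul hhm, natDegree_pow, natDegree_X_sub_C, mul_one]
  have hmn : m < n + 1 := by
    by_contra hcon
    have hmeq : m = n + 1 := by omega
    have hh1 : h = 1 := by
      exact Polynomial.eq_one_of_monic_natDegree_zero hhm (by omega)
    rw [hh1, mul_one, hmeq, sub_eq_add_neg, ← C_neg] at hgh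
    have h1 := hgn
    rw [hgh, coeff_X_add_C_pow] at h1
    simp only [Nat.add_sub_cancel_left, pow_one, Nat.choose_succ_self_right, Nat.cast_add,
      Nat.cast_one] at h1
    have hc0 : -c = 0 := by
      rcases mul_eq_zero.mp h1 with h | h
      · exact h
      · exact absurd (by exact_mod_cast h) hnu
    apply hgi
    rw [hgh, hc0, C_0, add_zero, coeff_X_pow, if_neg (by have := hi0.1; omega)]
  have hcop : IsCoprime ((X - C c) ^ m) h := by
    apply IsCoprime.pow_left
    exact ((irreducible_X_sub_C c).coprime_iff_not_dvd).mpr hnd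
  obtain ⟨P, R, hPR, hPm, -, hPd, -⟩ := hensel_poly Q' hQ'm _ h hpm hhm hcop hgh
  rw [hPR]
  refine HasP.mul (ih m hmn P hm1 hPm ?_) R
  rw [hPd, natDegree_pow, natDegree_X_sub_C, mul_one]

end puiseux
end Sat

end

noncomputable section
namespace Sat
open Polynomial

section bez
open nonZeroDivisors

theorem bezC {R : Type*} [CommRing R] [IsDomain R] [UniqueFactorizationMonoid R]
    (f g : Polynomial R) (hf : f ≠ 0)
    (h : ∀ p : Polynomial R, Irreducible p → p.natDegree ≠ 0 → p ∣ f → p ∣ g → False) :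
    ∃ (u v : Polynomial R) (d : R), d ≠ 0 ∧ u * f + v * g = C d := by
  by_cases hdeg : f.natDegree = 0
  · rw [natDegree_eq_zero] at hdeg
    obtain ⟨a, rfl⟩ := hdeg
    exact ⟨1, 0, a, by rintro rfl; simp at hf, by simp⟩
  obtain ⟨p, q, -, -, e⟩ := exists_mul_add_mul_eq_C_resultant f g le_rfl le_rfl (Or.inl hdeg)
  refine ⟨p, q, _, ?_, by rw [← e]; ring⟩
  intro h0
  let : NormalizedGCDMonoid R := Nonempty.some inferInstance
  let K := FractionRing R
  let φ := algebraMap R K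
  have hφ : Function.Injective φ := IsFractionRing.injective R K
  have h1 : resultant (f.map φ) (g.map φ) = 0 := by
    rw [natDegree_map_eq_of_injective hφ, natDegree_map_eq_of_injective hφ, resultant_map_map, h0,
      map_zero]
  rw [resultant_eq_zero_iff] at h1
  have hfK : f.map φ ≠ 0 := by rwa [Ne, Polynomial.map_eq_zero_iff hφ]
  obtain ⟨-, hnc⟩ := h1
  obtain ⟨r, hr, hrf, hrg⟩ : ∃ r : Polynomial K, Irreducible r ∧ r ∣ f.map φ ∧ r ∣ g.map φ := by
    by_contra hcon
    push Not at hcon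
    apply hnc
    apply isCoprime_of_prime_dvd
    · rintro ⟨h, -⟩; exact hfK h
    · intro z hz h1 h2
      exact hcon z hz.irreducible h1 h2
  let s := IsLocalization.integerNormalization R⁰ r
  obtain ⟨b, hb, hs⟩ := IsLocalization.integerNormalization_spec R⁰ r
  have hb0 : φ b ≠ 0 := by
    rw [Ne, map_eq_zero_iff φ hφ]
    exact nonZeroDivisors.ne_zero hb
  have hs' : s.map φ = C (φ b) * r := by
    rw [← smul_eq_C_mul]
    change _ = _ at hs
    rw [hs, algebraMap_smul]
  have hs0 : s ≠ 0 := by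
    intro h
    rw [h, Polynomial.map_zero] at hs'
    exact (mul_ne_zero (C_ne_zero.mpr hb0) hr.ne_zero) hs'.symm
  have hcont : φ s.content ≠ 0 := by
    rw [Ne, map_eq_zero_iff φ hφ, content_eq_zero_iff]
    exact hs0
  have hsp : C (φ s.content) * s.primPart.map φ = C (φ b) * r := by
    rw [← hs', ← map_C, ← Polynomial.map_mul, ← eq_C_content_mul_primPart]
  have hass : Associated (s.primPart.map φ) r := by
    have a1 : Associated (C (φ s.content) * s.primPart.map φ) (s.primPart.map φ) :=
      associated_unit_mul_left _ _ (isUnit_C.mpr hcont.isUnit)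
    have a2 : Associated (C (φ b) * r) r :=
      associated_unit_mul_left _ _ (isUnit_C.mpr hb0.isUnit)
    rw [hsp] at a1
    exact a1.symm.trans a2
  have hprim := s.isPrimitive_primPart
  refine h s.primPart ?_ ?_ ?_ ?_
  · rw [hprim.irreducible_iff_irreducible_map_fraction_map (K := K)]
    exact hass.irreducible_iff.mpr hr
  · rw [← natDegree_map_eq_of_injective hφ, natDegree_eq_of_degree_eq (degree_eq_degree_of_associated hass)]
    exact hr.natDegree_pos.ne'
  · rw [hprim.dvd_iff_fraction_map_dvd_fraction_map K]
    exact hass.dvd.trans hrf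
  · rw [hprim.dvd_iff_fraction_map_dvd_fraction_map K]
    exact hass.dvd.trans hrg

end bez

section monic_core

abbrev io : PowerSeries ℝ →+* PowerSeries ℂ := PowerSeries.map Complex.ofRealHom
abbrev kap : PowerSeries ℂ →+* PowerSeries ℂ := PowerSeries.map (starRingEnd ℂ)

lemma io_inj : Function.Injective io := by
  intro a b h
  ext n
  have := congrArg (PowerSeries.coeff n) h
  simpa using this

lemma kap_io (a : PowerSeries ℝ) : kap (io a) = io a := by
  ext n; simp

lemma kap_kap (a : PowerSeries ℂ) : kap (kap a) = a := by
  ext n; simp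

lemma ps_decomp (a : PowerSeries ℂ) : ∃ b c : PowerSeries ℝ, a = io b + PowerSeries.C Complex.I * io c := by
  refine ⟨PowerSeries.mk fun n => (PowerSeries.coeff n a).re,
    PowerSeries.mk fun n => (PowerSeries.coeff n a).im, ?_⟩
  ext n
  simp only [map_add, PowerSeries.coeff_map, PowerSeries.coeff_mk, PowerSeries.coeff_C_mul]
  rw [mul_comm]
  exact (Complex.re_add_im _).symm

lemma poly_decomp (Q : Polynomial (PowerSeries ℂ)) : ∃ A B : Polynomial (PowerSeries ℝ),
    Q = A.map io + C (PowerSeries.C Complex.I) * B.map io := by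
  induction Q using Polynomial.induction_on' with
  | add p q hp hq =>
    obtain ⟨A, B, h⟩ := hp
    obtain ⟨A', B', h'⟩ := hq
    refine ⟨A + A', B + B', ?_⟩
    rw [h, h', Polynomial.map_add, Polynomial.map_add]; ring
  | monomial n a =>
    obtain ⟨b, c, h⟩ := ps_decomp a
    refine ⟨monomial n b, monomial n c, ?_⟩
    rw [map_monomial, map_monomial, C_mul_monomial, ← map_add, ← h]

lemma map_kap_io (A : Polynomial (PowerSeries ℝ)) : (A.map io).map kap = A.map io := by
  ext1 n; rw [coeff_map, coeff_map, kap_io]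

lemma map_kap_decomp (A B : Polynomial (PowerSeries ℝ)) :
    (A.map io + C (PowerSeries.C Complex.I) * B.map io).map kap =
      A.map io - C (PowerSeries.C Complex.I) * B.map io := by
  rw [Polynomial.map_add, Polynomial.map_mul, map_kap_io, map_kap_io, map_C]
  have : kap (PowerSeries.C Complex.I) = - PowerSeries.C Complex.I := by simp
  rw [this, C_neg]
  ring

lemma map_norm (A B : Polynomial (PowerSeries ℝ)) :
    (A.map io + C (PowerSeries.C Complex.I) * B.map io) * 
      (A.map io - C (PowerSeries.C Complex.I) * B.map io) = (A ^ 2 + B ^ 2).map io := by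
  have : (C (PowerSeries.C Complex.I) : Polynomial (PowerSeries ℂ)) ^ 2 = -1 := by
    rw [← map_pow, ← map_pow, Complex.I_sq]; simp
  rw [Polynomial.map_add, Polynomial.map_pow, Polynomial.map_pow]
  linear_combination - (B.map io) ^ 2 * this

/-- substitution `v = ε t ^ N` -/
abbrev sub {k : Type*} [Field k] (N : ℕ) (hN : N ≠ 0) (ε : k) : PowerSeries k →+* PowerSeries k :=
  (exx N hN).comp (PowerSeries.rescale ε)

def NoBranch (G : Polynomial (PowerSeries ℝ)) : Prop :=
  ∀ (N : ℕ) (hN : N ≠ 0) (ε : ℝ) (ψ : PowerSeries ℝ), (ε = 1 ∨ ε = -1) →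
    eval₂ (sub N hN ε) ψ G ≠ 0

lemma rescale_exx (N : ℕ) (hN : N ≠ 0) (η : ℂ) (a : PowerSeries ℂ) :
    PowerSeries.rescale η (exx N hN a) = exx N hN (PowerSeries.rescale (η ^ N) a) := by
  ext n
  change PowerSeries.coeff n (PowerSeries.rescale η (PowerSeries.expand N hN a)) =
    PowerSeries.coeff n (PowerSeries.expand N hN _)
  rw [PowerSeries.coeff_rescale, PowerSeries.coeff_expand, PowerSeries.coeff_expand]
  split_ifs with h
  · obtain ⟨m, rfl⟩ := h
    rw [Nat.mul_div_cancel_left m (Nat.pos_of_ne_zero hN), PowerSeries.coeff_rescale, pow_mul]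
  · simp

lemma exx_inj {k : Type*} [Field k] (N : ℕ) (hN : N ≠ 0) :
    Function.Injective (exx N hN : PowerSeries k →+* PowerSeries k) := by
  intro a b h
  ext n
  have h1 : PowerSeries.coeff (N * n) (PowerSeries.expand N hN a) =
    PowerSeries.coeff (N * n) (PowerSeries.expand N hN b) := congrArg (PowerSeries.coeff (N * n)) h
  rwa [PowerSeries.coeff_expand_mul, PowerSeries.coeff_expand_mul] at h1

lemma mem_range_exx (N : ℕ) (hN : N ≠ 0) (ζ : ℂ) (hζ : IsPrimitiveRoot ζ N) (c : PowerSeries ℂ)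
    (hc : PowerSeries.rescale ζ c = c) : c ∈ Set.range (exx N hN : PowerSeries ℂ →+* PowerSeries ℂ) := by
  refine ⟨PowerSeries.mk fun j => PowerSeries.coeff (N * j) c, ?_⟩
  ext n
  change PowerSeries.coeff n (PowerSeries.expand N hN _) = _
  rw [PowerSeries.coeff_expand]
  split_ifs with h
  · obtain ⟨m, rfl⟩ := h
    rw [Nat.mul_div_cancel_left m (Nat.pos_of_ne_zero hN), PowerSeries.coeff_mk]
  · have h1 := congrArg (PowerSeries.coeff n) hc
    rw [PowerSeries.coeff_rescale] at h1
    have h2 : (ζ ^ n - 1) * PowerSeries.coeff n c = 0 := by linear_combination h1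
    rcases mul_eq_zero.mp h2 with h3 | h3
    · exact absurd ((hζ.pow_eq_one_iff_dvd n).mp (sub_eq_zero.mp h3)) h
    · exact h3.symm

lemma kap_exx (N : ℕ) (hN : N ≠ 0) (a : PowerSeries ℂ) : kap (exx N hN a) = exx N hN (kap a) := by
  exact PowerSeries.map_expand N hN (starRingEnd ℂ) a

lemma sq_eq_one_iff_of_pm {z : ℂ} (h : z ^ 2 = 1) : z = 1 ∨ z = -1 := by
  have : (z - 1) * (z + 1) = 0 := by linear_combination h
  rcases mul_eq_zero.mp this with h | h
  · exact Or.inl (sub_eq_zero.mp h)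
  · exact Or.inr (eq_neg_of_add_eq_zero_left h)

lemma real_branch (Q : Polynomial (PowerSeries ℂ)) (hQm : Q.Monic) (hQi : Irreducible Q)
    (hQ : Q.map kap = Q) :
    ∃ (N : ℕ) (hN : N ≠ 0) (ε : ℝ) (ψ : PowerSeries ℝ), (ε = 1 ∨ ε = -1) ∧
      eval₂ (sub N hN (ε : ℂ)) (io ψ) Q = 0 := by
  have hQd : 1 ≤ Q.natDegree := by
    rcases Nat.eq_zero_or_pos Q.natDegree with h | h
    · exact absurd (eq_one_of_monic_natDegree_zero hQm h) hQi.ne_one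
    · exact h
  obtain ⟨N, hN, φ, hφ⟩ := puiseux _ Q hQd hQm rfl
  let ζ := Complex.exp (2 * Real.pi * Complex.I / N)
  have hζ : IsPrimitiveRoot ζ N := Complex.isPrimitiveRoot_exp N hN
  let rr : ℕ → Polynomial (PowerSeries ℂ) := fun j => X - C (PowerSeries.rescale (ζ ^ j) φ)
  let R : Polynomial (PowerSeries ℂ) := ∏ j ∈ Finset.range N, rr j
  have hrr : ∀ j, (rr j).map (PowerSeries.rescale ζ) = rr (j + 1) := by
    intro j
    simp only [rr, Polynomial.map_sub, map_X, map_C, PowerSeries.rescale_rescale, ← pow_succ]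
  have hRinv : R.map (PowerSeries.rescale ζ) = R := by
    have e0 : rr N = rr 0 := by simp [rr, hζ.pow_eq_one]
    obtain ⟨M, rfl⟩ : ∃ M, N = M + 1 := ⟨N - 1, by omega⟩
    simp only [R, Polynomial.map_prod, hrr]
    rw [Finset.prod_range_succ, Finset.prod_range_succ', e0]
  have hlift : R ∈ lifts (exx N hN : PowerSeries ℂ →+* PowerSeries ℂ) := by
    rw [lifts_iff_coeff_lifts]
    intro n
    apply mem_range_exx N hN ζ hζ
    conv_rhs => rw [← hRinv]
    rw [coeff_map]
  rw [mem_lifts] at hlift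
  obtain ⟨R', hR'⟩ := hlift
  have hR'φ : eval₂ (exx N hN) φ R' = 0 := by
    rw [eval₂_eq_eval_map, hR', eval_prod]
    apply Finset.prod_eq_zero (Finset.mem_range.mpr (Nat.pos_of_ne_zero hN))
    simp [rr]
  have hdvd : Q ∣ R' := by
    by_contra hnd
    obtain ⟨u, v, d, hd, e⟩ := bezC Q R' hQm.ne_zero (fun p hp _ h1 h2 => by
      have := hp.associated_of_dvd hQi h1
      exact hnd (this.symm.dvd.trans h2))
    have e2 := congrArg (eval₂ (exx N hN) φ) e
    rw [eval₂_add, eval₂_mul, eval₂_mul, hφ, hR'φ, eval₂_C] at e2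
    simp only [mul_zero, add_zero] at e2
    exact hd ((map_eq_zero_iff _ (exx_inj N hN)).mp e2.symm)
  have hconj : eval₂ (exx N hN) (kap φ) Q = 0 := by
    have h1 := congrArg kap hφ
    rw [hom_eval₂, map_zero] at h1
    have h2 : kap.comp (exx N hN) = (exx N hN).comp kap := by
      ext1 a; exact kap_exx N hN a
    rw [h2, ← eval₂_map, hQ] at h1
    exact h1
  obtain ⟨S, hS⟩ := hdvd
  have hz : eval (kap φ) R = 0 := by
    rw [← hR', ← eval₂_eq_eval_map, hS, eval₂_mul, hconj, zero_mul]
  rw [eval_prod, Finset.prod_eq_zero_iff] at hz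
  obtain ⟨j, -, hj⟩ := hz
  simp only [rr, eval_sub, eval_X, eval_C] at hj
  have hj' : kap φ = PowerSeries.rescale (ζ ^ j) φ := sub_eq_zero.mp hj
  obtain ⟨η, hη⟩ := IsAlgClosed.exists_pow_nat_eq (ζ ^ j) (n := 2) (by norm_num)
  have hηN : (η ^ N) ^ 2 = 1 := by
    rw [← pow_mul, mul_comm, pow_mul, hη, ← pow_mul, mul_comm, pow_mul, hζ.pow_eq_one, one_pow]
  have hη1 : ‖η‖ = 1 := by
    have : ‖η‖ ^ (N * 2) = 1 := by rw [← norm_pow, pow_mul, hηN, norm_one]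
    exact (pow_eq_one_iff_of_nonneg (norm_nonneg _) (by omega)).mp this
  have hηc : (starRingEnd ℂ) η * η = 1 := by
    rw [mul_comm, Complex.mul_conj, Complex.normSq_eq_norm_sq, hη1]; simp
  have hψ : kap (PowerSeries.rescale η φ) = PowerSeries.rescale η φ := by
    have e1 : kap (PowerSeries.rescale η φ) = PowerSeries.rescale ((starRingEnd ℂ) η) (kap φ) := by
      ext n; simp
    rw [e1, hj', PowerSeries.rescale_rescale, ← hη]
    congr 2
    linear_combination η * hηc
  obtain ⟨ψ, c, hψc⟩ := ps_decomp (PowerSeries.rescale η φ)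
  have hc0 : PowerSeries.rescale η φ = io ψ := by
    ext n
    have h1 := congrArg (PowerSeries.coeff n) hψ
    have h2 := congrArg (PowerSeries.coeff n) hψc
    simp only [PowerSeries.coeff_map, map_add, PowerSeries.coeff_C_mul] at h1 h2 ⊢
    rw [h2] at h1 ⊢
    have h3 := congrArg Complex.im h1
    simp at h3
    have h4 : PowerSeries.coeff n c = 0 := by linarith
    simp [h4]
  have hev : ∀ ε : ℝ, η ^ N = ε → eval₂ (sub N hN (ε : ℂ)) (io ψ) Q = 0 := by
    intro ε hε
    have h1 := congrArg (PowerSeries.rescale η) hφ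
    rw [hom_eval₂, map_zero, hc0] at h1
    rw [← h1]
    congr 1
    ext1 a
    rw [← hε]
    exact (rescale_exx N hN η a).symm
  rcases sq_eq_one_iff_of_pm hηN with h | h
  · exact ⟨N, hN, 1, ψ, Or.inl rfl, hev 1 (by simp [h])⟩
  · exact ⟨N, hN, -1, ψ, Or.inr rfl, hev (-1) (by simp [h])⟩

lemma no_branch_ne {G : Polynomial (PowerSeries ℝ)} (hG : NoBranch G)
    {N : ℕ} {hN : N ≠ 0} {ε : ℝ} {ψ : PowerSeries ℝ} (hε : ε = 1 ∨ ε = -1) :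
    eval₂ (sub N hN (ε : ℂ)) (io ψ) (G.map io) ≠ 0 := by
  intro h
  apply hG N hN ε ψ hε
  apply io_inj
  rw [map_zero, hom_eval₂, ← h, eval₂_map]
  congr 1
  ext1 a
  have e1 := PowerSeries.map_expand N hN Complex.ofRealHom (PowerSeries.rescale ε a)
  refine e1.symm.symm.trans ?_
  change exx N hN _ = exx N hN _
  congr 1
  ext n; simp

theorem monic_core : ∀ (n : ℕ) (G : Polynomial (PowerSeries ℝ)), G.Monic → G.natDegree = n →
    NoBranch G → ∃ A B : Polynomial (PowerSeries ℝ), G = A ^ 2 + B ^ 2 := by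
  intro n
  induction n using Nat.strong_induction_on with
  | _ n ih =>
  intro G hG hn hNB
  rcases Nat.eq_zero_or_pos n with rfl | hpos
  · exact ⟨1, 0, by rw [eq_one_of_monic_natDegree_zero hG hn]; ring⟩
  have hGC : (G.map io).Monic := hG.map _
  have hGd : (G.map io).natDegree = n := by rw [hG.natDegree_map, hn]
  obtain ⟨Q0, hQ0i, hQ0d⟩ := WfDvdMonoid.exists_irreducible_factor (a := G.map io)
    (by intro hu; have := hGC.eq_one_of_isUnit hu; rw [this] at hGd; simp at hGd; omega)
    hGC.ne_zero
  have hu := hGC.isUnit_leadingCoeff_of_dvd hQ0d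
  obtain ⟨Q, hQm, hQi, hQd⟩ : ∃ Q : Polynomial (PowerSeries ℂ), Q.Monic ∧ Irreducible Q ∧ Q ∣ G.map io := by
    obtain ⟨w, hw⟩ := hu
    refine ⟨C (↑w⁻¹ : PowerSeries ℂ) * Q0, ?_, ?_, ?_⟩
    · rw [Monic, leadingCoeff_mul, leadingCoeff_C, ← hw]; simp
    · rw [irreducible_isUnit_mul (isUnit_C.mpr w⁻¹.isUnit)]; exact hQ0i
    · rw [(isUnit_C.mpr w⁻¹.isUnit).mul_left_dvd]; exact hQ0d
  by_cases hQ : Q.map kap = Q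
  · obtain ⟨N, hN, ε, ψ, hε, h⟩ := real_branch Q hQm hQi hQ
    obtain ⟨S, hS⟩ := hQd
    exact absurd (by rw [hS, eval₂_mul, h, zero_mul]) (no_branch_ne hNB (N := N) (hN := hN) (ψ := ψ) hε)
  have hkm : (Q.map kap).Monic := hQm.map _
  have hkd : Q.map kap ∣ G.map io := by
    have := Polynomial.map_dvd kap hQd
    rwa [map_kap_io] at this
  have hna : ¬ Q ∣ Q.map kap := by
    rintro ⟨S, hS⟩
    have hSm : S.Monic := hQm.of_mul_monic_left (hS ▸ hkm)
    have h1 : (Q.map kap).natDegree = Q.natDegree := hQm.natDegree_map _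
    rw [hS, hQm.natDegree_mul hSm] at h1
    have h2 : S = 1 := eq_one_of_monic_natDegree_zero hSm (by omega)
    rw [h2, mul_one] at hS
    exact hQ hS
  have hmul : Q * Q.map kap ∣ G.map io := by
    obtain ⟨S, hS⟩ := hkd
    rw [hS, mul_comm]
    apply mul_dvd_mul_left
    rw [hS] at hQd
    exact (hQi.prime.dvd_or_dvd hQd).resolve_left hna
  obtain ⟨A, B, hAB⟩ := poly_decomp Q
  have hk := map_kap_decomp A B
  rw [← hAB] at hk
  have hN := map_norm A B
  rw [← hAB, ← hk] at hN
  have hHm : (A ^ 2 + B ^ 2).Monic := by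
    have h1 : (Q * Q.map kap).Monic := hQm.mul hkm
    rw [hN] at h1
    exact monic_of_injective io_inj h1
  have hHd : (A ^ 2 + B ^ 2).natDegree = Q.natDegree + Q.natDegree := by
    rw [← hHm.natDegree_map io, ← hN, hQm.natDegree_mul hkm, hQm.natDegree_map]
  rw [hN, map_dvd_map io io_inj hHm] at hmul
  obtain ⟨L, hL⟩ := hmul
  have hLm : L.Monic := hHm.of_mul_monic_left (hL ▸ hG)
  have hQpos : 0 < Q.natDegree := by
    rcases Nat.eq_zero_or_pos Q.natDegree with h | h
    · exact absurd (eq_one_of_monic_natDegree_zero hQm h) hQi.ne_one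
    · exact h
  have hLd : n = Q.natDegree + Q.natDegree + L.natDegree := by
    rw [← hn, hL, hHm.natDegree_mul hLm, hHd]
  obtain ⟨C', D', hCD⟩ := ih L.natDegree (by omega) L hLm rfl (by
    intro N hN ε ψ hε h
    apply hNB N hN ε ψ hε
    rw [hL, eval₂_mul, h, mul_zero])
  refine ⟨A * C' - B * D', A * D' + B * C', ?_⟩
  rw [hL, hCD]; ring

end monic_core
end Sat

end

noncomputable section
namespace Sat
open Polynomial

section analytic

lemma poly_split (p : Polynomial ℝ) (hp : p ≠ 0) (r : ℝ) : ∃ (e : ℕ) (b : Polynomial ℝ),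
    p = (X - C r) ^ e * b ∧ b.eval r ≠ 0 := by
  obtain ⟨b, hb, hnd⟩ := p.exists_eq_pow_rootMultiplicity_mul_and_not_dvd hp r
  exact ⟨_, b, hb, fun h => hnd (dvd_iff_isRoot.mpr h)⟩

lemma near_pos (b : Polynomial ℝ) (r : ℝ) (hb : 0 < b.eval r) :
    ∃ δ > 0, ∀ x, |x - r| < δ → b.eval r / 2 < b.eval x := by
  have hc : ContinuousAt (fun x => b.eval x) r := b.continuous.continuousAt
  have := hc.eventually (lt_mem_nhds (show b.eval r / 2 < b.eval r by linarith))
  obtain ⟨δ, hδ, h⟩ := Metric.eventually_nhds_iff.mp this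
  exact ⟨δ, hδ, fun x hx => h (by rwa [Real.dist_eq])⟩

lemma poly_lower (p : Polynomial ℝ) (hp : p ≠ 0) (r : ℝ) : ∃ (e : ℕ) (c δ : ℝ), 0 < c ∧ 0 < δ ∧
    ∀ x, |x - r| < δ → c * |x - r| ^ e ≤ |p.eval x| := by
  obtain ⟨e, b, hpb, hb⟩ := poly_split p hp r
  have hb2 : 0 < (b ^ 2).eval r := by rw [eval_pow]; positivity
  obtain ⟨δ, hδ, h⟩ := near_pos (b ^ 2) r hb2
  refine ⟨e, |b.eval r| / 2, δ, by positivity, hδ, fun x hx => ?_⟩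
  have h1 := h x hx
  simp only [eval_pow] at h1
  have h2 : |b.eval r| / 2 ≤ |b.eval x| := by
    rw [← sq_abs, ← sq_abs (b.eval x)] at h1
    have := abs_nonneg (b.eval r)
    have := abs_nonneg (b.eval x)
    by_contra hcon
    push Not at hcon
    nlinarith
  rw [hpb, eval_mul, eval_pow, eval_sub, eval_X, eval_C, abs_mul, abs_pow, mul_comm]
  gcongr

lemma poly_upper (g : Polynomial ℝ) (M : ℕ) (h : X ^ M ∣ g) : ∃ C₀ : ℝ, 0 ≤ C₀ ∧
    ∀ t, |t| ≤ 1 → |g.eval t| ≤ C₀ * |t| ^ M := by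
  obtain ⟨b, rfl⟩ := h
  obtain ⟨C₀, hC⟩ := (isCompact_Icc (a := (-1 : ℝ)) (b := 1)).exists_bound_of_continuousOn
    (f := fun x => b.eval x) b.continuous.continuousOn
  refine ⟨C₀, le_trans (norm_nonneg _) (hC 0 (by simp)), fun t ht => ?_⟩
  have := hC t (by rw [abs_le] at ht; exact ht)
  rw [eval_mul, eval_pow, eval_X, abs_mul, abs_pow, mul_comm]
  gcongr
  exact this

lemma powers_absurd {c C₀ δ : ℝ} (hc : 0 < c) (hδ : 0 < δ) (K : ℕ)
    (h : ∀ t : ℝ, 0 < t → t < δ → c * t ^ K ≤ C₀ * t ^ (K + 1)) : False := by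
  have hC : 0 < |C₀| + 1 := by positivity
  set t := min (δ / 2) (c / (2 * (|C₀| + 1))) with ht
  have ht0 : 0 < t := by rw [ht]; positivity
  have h1 := h t ht0 (lt_of_le_of_lt (min_le_left _ _) (by linarith))
  have h2 : t * (2 * (|C₀| + 1)) ≤ c := by
    rw [← le_div_iff₀ (by positivity)]; exact min_le_right _ _
  have h3 : c ≤ C₀ * t := by
    have : c * t ^ K ≤ (C₀ * t) * t ^ K := by rw [pow_succ] at h1; linarith
    exact le_of_mul_le_mul_right this (by positivity)
  have := le_abs_self C₀
  nlinarith

abbrev coP : Polynomial ℝ →+* PowerSeries ℝ := Polynomial.coeToPowerSeries.ringHom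

lemma coP_inj : Function.Injective coP := fun _ _ h => Polynomial.coe_injective ℝ h

lemma coP_dvd (g : Polynomial ℝ) (M : ℕ) (h : PowerSeries.X ^ M ∣ coP g) : X ^ M ∣ g := by
  rw [PowerSeries.X_pow_dvd_iff] at h
  rw [X_pow_dvd_iff]
  intro d hd
  have := h d hd
  simpa using this

lemma trunc_dvd (ψ : PowerSeries ℝ) (M : ℕ) :
    PowerSeries.X ^ M ∣ ψ - coP (PowerSeries.trunc M ψ) := by
  rw [PowerSeries.X_pow_dvd_iff]
  intro m hm
  simp [PowerSeries.coeff_trunc, hm]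

lemma noBranch_of_bound (G : P2) (c δ : ℝ) (hc : 0 < c) (hδ : 0 < δ) (K : ℕ)
    (h : ∀ v w, |v| < δ → v ≠ 0 → c * |v| ^ K ≤ |ev v w G|) : NoBranch (G.map coP) := by
  intro N hN ε ψ hε h0
  have hεa : |ε| = 1 := by rcases hε with rfl | rfl <;> simp
  set M := N * K + 1
  let ψM := PowerSeries.trunc M ψ
  let θ : Polynomial ℝ →+* Polynomial ℝ := eval₂RingHom C (C ε * X ^ N)
  let g : Polynomial ℝ := eval₂ θ ψM G
  have hθ : coP.comp θ = (sub N hN ε).comp coP := by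
    apply Polynomial.ringHom_ext
    · intro a
      simp only [θ, RingHom.comp_apply, coe_eval₂RingHom, eval₂_C, coeToPowerSeries.ringHom_apply,
        coe_C]
      have : PowerSeries.rescale ε (PowerSeries.C a) = PowerSeries.C a := by
        ext n; rw [PowerSeries.coeff_rescale, PowerSeries.coeff_C]; split_ifs with h <;> simp [h]
      rw [this]
      exact (PowerSeries.expand_C N hN a).symm
    · simp only [θ, RingHom.comp_apply, coe_eval₂RingHom, eval₂_X, coeToPowerSeries.ringHom_apply,
        coe_X, PowerSeries.rescale_X, map_mul]
      have h1 : exx N hN (PowerSeries.C ε) = PowerSeries.C ε := PowerSeries.expand_C N hN ε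
      have h2 : exx N hN (PowerSeries.X : PowerSeries ℝ) = PowerSeries.X ^ N := PowerSeries.expand_X N hN
      rw [h1, h2]
      simp
  have hg : coP g = eval (coP ψM) ((G.map coP).map (sub N hN ε)) := by
    simp only [g]
    rw [hom_eval₂, hθ, ← eval₂_map, eval₂_eq_eval_map]
  have hdiv : X ^ M ∣ g := by
    apply coP_dvd
    rw [hg]
    rw [eval₂_eq_eval_map] at h0
    have h1 := sub_dvd_eval_sub ψ (coP ψM) ((G.map coP).map (sub N hN ε))
    rw [h0, zero_sub, dvd_neg] at h1
    exact (trunc_dvd ψ M).trans h1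
  have hev : ∀ t, g.eval t = ev (ε * t ^ N) (ψM.eval t) G := by
    intro t
    have : (evalRingHom t).comp (eval₂RingHom θ ψM) = ev (ε * t ^ N) (ψM.eval t) := by
      apply Polynomial.ringHom_ext'
      · apply Polynomial.ringHom_ext
        · intro a; simp [ev, θ]
        · simp [ev, θ]
      · simp [ev]
    exact congrArg (fun f => f G) this
  obtain ⟨C₀, hC₀, hup⟩ := poly_upper g M hdiv
  apply powers_absurd (C₀ := C₀) hc (δ := min δ 1) (by positivity) (N * K)
  intro t ht ht1
  have htδ := lt_of_lt_of_le ht1 (min_le_left _ _)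
  have ht1' := lt_of_lt_of_le ht1 (min_le_right _ _)
  have habs : |ε * t ^ N| = t ^ N := by rw [abs_mul, hεa, one_mul, abs_of_pos (by positivity)]
  have h1 := h (ε * t ^ N) (ψM.eval t) (by
    rw [habs]
    calc t ^ N ≤ t := pow_le_of_le_one ht.le ht1'.le hN
      _ < δ := htδ) (by rw [← abs_pos, habs]; positivity)
  rw [← hev, habs, ← pow_mul] at h1
  have h2 := hup t (by rw [abs_of_pos ht]; exact ht1'.le)
  rw [abs_of_pos ht] at h2
  exact h1.trans h2

end analytic
end Sat

end

noncomputable section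
namespace Sat
open Polynomial

section coreD

lemma ps_sqrt (b : PowerSeries ℝ) (hb : 0 < PowerSeries.constantCoeff b) :
    ∃ σ : PowerSeries ℝ, σ ^ 2 = b := by
  set b0 := PowerSeries.constantCoeff b
  set c := Real.sqrt b0 with hc
  have hcpos : 0 < c := Real.sqrt_pos.mpr hb
  have hmon : (X ^ 2 - C b : Polynomial (PowerSeries ℝ)).Monic := monic_X_pow_sub_C b (by norm_num)
  obtain ⟨P, Q, hPQ, hP, -, hPd, -⟩ := hensel_poly (X ^ 2 - C b) hmon (X - C c) (X + C c)
    (monic_X_sub_C c) (monic_X_add_C c) (by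
      refine ⟨- C (1 / (2 * c)), C (1 / (2 * c)), ?_⟩
      have : (C (1 / (2 * c)) * (2 * C c) : Polynomial ℝ) = 1 := by
        rw [← C_ofNat, ← C_mul, ← C_mul, ← C_1]; congr 1; field_simp
      linear_combination this) (by
      have : (C c : Polynomial ℝ) ^ 2 = C b0 := by rw [← C_pow, hc, Real.sq_sqrt hb.le]
      rw [Polynomial.map_sub, Polynomial.map_pow, map_X, map_C]
      linear_combination this)
  rw [natDegree_X_sub_C] at hPd
  have hP1 : P = X + C (P.coeff 0) := by
    rw [hP.eq_X_add_C hPd]; simp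
  refine ⟨- P.coeff 0, ?_⟩
  have h1 := congrArg (eval (- P.coeff 0)) hPQ
  rw [eval_mul] at h1
  have : eval (- P.coeff 0) P = 0 := by
    conv_lhs => rw [hP1]
    simp
  rw [this, zero_mul] at h1
  simp only [eval_sub, eval_pow, eval_X, eval_C] at h1
  exact sub_eq_zero.mp h1

lemma real_sq_add (x y : Polynomial ℝ) (h : x ^ 2 + y ^ 2 = 0) : x = 0 ∧ y = 0 := by
  have h1 : ∀ t, x.eval t = 0 ∧ y.eval t = 0 := by
    intro t
    have := congrArg (eval t) h
    simp only [eval_add, eval_pow, eval_zero] at this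
    constructor
    · nlinarith [sq_nonneg (x.eval t), sq_nonneg (y.eval t)]
    · nlinarith [sq_nonneg (x.eval t), sq_nonneg (y.eval t)]
  exact ⟨Polynomial.funext fun t => by simp [(h1 t).1], Polynomial.funext fun t => by simp [(h1 t).2]⟩

lemma ps_sq_add (x y : PowerSeries ℝ) (h : x ^ 2 + y ^ 2 = 0) : x = 0 ∧ y = 0 := by
  have key : ∀ n, PowerSeries.X ^ n ∣ x ∧ PowerSeries.X ^ n ∣ y := by
    intro n
    induction n with
    | zero => simp
    | succ n ih =>
      obtain ⟨⟨x', hx⟩, ⟨y', hy⟩⟩ := ih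
      have h1 : x' ^ 2 + y' ^ 2 = 0 := by
        have : (PowerSeries.X ^ n : PowerSeries ℝ) ^ 2 * (x' ^ 2 + y' ^ 2) = 0 := by
          rw [← h, hx, hy]; ring
        rcases mul_eq_zero.mp this with h2 | h2
        · exact absurd h2 (pow_ne_zero _ (pow_ne_zero _ PowerSeries.X_ne_zero))
        · exact h2
      have h2 := congrArg PowerSeries.constantCoeff h1
      simp only [map_add, map_pow, map_zero] at h2
      have hx0 : PowerSeries.constantCoeff x' = 0 := by
        nlinarith [sq_nonneg (PowerSeries.constantCoeff x'), sq_nonneg (PowerSeries.constantCoeff y')]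
      have hy0 : PowerSeries.constantCoeff y' = 0 := by
        nlinarith [sq_nonneg (PowerSeries.constantCoeff x'), sq_nonneg (PowerSeries.constantCoeff y')]
      rw [← PowerSeries.X_dvd_iff] at hx0 hy0
      rw [hx, hy, pow_succ]
      exact ⟨mul_dvd_mul_left _ hx0, mul_dvd_mul_left _ hy0⟩
  constructor <;> ext n
  · have := (key (n + 1)).1
    rw [PowerSeries.X_pow_dvd_iff] at this
    simpa using this n (by omega)
  · have := (key (n + 1)).2
    rw [PowerSeries.X_pow_dvd_iff] at this
    simpa using this n (by omega)

lemma sos_degree (A B : Polynomial (PowerSeries ℝ)) (m : ℕ) (h : (A ^ 2 + B ^ 2).natDegree ≤ 2 * m) :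
    A.natDegree ≤ m ∧ B.natDegree ≤ m := by
  by_contra hcon
  set d := max A.natDegree B.natDegree with hd
  have hdm : m < d := by
    rw [hd]; by_contra h2; push Not at h2
    exact hcon ⟨(le_max_left _ _).trans h2, (le_max_right _ _).trans h2⟩
  have hA : A.natDegree ≤ d := le_max_left _ _
  have hB : B.natDegree ≤ d := le_max_right _ _
  have h1 : (A ^ 2 + B ^ 2).coeff (d + d) = 0 := coeff_eq_zero_of_natDegree_lt (by omega)
  rw [coeff_add, pow_two, pow_two, coeff_mul_add_eq_of_natDegree_le hA hA, coeff_mul_add_eq_of_natDegree_le hB hB,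
    ← pow_two, ← pow_two] at h1
  obtain ⟨hA0, hB0⟩ := ps_sq_add _ _ h1
  rcases max_choice A.natDegree B.natDegree with h3 | h3
  · rw [← hd] at h3
    rw [h3, coeff_natDegree, leadingCoeff_eq_zero] at hA0
    rw [hA0] at h3; simp at h3; omega
  · rw [← hd] at h3
    rw [h3, coeff_natDegree, leadingCoeff_eq_zero] at hB0
    rw [hB0] at h3; simp at h3; omega

lemma sos_even (A B : Polynomial (PowerSeries ℝ)) : ∃ d, (A ^ 2 + B ^ 2).natDegree = 2 * d := by
  rcases Nat.even_or_odd' (A ^ 2 + B ^ 2).natDegree with ⟨d, h | h⟩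
  · exact ⟨d, h⟩
  · exfalso
    set d' := max A.natDegree B.natDegree
    have h1 : (A ^ 2 + B ^ 2).natDegree ≤ 2 * d' := by
      apply natDegree_add_le_of_degree_le
      · refine natDegree_pow_le.trans ?_
        have := le_max_left A.natDegree B.natDegree
        omega
      · refine natDegree_pow_le.trans ?_
        have := le_max_right A.natDegree B.natDegree
        omega
    have h2 : d + 1 ≤ d' := by omega
    have h3 : (A ^ 2 + B ^ 2).coeff (d' + d') = 0 := coeff_eq_zero_of_natDegree_lt (by omega)
    have hA : A.natDegree ≤ d' := le_max_left _ _
    have hB : B.natDegree ≤ d' := le_max_right _ _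
    rw [coeff_add, pow_two, pow_two, coeff_mul_add_eq_of_natDegree_le hA hA, coeff_mul_add_eq_of_natDegree_le hB hB,
      ← pow_two, ← pow_two] at h3
    obtain ⟨hA0, hB0⟩ := ps_sq_add _ _ h3
    rcases max_choice A.natDegree B.natDegree with h4 | h4
    · have h5 : d' = A.natDegree := h4
      rw [h5, coeff_natDegree, leadingCoeff_eq_zero] at hA0
      rw [hA0] at h5; simp at h5; omega
    · have h5 : d' = B.natDegree := h4
      rw [h5, coeff_natDegree, leadingCoeff_eq_zero] at hB0
      rw [hB0] at h5; simp at h5; omega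

lemma X_dvd_sos (A B F : Polynomial (PowerSeries ℝ))
    (h : C PowerSeries.X * F = A ^ 2 + B ^ 2) : C PowerSeries.X ∣ A ∧ C PowerSeries.X ∣ B := by
  have h1 := congrArg (Polynomial.map PowerSeries.constantCoeff) h
  rw [Polynomial.map_mul, map_C, PowerSeries.constantCoeff_X, C_0, zero_mul, Polynomial.map_add,
    Polynomial.map_pow, Polynomial.map_pow] at h1
  obtain ⟨hA, hB⟩ := real_sq_add _ _ h1.symm
  constructor
  · rw [C_dvd_iff_dvd_coeff]
    intro i
    rw [PowerSeries.X_dvd_iff, ← coeff_map, hA, coeff_zero]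
  · rw [C_dvd_iff_dvd_coeff]
    intro i
    rw [PowerSeries.X_dvd_iff, ← coeff_map, hB, coeff_zero]

lemma sos_div_X (n : ℕ) : ∀ (A B F : Polynomial (PowerSeries ℝ)),
    C (PowerSeries.X ^ n) ^ 2 * F = A ^ 2 + B ^ 2 → ∃ A' B', F = A' ^ 2 + B' ^ 2 := by
  induction n with
  | zero => intro A B F h; exact ⟨A, B, by simpa using h⟩
  | succ n ih =>
    intro A B F h
    have e : (C (PowerSeries.X ^ (n + 1)) : Polynomial (PowerSeries ℝ)) =
      C (PowerSeries.X ^ n) * C PowerSeries.X := by rw [pow_succ, C_mul]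
    rw [e] at h
    obtain ⟨⟨A', hA⟩, ⟨B', hB⟩⟩ := X_dvd_sos A B
      (C (PowerSeries.X) * C (PowerSeries.X ^ n) ^ 2 * F) (by
        rw [← h]; ring)
    apply ih A' B' F
    have h0 : (C PowerSeries.X : Polynomial (PowerSeries ℝ)) ^ 2 ≠ 0 :=
      pow_ne_zero _ (C_ne_zero.mpr PowerSeries.X_ne_zero)
    apply mul_left_cancel₀ h0
    rw [hA, hB] at h
    linear_combination h

lemma sos_div (D : PowerSeries ℝ) (hD : D ≠ 0) (A B F : Polynomial (PowerSeries ℝ))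
    (h : C D ^ 2 * F = A ^ 2 + B ^ 2) : ∃ A' B', F = A' ^ 2 + B' ^ 2 := by
  obtain ⟨o, u, hu, hu1, -⟩ := ps_factor D
  have hunit : IsUnit u := by
    rw [PowerSeries.isUnit_iff_constantCoeff]
    exact (hu1 hD).isUnit
  obtain ⟨w, hw⟩ := hunit
  apply sos_div_X o (C (↑w⁻¹ : PowerSeries ℝ) * A) (C (↑w⁻¹ : PowerSeries ℝ) * B) F
  have h1 : (C (↑w⁻¹ : PowerSeries ℝ) * C u : Polynomial (PowerSeries ℝ)) = 1 := by
    rw [← C_mul, ← hw]; simp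
  rw [mul_pow, mul_pow, ← mul_add, ← h, hu, C_mul]
  linear_combination - C (PowerSeries.X ^ o) ^ 2 * F * (C (↑w⁻¹ : PowerSeries ℝ) * C u + 1) * h1

/-- a polynomial nonnegative near zero is a square of a power series -/
lemma sq_of_nonneg (a : Polynomial ℝ) (δ : ℝ) (hδ : 0 < δ) (h : ∀ v, |v| < δ → 0 ≤ a.eval v) :
    ∃ σ : PowerSeries ℝ, σ ^ 2 = coP a := by
  by_cases ha : a = 0
  · exact ⟨0, by simp [ha]⟩
  obtain ⟨e, b, hab, hb⟩ := poly_split a ha 0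
  rw [C_0, sub_zero] at hab
  have key : ∀ s : ℝ, s = 1 ∨ s = -1 → 0 < s ^ e * b.eval 0 := by
    intro s hs
    have hs1 : |s| = 1 := by rcases hs with rfl | rfl <;> simp
    have hs2 : s ≠ 0 := by rintro rfl; simp at hs1
    by_contra hcon
    have hlt : s ^ e * b.eval 0 < 0 :=
      lt_of_le_of_ne (not_lt.mp hcon) (mul_ne_zero (pow_ne_zero _ hs2) hb)
    obtain ⟨δ', hδ', hn⟩ := near_pos (C (- s ^ e) * b) 0 (by simp; linarith)
    simp only [eval_mul, eval_C] at hn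
    set t := min δ δ' / 2 with ht
    have htpos : 0 < t := by rw [ht]; positivity
    have h1 := hn (s * t) (by
      rw [sub_zero, abs_mul, hs1, one_mul, abs_of_pos htpos]
      have := min_le_right δ δ'; linarith)
    have h2 := h (s * t) (by
      rw [abs_mul, hs1, one_mul, abs_of_pos htpos]
      have := min_le_left δ δ'; linarith)
    rw [hab, eval_mul, eval_pow, eval_X, mul_pow] at h2
    have h3 : 0 < - s ^ e * b.eval (s * t) := by nlinarith
    have h4 : 0 < t ^ e := by positivity
    nlinarith [mul_pos h3 h4]
  have h1 := key 1 (Or.inl rfl)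
  have h2 := key (-1) (Or.inr rfl)
  simp only [one_pow, one_mul] at h1
  have he : Even e := by
    rcases Nat.even_or_odd e with h | h
    · exact h
    · rw [h.neg_one_pow] at h2; linarith
  obtain ⟨j, hj⟩ := he
  obtain ⟨σ, hσ⟩ := ps_sqrt (coP b) (by
    simpa [coeff_zero_eq_eval_zero] using h1)
  refine ⟨PowerSeries.X ^ j * σ, ?_⟩
  rw [mul_pow, hσ, hab, map_mul, map_pow, hj]
  simp only [coeToPowerSeries.ringHom_apply, coe_X]
  ring

lemma ev_eval₂ (v s : ℝ) (F : P2) : ev v s F = eval₂ (evalRingHom v) s F := by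
  rw [ev, RingHom.comp_apply, coe_evalRingHom, coe_evalRingHom, eval₂_evalRingHom]

theorem coreD_ps (F : P2) (c δ : ℝ) (hc : 0 < c) (hδ : 0 < δ) (K : ℕ)
    (h : ∀ v s, |v| < δ → c * |v| ^ K ≤ ev v s F) :
    ∃ A B : Polynomial (PowerSeries ℝ), F.map coP = A ^ 2 + B ^ 2 := by
  have hnn : ∀ v s, |v| < δ → 0 ≤ ev v s F := fun v s hv => le_trans (by positivity) (h v s hv)
  set a := F.leadingCoeff with ha
  have hF0 : F ≠ 0 := by
    rintro rfl
    have := h (δ / 2) 0 (by rw [abs_of_pos (by positivity)]; linarith)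
    rw [map_zero] at this
    have h2 : 0 < c * |δ / 2| ^ K := by
      have : 0 < |δ / 2| := abs_pos.mpr (by positivity)
      positivity
    linarith
  have ha0 : a ≠ 0 := leadingCoeff_ne_zero.mpr hF0
  have hapos : ∀ v, |v| < δ → 0 ≤ a.eval v := by
    intro v hv
    by_contra hcon
    push Not at hcon
    let p := F.map (evalRingHom v)
    have hne : evalRingHom v F.leadingCoeff ≠ 0 := by simpa using hcon.ne
    have hpl : p.leadingCoeff = a.eval v := leadingCoeff_map_of_leadingCoeff_ne_zero _ hne
    have hpe : ∀ s, 0 ≤ p.eval s := by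
      intro s
      have := hnn v s hv
      rwa [ev_eval₂, eval₂_eq_eval_map] at this
    by_cases hdeg : 0 < p.degree
    · have := tendsto_atBot_of_leadingCoeff_nonpos p hdeg (hpl ▸ hcon.le)
      obtain ⟨s, hs⟩ := (this.eventually (Filter.eventually_lt_atBot 0)).exists
      exact absurd (hpe s) (not_le.mpr hs)
    · have := eq_C_of_degree_le_zero (not_lt.mp hdeg)
      have h1 := hpe 0
      rw [this, eval_C] at h1
      rw [this, leadingCoeff_C] at hpl
      linarith
  obtain ⟨σ, hσ⟩ := sq_of_nonneg a δ hδ hapos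
  by_cases hn : F.natDegree = 0
  · have hFC := eq_C_of_natDegree_eq_zero hn
    have haC : a = F.coeff 0 := by rw [ha, leadingCoeff, hn]
    refine ⟨C σ, 0, ?_⟩
    rw [hFC, map_C, ← haC, ← hσ]; simp
  have hn1 : 1 ≤ F.natDegree := by omega
  set n := F.natDegree with hndef
  let G := F.integralNormalization
  have hGm : G.Monic := monic_integralNormalization hF0
  obtain ⟨e, c', δ', hc', hδ', hal⟩ := poly_lower a ha0 0
  have hNB : NoBranch (G.map coP) := by
    apply noBranch_of_bound G (c' ^ (n - 1) * c) (min δ δ') (by positivity) (by positivity)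
      (e * (n - 1) + K)
    intro v w hv hv0
    have hv1 := lt_of_lt_of_le hv (min_le_left _ _)
    have hv2 := lt_of_lt_of_le hv (min_le_right _ _)
    have hvp : 0 < |v| := abs_pos.mpr hv0
    have h1 := hal v (by rwa [sub_zero])
    rw [sub_zero] at h1
    have hav : a.eval v ≠ 0 := by
      rw [← abs_pos]; exact lt_of_lt_of_le (by positivity) h1
    have h2 := integralNormalization_eval₂_leadingCoeff_mul hn1 (evalRingHom v) (w / a.eval v)
    rw [coe_evalRingHom, ← ha, mul_div_cancel₀ _ hav, ← ev_eval₂, ← ev_eval₂] at h2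
    rw [h2, abs_mul, abs_pow]
    have h3 := (h v (w / a.eval v) hv1).trans (le_abs_self _)
    calc c' ^ (n - 1) * c * |v| ^ (e * (n - 1) + K)
        = (c' * |v| ^ e) ^ (n - 1) * (c * |v| ^ K) := by rw [mul_pow, ← pow_mul, pow_add]; ring
      _ ≤ _ := by gcongr
  obtain ⟨A, B, hAB⟩ := monic_core _ (G.map coP) (hGm.map _) rfl hNB
  obtain ⟨d, hd⟩ := sos_even A B
  have hnd : n = 2 * d := by
    rw [← hd, ← hAB, hGm.natDegree_map, natDegree_integralNormalization]
  have hcomp : (G.map coP).comp (C (coP a) * X) = C (coP a) ^ (n - 1) * F.map coP := by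
    have h2 := integralNormalization_eval₂_leadingCoeff_mul hn1 (C : Polynomial ℝ →+* P2) X
    rw [eval₂_C_X, ← ha, ← comp] at h2
    have h3 := congrArg (Polynomial.map coP) h2
    rw [Polynomial.map_comp, Polynomial.map_mul, Polynomial.map_mul, Polynomial.map_pow, map_C, map_X] at h3
    exact h3
  have hd1 : 1 ≤ d := by omega
  apply sos_div (coP a ^ d) (pow_ne_zero _ (by rwa [Ne, map_eq_zero_iff _ coP_inj]))
    (C σ * A.comp (C (coP a) * X)) (C σ * B.comp (C (coP a) * X)) (F.map coP)
  rw [hAB, add_comp, pow_comp, pow_comp] at hcomp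
  have e0 : (C σ : Polynomial (PowerSeries ℝ)) ^ 2 = C (coP a) := by rw [← C_pow, hσ]
  rw [mul_pow, mul_pow, ← mul_add, hcomp, e0, C_pow]
  have e1 : n - 1 + 1 = d * 2 := by omega
  rw [← mul_assoc, ← pow_succ', e1, pow_mul]

lemma map_eq_C_X_pow (N : ℕ) (D : P2) (h : C (PowerSeries.X ^ N) ∣ D.map coP) :
    ∃ R : P2, D = C (X ^ N) * R := by
  have : C (X ^ N) ∣ D := by
    rw [C_dvd_iff_dvd_coeff] at h ⊢
    intro i
    apply coP_dvd
    rw [← coeff_map]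
    exact h i
  exact this

lemma trunc_poly (A : Polynomial (PowerSeries ℝ)) (m N : ℕ) (hA : A.natDegree ≤ m) :
    ∃ A' : P2, A'.natDegree ≤ m ∧ C (PowerSeries.X ^ N) ∣ A - A'.map coP := by
  let A' : P2 := ∑ i ∈ Finset.range (m + 1), monomial i (PowerSeries.trunc N (A.coeff i))
  have hc : ∀ i, A'.coeff i = if i < m + 1 then PowerSeries.trunc N (A.coeff i) else 0 := by
    intro i
    simp only [A', finsetSum_coeff, coeff_monomial, Finset.sum_ite_eq', Finset.mem_range]
  refine ⟨A', ?_, ?_⟩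
  · rw [natDegree_le_iff_coeff_eq_zero]
    intro i hi
    rw [hc, if_neg (by omega)]
  · rw [C_dvd_iff_dvd_coeff]
    intro i
    rw [coeff_sub, coeff_map, hc]
    split_ifs with h
    · exact trunc_dvd _ _
    · rw [coeff_eq_zero_of_natDegree_lt (by omega)]; simp

theorem coreD (F : P2) (c δ : ℝ) (hc : 0 < c) (hδ : 0 < δ) (K m : ℕ) (hm : F.natDegree ≤ 2 * m)
    (h : ∀ v s, |v| < δ → c * |v| ^ K ≤ ev v s F) (N : ℕ) :
    ∃ A B R : P2, A.natDegree ≤ m ∧ B.natDegree ≤ m ∧ F = A ^ 2 + B ^ 2 + C (X ^ N) * R := by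
  obtain ⟨A, B, hAB⟩ := coreD_ps F c δ hc hδ K h
  have hd : (A ^ 2 + B ^ 2).natDegree ≤ 2 * m := by
    rw [← hAB]; exact natDegree_map_le.trans hm
  obtain ⟨hA, hB⟩ := sos_degree A B m hd
  obtain ⟨A', hA', hA2⟩ := trunc_poly A m N hA
  obtain ⟨B', hB', hB2⟩ := trunc_poly B m N hB
  obtain ⟨R, hR⟩ := map_eq_C_X_pow N (F - A' ^ 2 - B' ^ 2) (by
    rw [Polynomial.map_sub, Polynomial.map_sub, hAB, Polynomial.map_pow, Polynomial.map_pow]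
    have : A ^ 2 + B ^ 2 - A'.map coP ^ 2 - B'.map coP ^ 2 =
      (A - A'.map coP) * (A + A'.map coP) + (B - B'.map coP) * (B + B'.map coP) := by ring
    rw [this]
    exact dvd_add (hA2.mul_right _) (hB2.mul_right _))
  exact ⟨A', B', R, hA', hB', by rw [← hR]; ring⟩

end coreD
end Sat

end

noncomputable section
namespace Sat
open Polynomial

section stepC

/-- homogenise to degree `m`, then substitute -/
def Hg (a b : P2) (m : ℕ) (G : P2) : P2 :=
  MvPolynomial.eval₂Hom (C : Polynomial ℝ →+* P2) ![a, b] (homogenize G m)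

lemma Hg_add (a b : P2) (m : ℕ) (G G' : P2) : Hg a b m (G + G') = Hg a b m G + Hg a b m G' := by
  simp only [Hg, homogenize_add, map_add]

lemma Hg_zero (a b : P2) (m : ℕ) : Hg a b m 0 = 0 := by
  simp only [Hg, homogenize_zero, map_zero]

lemma Hg_neg (a b : P2) (m : ℕ) (G : P2) : Hg a b m (- G) = - Hg a b m G := by
  simp only [Hg, homogenize_neg, map_neg]

lemma Hg_sub (a b : P2) (m : ℕ) (G G' : P2) : Hg a b m (G - G') = Hg a b m G - Hg a b m G' := by
  rw [sub_eq_add_neg, Hg_add, Hg_neg, sub_eq_add_neg]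

lemma Hg_C_mul (a b : P2) (m : ℕ) (p : Polynomial ℝ) (G : P2) :
    Hg a b m (C p * G) = C p * Hg a b m G := by
  simp [Hg]

lemma Hg_mul (a b : P2) {m n : ℕ} {G G' : P2} (hG : G.natDegree ≤ m) (hG' : G'.natDegree ≤ n) :
    Hg a b (m + n) (G * G') = Hg a b m G * Hg a b n G' := by
  rw [Hg, homogenize_mul _ _ hG hG', map_mul]; rfl

lemma Hg_X_pow (a b : P2) {m j : ℕ} (h : j ≤ m) : Hg a b m (X ^ j) = a ^ j * b ^ (m - j) := by
  rw [Hg, homogenize_X_pow h]; simp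

lemma Hg_one (a b : P2) (m : ℕ) : Hg a b m 1 = b ^ m := by
  simpa using Hg_X_pow a b (m := m) (j := 0) (Nat.zero_le _)

lemma Hg_X (a b : P2) : Hg a b 1 X = a := by
  simpa using Hg_X_pow a b (m := 1) (j := 1) le_rfl

lemma Hg_pow (a b : P2) {G : P2} (hG : G.natDegree ≤ 1) (n : ℕ) :
    Hg a b n (G ^ n) = (Hg a b 1 G) ^ n := by
  induction n with
  | zero => simp [Hg_one]
  | succ n ih =>
    rw [pow_succ, pow_succ, Hg_mul a b _ hG, ih]
    refine natDegree_pow_le.trans ?_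
    nlinarith

lemma ev_Hg (a b : P2) (m : ℕ) (P : P2) (hP : P.natDegree ≤ m) (x z : ℝ) (hb : ev x z b ≠ 0) :
    ev x z (Hg a b m P) = (ev x z b) ^ m * ev x (ev x z a / ev x z b) P := by
  apply Polynomial.induction_with_natDegree_le
    (fun P => ev x z (Hg a b m P) = (ev x z b) ^ m * ev x (ev x z a / ev x z b) P) (N := m)
  · simp [Hg_zero]
  · intro n r hr hn
    have : ev x (ev x z a / ev x z b) (C r * X ^ n) = r.eval x * (ev x z a / ev x z b) ^ n := by
      rw [map_mul, map_pow, ev_C, show (X : P2) = yy from rfl, ev_yy]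
    rw [Hg_C_mul, Hg_X_pow a b hn, this, map_mul, map_mul, map_pow, map_pow, ev_C, div_pow]
    obtain ⟨k, rfl⟩ := Nat.exists_eq_add_of_le hn
    rw [Nat.add_sub_cancel_left, pow_add]
    field_simp
  · intro f g _ _ hf hg
    rw [Hg_add, map_add, map_add, hf, hg]; ring
  · exact hP

lemma Hg_hat (m : ℕ) (P : P2) (hP : P.natDegree ≤ m) :
    Hg yy (xx ^ 2 - yy) m (Hg X (1 + X) m P) = Hg yy (xx ^ 2) m P := by
  apply Polynomial.induction_with_natDegree_le
    (fun P => Hg yy (xx ^ 2 - yy) m (Hg X (1 + X) m P) = Hg yy (xx ^ 2) m P) (N := m)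
  · simp [Hg_zero]
  · intro n r hr hn
    have h1 : (1 + X : P2).natDegree ≤ 1 := by
      rw [add_comm]; exact (natDegree_X_add_C (1 : Polynomial ℝ)).le
    obtain ⟨k, rfl⟩ := Nat.exists_eq_add_of_le hn
    rw [Hg_C_mul, Hg_X_pow _ _ hn, Hg_C_mul, Hg_C_mul, Hg_X_pow _ _ hn, Nat.add_sub_cancel_left,
      Hg_mul, Hg_pow _ _ h1, Hg_pow _ _ natDegree_X_le, Hg_add, Hg_X, Hg_one]
    · ring
    · exact natDegree_X_pow_le n
    · exact natDegree_pow_le.trans (by nlinarith)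
  · intro f g _ _ hf hg
    rw [Hg_add, Hg_add, Hg_add, hf, hg]
  · exact hP

lemma natDegree_hat (m : ℕ) (P : P2) (hP : P.natDegree ≤ m) : (Hg X (1 + X) m P).natDegree ≤ m := by
  apply Polynomial.induction_with_natDegree_le
    (fun P => (Hg X (1 + X) m P).natDegree ≤ m) (N := m)
  · simp [Hg_zero]
  · intro n r hr hn
    have h1 : (1 + X : P2).natDegree ≤ 1 := by
      rw [add_comm]; exact (natDegree_X_add_C (1 : Polynomial ℝ)).le
    obtain ⟨k, rfl⟩ := Nat.exists_eq_add_of_le hn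
    rw [Hg_C_mul, Hg_X_pow _ _ hn, Nat.add_sub_cancel_left]
    refine (natDegree_C_mul_le _ _).trans (natDegree_mul_le_of_le (natDegree_X_pow_le n) ?_)
    exact natDegree_pow_le.trans (by nlinarith)
  · intro f g _ _ hf hg
    rw [Hg_add]; exact natDegree_add_le_of_degree_le hf hg
  · exact hP

lemma Hg_sq_mem (m : ℕ) (A : P2) (hA : ∀ i, m < 2 * i → A.coeff i = 0) :
    Hg yy (xx ^ 2 - yy) m (A ^ 2) ∈ T := by
  have hd : A.natDegree ≤ m / 2 := by
    rw [natDegree_le_iff_coeff_eq_zero]; intro i hi; exact hA i (by omega)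
  have e : m = (m - 2 * (m / 2)) + (m / 2 + m / 2) := by omega
  have h1 : Hg yy (xx ^ 2 - yy) m (A ^ 2) = (xx ^ 2 - yy) ^ (m - 2 * (m / 2)) *
      (Hg yy (xx ^ 2 - yy) (m / 2) A) ^ 2 := by
    conv_lhs => rw [e, ← one_mul (A ^ 2), pow_two A]
    rw [Hg_mul _ _ (by simp) (natDegree_mul_le_of_le hd hd), Hg_mul _ _ hd hd, Hg_one]; ring
  rw [h1]
  exact T.mul_mem (T.pow_mem T_xy _) (T_sq _)

lemma Hg_X_sq_mem (m : ℕ) (A : P2) (hA : ∀ i, m < 2 * i + 1 → A.coeff i = 0) :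
    Hg yy (xx ^ 2 - yy) m (X * A ^ 2) ∈ T := by
  by_cases hm : m = 0
  · have : A = 0 := by ext1 i; rw [hA i (by omega)]; simp
    rw [this]; simp [Hg_zero]
  set D := (m - 1) / 2 with hD
  have hd : A.natDegree ≤ D := by
    rw [natDegree_le_iff_coeff_eq_zero]; intro i hi; exact hA i (by omega)
  have e : m = (m - 1 - 2 * D) + (1 + (D + D)) := by omega
  have h1 : Hg yy (xx ^ 2 - yy) m (X * A ^ 2) = (xx ^ 2 - yy) ^ (m - 1 - 2 * D) * (yy *
      (Hg yy (xx ^ 2 - yy) D A) ^ 2) := by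
    conv_lhs => rw [e, ← one_mul (X * A ^ 2), pow_two A]
    rw [Hg_mul _ _ (by simp) (natDegree_mul_le_of_le natDegree_X_le (natDegree_mul_le_of_le hd hd)),
      Hg_mul _ _ natDegree_X_le (natDegree_mul_le_of_le hd hd), Hg_mul _ _ hd hd, Hg_one, Hg_X]
    ring
  rw [h1]
  exact T.mul_mem (T.pow_mem T_xy _) (T.mul_mem T_y (T_sq _))

/-- even-odd decomposition -/
lemma even_odd {R : Type*} [CommRing R] (p : Polynomial R) :
    p = expand R 2 (contract 2 p) + X * expand R 2 (contract 2 (divX p)) := by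
  ext n
  rw [coeff_add]
  rcases Nat.even_or_odd' n with ⟨k, rfl | rfl⟩
  · have h1 : (X * expand R 2 (contract 2 (divX p))).coeff (2 * k) = 0 := by
      rcases k with _ | k
      · simp
      · rw [show 2 * (k + 1) = (2 * k + 1) + 1 by ring, coeff_X_mul, coeff_expand (by norm_num),
          if_neg (by omega)]
    rw [h1, add_zero, mul_comm, coeff_expand_mul (by norm_num), coeff_contract (by norm_num)]
  · rw [coeff_X_mul, coeff_expand (by norm_num), if_neg (by omega), zero_add, mul_comm 2 k,
      coeff_expand_mul (by norm_num), coeff_contract (by norm_num), coeff_divX]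

lemma even_part {R S : Type*} [CommRing R] [CommRing S] [IsDomain S] [CharZero S] (e : R →+* S)
    (he : Function.Injective e) (σ : S →+* S) (θ : S) (h1 : ∀ r, σ (e r) = e r) (h2 : σ θ = - θ)
    (a b : R) (h : e a = θ * e b) : a = 0 := by
  have h3 := congrArg σ h
  rw [h1, map_mul, h1, h2] at h3
  have : (2 : S) * e a = 0 := by linear_combination h3 + h
  rcases mul_eq_zero.mp this with h4 | h4
  · exact absurd h4 two_ne_zero
  · exact he (by rw [h4, map_zero])

lemma even_part0 {R : Type*} [CommRing R] [IsDomain R] [CharZero R] (a b : Polynomial R)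
    (h : expand R 2 a = X * expand R 2 b) : a = 0 := by
  apply even_part (expand R 2).toRingHom (expand_injective (by norm_num))
    (compRingHom (-X)) X _ _ a b h
  · intro r
    change (expand _ 2 r).comp (-X) = expand _ 2 r
    rw [expand_eq_comp_X_pow, comp_assoc, pow_comp, X_comp, neg_sq]
  · simp

lemma even_part1 (a b : P2) (h : expand _ 2 a = X * expand _ 2 b) : a = 0 := even_part0 a b h

lemma even_part2 (a b : P2) (h : a.map (expand ℝ 2).toRingHom = C X * b.map (expand ℝ 2).toRingHom) :
    a = 0 := by
  apply even_part (mapRingHom (expand ℝ 2).toRingHom)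
    (map_injective _ (expand_injective (by norm_num))) (mapRingHom (compRingHom (-X))) (C X) _ _ a b h
  · intro r
    rw [coe_mapRingHom, coe_mapRingHom, Polynomial.map_map]
    congr 1
    ext
    · simp
    · simp
  · simp

lemma even_odd2 (A : P2) : ∃ A' A'' : P2, A = A'.map (expand ℝ 2).toRingHom +
    C X * A''.map (expand ℝ 2).toRingHom ∧ ∀ i, A.coeff i = 0 → A'.coeff i = 0 ∧ A''.coeff i = 0 := by
  let f : ℕ → Polynomial ℝ → Polynomial ℝ := fun k p => contract 2 (divX^[k] p)
  let B : ℕ → P2 := fun k => ∑ i ∈ Finset.range (A.natDegree + 1), monomial i (f k (A.coeff i))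
  have hf : ∀ k, f k 0 = 0 := by
    intro k
    have : divX^[k] (0 : Polynomial ℝ) = 0 := by
      induction k with
      | zero => rfl
      | succ k ih => rw [Function.iterate_succ_apply', ih, divX_zero]
    simp only [f, this]
    ext n; rw [coeff_contract (by norm_num)]; simp
  have hB : ∀ k i, (B k).coeff i = f k (A.coeff i) := by
    intro k i
    simp only [B, finsetSum_coeff, coeff_monomial, Finset.sum_ite_eq', Finset.mem_range]
    split_ifs with h
    · rfl
    · rw [coeff_eq_zero_of_natDegree_lt (by omega), hf]
  refine ⟨B 0, B 1, ?_, ?_⟩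
  · ext1 i
    rw [coeff_add, coeff_map, coeff_C_mul, coeff_map, hB, hB]
    exact even_odd (A.coeff i)
  · intro i hi
    rw [hB, hB, hi, hf, hf]; exact ⟨rfl, rfl⟩

lemma map_Hat_ev (τ : Polynomial ℝ) (G : P2) (v s : ℝ) :
    ev v s (expand _ 2 (G.map (compRingHom τ))) = ev (τ.eval v) (s ^ 2) G := by
  induction G using P2_induction with
  | hc r => simp [cst, ev]
  | hx => simp [xx, ev]
  | hy => simp [yy, ev]
  | hadd g h hg hh => rw [Polynomial.map_add, map_add, map_add, map_add, hg, hh]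
  | hmul g h hg hh => rw [Polynomial.map_mul, map_mul, map_mul, map_mul, hg, hh]

lemma stepC_s (P : P2) (m : ℕ) (hP : P.natDegree ≤ m) (τ : Polynomial ℝ) (c δ : ℝ) (hc : 0 < c)
    (hδ : 0 < δ) (K : ℕ)
    (h : ∀ v z, |v| < δ → 0 ≤ z → z ≤ 1 → c * |v| ^ K ≤ ev (τ.eval v) z P) (N : ℕ) :
    ∃ A₀ A₁ B₀ B₁ R : P2, (∀ i, m < 2 * i → A₀.coeff i = 0) ∧ (∀ i, m < 2 * i + 1 → A₁.coeff i = 0) ∧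
      (∀ i, m < 2 * i → B₀.coeff i = 0) ∧ (∀ i, m < 2 * i + 1 → B₁.coeff i = 0) ∧
      (Hg X (1 + X) m P).map (compRingHom τ) = A₀ ^ 2 + B₀ ^ 2 + X * A₁ ^ 2 + X * B₁ ^ 2
        + C (X ^ N) * R := by
  set G := (Hg X (1 + X) m P).map (compRingHom τ) with hG
  have hGd : (expand _ 2 G).natDegree ≤ 2 * m := by
    rw [natDegree_expand, mul_comm]
    exact Nat.mul_le_mul_left _ (natDegree_map_le.trans (natDegree_hat m P hP))
  obtain ⟨A, B, R, hA, hB, hF⟩ := coreD (expand _ 2 G) c δ hc hδ K m hGd (by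
    intro v s hv
    rw [hG, map_Hat_ev]
    have e1 : ev (τ.eval v) (s ^ 2) (1 + X) = 1 + s ^ 2 := by
      rw [map_add, map_one, show (X : P2) = yy from rfl, ev_yy]
    have e2 : ev (τ.eval v) (s ^ 2) X = s ^ 2 := ev_yy _ _
    have hpos : 0 < 1 + s ^ 2 := by positivity
    rw [ev_Hg _ _ _ _ hP _ _ (by rw [e1]; exact hpos.ne'), e1, e2]
    have h1 := h v (s ^ 2 / (1 + s ^ 2)) hv (by positivity) (by rw [div_le_one hpos]; linarith)
    have h2 : 1 ≤ (1 + s ^ 2) ^ m := one_le_pow₀ (by nlinarith [sq_nonneg s])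
    have h3 : 0 ≤ c * |v| ^ K := by positivity
    nlinarith) N
  have hdeg : ∀ A : P2, A.natDegree ≤ m → (∀ i, m < 2 * i → (contract 2 A).coeff i = 0) ∧
      (∀ i, m < 2 * i + 1 → (contract 2 (divX A)).coeff i = 0) := by
    intro A hA
    constructor
    · intro i hi
      rw [coeff_contract (by norm_num)]
      exact coeff_eq_zero_of_natDegree_lt (by omega)
    · intro i hi
      rw [coeff_contract (by norm_num), coeff_divX]
      exact coeff_eq_zero_of_natDegree_lt (by omega)
  refine ⟨contract 2 A, contract 2 (divX A), contract 2 B, contract 2 (divX B), contract 2 R,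
    (hdeg A hA).1, (hdeg A hA).2, (hdeg B hB).1, (hdeg B hB).2, ?_⟩
  rw [← sub_eq_zero]
  apply even_part1 _ (2 * contract 2 A * contract 2 (divX A) + 2 * contract 2 B * contract 2 (divX B)
    + C (X ^ N) * contract 2 (divX R))
  have eA := even_odd A
  have eB := even_odd B
  have eR := even_odd R
  simp only [map_sub, map_add, map_mul, map_pow, expand_X, expand_C, map_ofNat]
  rw [hF]
  set a0 := expand _ 2 (contract 2 A)
  set a1 := expand _ 2 (contract 2 (divX A))
  set b0 := expand _ 2 (contract 2 B)
  set b1 := expand _ 2 (contract 2 (divX B))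
  set r0 := expand _ 2 (contract 2 R)
  set r1 := expand _ 2 (contract 2 (divX R))
  rw [eA, eB, eR, C_pow]
  ring

/-- step C at an interior point -/
lemma stepC_int (P : P2) (m : ℕ) (hP : P.natDegree ≤ m) (r c δ : ℝ) (hc : 0 < c)
    (hδ : 0 < δ) (K : ℕ)
    (h : ∀ x z, |x - r| < δ → 0 ≤ z → z ≤ 1 → c * |x - r| ^ K ≤ ev x z P) (N : ℕ) :
    ∃ t ∈ T, ∃ R, Hg yy (xx ^ 2) m P = t + C ((X - C r) ^ N) * R := by
  obtain ⟨A₀, A₁, B₀, B₁, R, hA0, hA1, hB0, hB1, e⟩ := stepC_s P m hP (X + C r) c δ hc hδ K (by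
    intro v z hv hz hz1
    have := h (v + r) z (by simpa using hv) hz hz1
    simpa using this) N
  set σ : Polynomial ℝ →+* Polynomial ℝ := compRingHom (X - C r) with hσ
  have e2 := congrArg (Polynomial.map σ) e
  have e3 : σ.comp (compRingHom (X + C r)) = RingHom.id _ := by
    ext <;> simp [hσ]
  rw [Polynomial.map_map, e3, Polynomial.map_id] at e2
  simp only [Polynomial.map_add, Polynomial.map_mul, Polynomial.map_pow, map_X, map_C] at e2
  have e4 : σ (X ^ N) = (X - C r) ^ N := by simp [hσ]
  rw [e4] at e2
  rw [← Hg_hat m P hP, e2]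
  simp only [Hg_add, Hg_C_mul]
  refine ⟨_, ?_, _, rfl⟩
  refine T.add_mem (T.add_mem (T.add_mem (Hg_sq_mem _ _ ?_) (Hg_sq_mem _ _ ?_)) (Hg_X_sq_mem _ _ ?_))
    (Hg_X_sq_mem _ _ ?_)
  · intro i hi; rw [coeff_map, hA0 i hi, map_zero]
  · intro i hi; rw [coeff_map, hB0 i hi, map_zero]
  · intro i hi; rw [coeff_map, hA1 i hi, map_zero]
  · intro i hi; rw [coeff_map, hB1 i hi, map_zero]

/-- step C at an end point, `ε = ±1` -/
lemma stepC_end (P : P2) (m : ℕ) (hP : P.natDegree ≤ m) (r ε c δ : ℝ) (hε : ε * ε = 1)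
    (hT : C (C ε * (X - C r)) ∈ T) (hc : 0 < c)
    (hδ : 0 < δ) (K : ℕ)
    (h : ∀ u z, 0 ≤ u → u < δ → 0 ≤ z → z ≤ 1 → c * u ^ K ≤ ev (r + ε * u) z P) (N : ℕ) :
    ∃ t ∈ T, ∃ R, Hg yy (xx ^ 2) m P = t + C ((X - C r) ^ N) * R := by
  obtain ⟨A₀, A₁, B₀, B₁, R, hA0, hA1, hB0, hB1, e⟩ := stepC_s P m hP (C r + C ε * X ^ 2)
    c (Real.sqrt δ) hc (Real.sqrt_pos.mpr hδ) (2 * K) (by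
    intro v z hv hz hz1
    have h1 : v ^ 2 < δ := by
      rw [← sq_abs]; exact (Real.lt_sqrt (abs_nonneg v)).mp hv
    have := h (v ^ 2) z (by positivity) h1 hz hz1
    rw [pow_mul, sq_abs]
    simpa using this) (2 * N)
  set e2 : Polynomial ℝ →+* Polynomial ℝ := (expand ℝ 2).toRingHom with he2
  set ρ : Polynomial ℝ →+* Polynomial ℝ := compRingHom (C r + C ε * X) with hρ
  have hcomp : compRingHom (C r + C ε * X ^ 2) = e2.comp ρ := by
    ext <;> simp [hρ, he2]
  rw [hcomp, ← Polynomial.map_map] at e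
  obtain ⟨a0, a0', ha0, ha0d⟩ := even_odd2 A₀
  obtain ⟨a1, a1', ha1, ha1d⟩ := even_odd2 A₁
  obtain ⟨b0, b0', hb0, hb0d⟩ := even_odd2 B₀
  obtain ⟨b1, b1', hb1, hb1d⟩ := even_odd2 B₁
  obtain ⟨q, q', hq, -⟩ := even_odd2 R
  have key : (Hg X (1 + X) m P).map ρ - (a0 ^ 2 + C X * a0' ^ 2 + (b0 ^ 2 + C X * b0' ^ 2)
    + (X * a1 ^ 2 + C X * (X * a1' ^ 2)) + (X * b1 ^ 2 + C X * (X * b1' ^ 2)) + C (X ^ N) * q) = 0 := by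
    apply even_part2 _ (2 * a0 * a0' + 2 * b0 * b0' + 2 * X * a1 * a1' + 2 * X * b1 * b1'
      + C (X ^ N) * q')
    simp only [Polynomial.map_sub, Polynomial.map_add, Polynomial.map_mul, Polynomial.map_pow,
      map_X, map_C, Polynomial.map_ofNat]
    rw [← he2, e, ha0, ha1, hb0, hb1, hq]
    have e5 : e2 X = X ^ 2 := by simp [he2]
    have e6 : (C (e2 (X ^ N)) : P2) = C X ^ (N * 2) := by rw [map_pow, e5, ← pow_mul, mul_comm, C_pow]
    rw [e6, e5]
    simp only [C_pow, ← he2]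
    ring
  rw [sub_eq_zero] at key
  set σ : Polynomial ℝ →+* Polynomial ℝ := compRingHom (C ε * (X - C r)) with hσ
  have key2 := congrArg (Polynomial.map σ) key
  have e3 : σ.comp ρ = RingHom.id _ := by
    have hCε : (C ε * C ε : Polynomial ℝ) = 1 := by rw [← C_mul, hε, C_1]
    ext1
    · ext; simp [hρ, hσ]
    · simp only [hρ, hσ, RingHom.comp_apply, coe_compRingHom_apply, add_comp, mul_comp, C_comp, X_comp,
        RingHom.id_apply]
      linear_combination (X - C r) * hCε
  rw [Polynomial.map_map, e3, Polynomial.map_id] at key2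
  simp only [Polynomial.map_add, Polynomial.map_mul, Polynomial.map_pow, map_X, map_C] at key2
  have e4 : (C (σ (X ^ N)) : P2) = C ((X - C r) ^ N) * C (C ε ^ N) := by
    rw [← C_mul]; simp [hσ, mul_pow, mul_comm]
  have e5 : σ X = C ε * (X - C r) := by simp [hσ]
  rw [e4, e5] at key2
  rw [mul_assoc (C ((X - C r) ^ N))] at key2
  rw [← Hg_hat m P hP, key2]
  simp only [Hg_add, Hg_C_mul _ _ _ _ (_ ^ 2), Hg_C_mul _ _ _ _ (X * _)]
  rw [Hg_C_mul _ _ _ ((X - C r) ^ N)]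
  refine ⟨_, ?_, _, rfl⟩
  have z : ∀ (A : P2) i, A.coeff i = 0 → (A.map σ).coeff i = 0 := by
    intro A i hi; rw [coeff_map, hi, map_zero]
  refine T.add_mem (T.add_mem (T.add_mem
    (T.add_mem (Hg_sq_mem _ _ ?_) (T.mul_mem hT (Hg_sq_mem _ _ ?_)))
    (T.add_mem (Hg_sq_mem _ _ ?_) (T.mul_mem hT (Hg_sq_mem _ _ ?_))))
    (T.add_mem (Hg_X_sq_mem _ _ ?_) (T.mul_mem hT (Hg_X_sq_mem _ _ ?_))))
    (T.add_mem (Hg_X_sq_mem _ _ ?_) (T.mul_mem hT (Hg_X_sq_mem _ _ ?_)))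
  · exact fun i hi => z _ _ (ha0d i (hA0 i hi)).1
  · exact fun i hi => z _ _ (ha0d i (hA0 i hi)).2
  · exact fun i hi => z _ _ (hb0d i (hB0 i hi)).1
  · exact fun i hi => z _ _ (hb0d i (hB0 i hi)).2
  · exact fun i hi => z _ _ (ha1d i (hA1 i hi)).1
  · exact fun i hi => z _ _ (ha1d i (hA1 i hi)).2
  · exact fun i hi => z _ _ (hb1d i (hB1 i hi)).1
  · exact fun i hi => z _ _ (hb1d i (hB1 i hi)).2

end stepC
end Sat

end

noncomputable section
namespace Sat
open Polynomial

section localPos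

lemma T_bd' (g : P2) : ∃ r, 0 ≤ r ∧ cst r + g ∈ T ∧ cst r - g ∈ T := by
  obtain ⟨r, h1, h2⟩ := T_bd g
  have h3 : cst (|r| - r) ∈ T := T_cst (by linarith [le_abs_self r])
  rw [cst_sub] at h3
  refine ⟨|r|, abs_nonneg r, ?_, ?_⟩
  · have := T.add_mem h3 h2
    convert this using 1; ring
  · have := T.add_mem h3 h1
    convert this using 1; ring

/-- `g(x, x^2 z)` -/
def blow (g : P2) : P2 := g.comp (C (X ^ 2) * X)

lemma blow_add (g h : P2) : blow (g + h) = blow g + blow h := add_comp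
lemma blow_mul (g h : P2) : blow (g * h) = blow g * blow h := mul_comp _ _ _

lemma blow_natDegree (g : P2) : (blow g).natDegree ≤ g.natDegree := by
  refine natDegree_comp_le.trans ?_
  have : (C (X ^ 2) * X : P2).natDegree ≤ 1 := (natDegree_C_mul_le _ _).trans natDegree_X_le
  nlinarith

lemma ev_blow (g : P2) (x z : ℝ) : ev x z (blow g) = ev x (x ^ 2 * z) g := by
  induction g using P2_induction with
  | hc r => simp [blow, cst, ev]
  | hx => simp [blow, xx, ev]
  | hy => simp [blow, yy, ev]; ring
  | hadd g h hg hh => rw [blow_add, map_add, map_add, hg, hh]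
  | hmul g h hg hh => rw [blow_mul, map_mul, map_mul, hg, hh]

lemma Hg_blow (g : P2) (m : ℕ) (hm : g.natDegree ≤ m) :
    Hg yy (xx ^ 2) m (blow g) = (xx ^ m) ^ 2 * g := by
  apply Polynomial.induction_with_natDegree_le
    (fun g => Hg yy (xx ^ 2) m (blow g) = (xx ^ m) ^ 2 * g) (N := m)
  · simp [blow, Hg_zero]
  · intro n r hr hn
    have : blow (C r * X ^ n) = C r * (C ((X ^ 2) ^ n) * X ^ n) := by
      simp [blow, mul_pow]
    obtain ⟨k, rfl⟩ := Nat.exists_eq_add_of_le hn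
    rw [this, Hg_C_mul, Hg_C_mul, Hg_X_pow _ _ hn, Nat.add_sub_cancel_left, C_pow, C_pow]
    simp only [xx, yy]
    ring
  · intro f g _ _ hf hg
    rw [blow_add, Hg_add, hf, hg]; ring
  · exact hm

lemma local_pos (g : P2) (r c δ : ℝ) (hr : 0 < r) (hr1 : r ≤ 1) (hc : 0 < c) (hδ : 0 < δ) (K : ℕ)
    (h : ∀ a b, inK a b → |a - r| < δ → c * |a - r| ^ K ≤ ev a b g) (N : ℕ) :
    ∃ C₀ : ℝ, 0 ≤ C₀ ∧ g + cst C₀ * C ((X - C r) ^ 2) ^ N ∈ T := by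
  have step : ∃ t ∈ T, ∃ R, Hg yy (xx ^ 2) g.natDegree (blow g) = t + C ((X - C r) ^ (2 * N)) * R := by
    rcases lt_or_eq_of_le hr1 with hr2 | rfl
    · apply stepC_int (blow g) _ (blow_natDegree g) r c (min δ (min r (1 - r))) hc
        (by have : 0 < 1 - r := by linarith
            positivity) K
      intro x z hx hz hz1
      rw [ev_blow]
      have h1 := lt_of_lt_of_le hx (min_le_left _ _)
      have h2 := lt_of_lt_of_le hx ((min_le_right _ _).trans (min_le_left _ _))
      have h3 := lt_of_lt_of_le hx ((min_le_right _ _).trans (min_le_right _ _))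
      rw [abs_lt] at h2 h3
      exact h _ _ ⟨by linarith, by linarith, by positivity, by nlinarith [sq_nonneg x]⟩ h1
    · apply stepC_end (blow g) _ (blow_natDegree g) 1 (-1) c (min δ 1) (by norm_num) _ hc
        (by positivity) K
      · intro u z hu hu1 hz hz1
        rw [ev_blow]
        have h1 := lt_of_lt_of_le hu1 (min_le_left _ _)
        have h2 := lt_of_lt_of_le hu1 (min_le_right _ _)
        have := h (1 + -1 * u) ((1 + -1 * u) ^ 2 * z) ⟨by linarith, by linarith, by positivity,
          by nlinarith [sq_nonneg (1 + -1 * u)]⟩ (by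
            rw [show 1 + -1 * u - 1 = - u by ring, abs_neg, abs_of_nonneg hu]; exact h1)
        rwa [show 1 + -1 * u - 1 = - u by ring, abs_neg, abs_of_nonneg hu] at this
      · have := T_1x
        convert this using 1
        simp [xx]
  obtain ⟨t, ht, R, e⟩ := step
  rw [Hg_blow g _ le_rfl] at e
  set m := g.natDegree
  have hcop : IsCoprime (X ^ m : Polynomial ℝ) ((X - C r) ^ (2 * N)) := by
    apply IsCoprime.pow
    refine ⟨C (1 / r), - C (1 / r), ?_⟩
    have : (C (1 / r) * C r : Polynomial ℝ) = 1 := by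
      rw [← C_mul, ← C_1]; congr 1; field_simp
    linear_combination this
  obtain ⟨a, b, hab⟩ := hcop
  set q : P2 := C ((X - C r) ^ (2 * N)) with hq
  have hab' : C a * xx ^ m + C b * q = 1 := by
    rw [hq, xx, ← C_pow, ← C_mul, ← C_mul, ← C_add, hab, C_1]
  set R' := C a ^ 2 * R + (2 * C b - C b ^ 2 * q) * g with hR'
  obtain ⟨ρ, hρ, hρ1, -⟩ := T_bd' R'
  refine ⟨ρ, hρ, ?_⟩
  have hq2 : C ((X - C r) ^ 2) ^ N = q := by rw [← C_pow, ← pow_mul]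
  have hqT : q ∈ T := by rw [← hq2]; exact T.pow_mem (C_sq_mem _) _
  have := T.add_mem (T.mul_mem (T_sq (C a)) ht) (T.mul_mem hqT hρ1)
  convert this using 1
  rw [hq2, hR']
  linear_combination C a ^ 2 * e - (1 + C a * xx ^ m - C b * q) * g * hab'

end localPos
end Sat

end

noncomputable section
namespace Sat
open Polynomial

section localZero

lemma pow_diff_mem (j : ℕ) : (xx ^ 2) ^ j - yy ^ j ∈ T := by
  induction j with
  | zero => simp
  | succ j ih =>
    have := T.add_mem (T.mul_mem ih (T_sq xx)) (T.mul_mem (T.pow_mem T_y j) T_xy)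
    convert this using 1; ring

lemma J_term (M j : ℕ) (p : Polynomial ℝ) (hp : X ^ M ∣ p * X ^ (2 * j)) :
    ∃ C₀, 0 ≤ C₀ ∧ C p * X ^ j + cst C₀ * xx ^ M ∈ T := by
  rcases le_or_gt (2 * j) M with h | h
  · obtain ⟨k, rfl⟩ := Nat.exists_eq_add_of_le h
    obtain ⟨w, hw⟩ := hp
    have hpw : p = X ^ k * w := by
      have h0 : (X ^ (2 * j) : Polynomial ℝ) ≠ 0 := pow_ne_zero _ X_ne_zero
      apply mul_left_cancel₀ h0
      rw [pow_add] at hw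
      linear_combination hw
    obtain ⟨r, hr, h1, -⟩ := T_bd' (C w)
    refine ⟨r, hr, ?_⟩
    have := T.add_mem (T.mul_mem (T.mul_mem (T_cst hr) (T.pow_mem T_x k)) (pow_diff_mem j))
      (T.mul_mem (T.mul_mem (T.pow_mem T_x k) (T.pow_mem T_y j)) h1)
    convert this using 1
    rw [hpw, C_mul, C_pow, pow_add, pow_mul]
    simp only [xx, yy]
    ring
  · set j0 := (M + 1) / 2
    obtain ⟨k, hk⟩ := Nat.exists_eq_add_of_le (show j0 ≤ j by omega)
    obtain ⟨b, hb⟩ := Nat.exists_eq_add_of_le (show M ≤ 2 * j0 by omega)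
    obtain ⟨r, hr, h1, -⟩ := T_bd' (C p * yy ^ k)
    refine ⟨r, hr, ?_⟩
    have h3 : xx ^ M - xx ^ (2 * j0) ∈ T := by
      have hb1 : b = 0 ∨ b = 1 := by omega
      rcases hb1 with rfl | rfl
      · rw [hb]; simp
      · have := T.mul_mem (T.pow_mem T_x M) T_1x
        rw [hb]
        convert this using 1; ring
    have := T.add_mem (T.mul_mem (T_cst hr) h3) (T.add_mem
      (T.mul_mem (T_cst hr) (pow_diff_mem j0)) (T.mul_mem (T.pow_mem T_y j0) h1))
    convert this using 1
    rw [hk, pow_add, pow_mul]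
    simp only [xx, yy]
    ring

lemma coeff_blow (g : P2) (j : ℕ) : (blow g).coeff j = g.coeff j * X ^ (2 * j) := by
  rw [blow, comp_C_mul_X_coeff, pow_mul]

lemma J_mem (M : ℕ) (h : P2) (hh : C (X ^ M) ∣ blow h) :
    ∃ C₀, 0 ≤ C₀ ∧ h + cst C₀ * xx ^ M ∈ T := by
  have key : ∀ s : Finset ℕ, ∃ C₀, 0 ≤ C₀ ∧
      (∑ j ∈ s, C (h.coeff j) * X ^ j) + cst C₀ * xx ^ M ∈ T := by
    intro s
    induction s using Finset.induction_on with
    | empty => exact ⟨0, le_rfl, by simp⟩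
    | insert a s ha ih =>
      obtain ⟨c1, hc1, h1⟩ := ih
      obtain ⟨c2, hc2, h2⟩ := J_term M a (h.coeff a) (by
        rw [← coeff_blow]; exact (C_dvd_iff_dvd_coeff _ _).mp hh a)
      refine ⟨c2 + c1, by positivity, ?_⟩
      have := T.add_mem h2 h1
      rw [Finset.sum_insert ha, cst_add]
      convert this using 1; ring
  obtain ⟨c, hc, h1⟩ := key (Finset.range (h.natDegree + 1))
  rw [← as_sum_range_C_mul_X_pow] at h1
  exact ⟨c, hc, h1⟩

lemma blow_Hg (P : P2) (e : ℕ) (hP : P.natDegree ≤ e) :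
    blow (Hg yy (xx ^ 2) e P) = C (X ^ (2 * e)) * P := by
  apply Polynomial.induction_with_natDegree_le
    (fun P => blow (Hg yy (xx ^ 2) e P) = C (X ^ (2 * e)) * P) (N := e)
  · simp [Hg_zero, blow]
  · intro n r hr hn
    obtain ⟨k, rfl⟩ := Nat.exists_eq_add_of_le hn
    rw [Hg_C_mul, Hg_X_pow _ _ hn, Nat.add_sub_cancel_left]
    simp only [blow, mul_comp, pow_comp, C_comp, xx, yy, X_comp, C_pow]
    ring
  · intro f g _ _ hf hg
    rw [Hg_add, blow_add, hf, hg]; ring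
  · exact hP

/-- lower bound for the unit part -/
lemma unit_part (V U : P2) (s : ℕ) (κ : ℝ) (hκ : 0 < κ) (hV : blow V = C (X ^ s) * U)
    (hU : C X ∣ U - cst κ) (N : ℕ) : ∃ C₀, 0 ≤ C₀ ∧ V + cst C₀ * xx ^ N ∈ T := by
  obtain ⟨c1, hc1, h1⟩ := J_mem (s + 1) (V - cst κ * xx ^ s) (by
    obtain ⟨w, hw⟩ := hU
    refine ⟨w, ?_⟩
    have e1 : blow (V - cst κ * xx ^ s) = blow V - cst κ * C (X ^ s) := by
      simp [blow, cst, xx]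
    rw [e1, hV, pow_succ, C_mul]
    linear_combination C (X ^ s) * hw)
  have h2 : ∃ c, 0 ≤ c ∧ cst κ - cst c1 * xx + cst c * xx ^ N ∈ T := by
    set x0 := κ / (2 * (c1 + 1)) with hx0
    have hx0p : 0 < x0 := by positivity
    refine ⟨(c1 + 1) / x0 ^ N, by positivity, ?_⟩
    apply pss
    intro a b hab
    obtain ⟨ha0, ha1, -, -⟩ := hab
    simp only [map_add, map_sub, map_mul, map_pow, ev_cst, ev_xx]
    rcases lt_or_ge a x0 with h | h
    · have e1 : (c1 + 1) * x0 = κ / 2 := by rw [hx0]; field_simp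
      have e2 : 0 ≤ (c1 + 1) / x0 ^ N * a ^ N := by positivity
      nlinarith
    · have e2 : c1 + 1 ≤ (c1 + 1) / x0 ^ N * a ^ N := by
        rw [div_mul_eq_mul_div, le_div_iff₀ (by positivity)]
        gcongr
      nlinarith
  obtain ⟨c2, hc2, h2⟩ := h2
  refine ⟨c2, hc2, ?_⟩
  have h3 : 1 - xx ^ s ∈ T := by
    clear * -
    induction s with
    | zero => simp
    | succ n ih =>
      have := T.add_mem ih (T.mul_mem (T.pow_mem T_x n) T_1x)
      convert this using 1; ring
  have := T.add_mem (T.add_mem h1 (T.mul_mem (T.pow_mem T_x s) h2))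
    (T.mul_mem (T.mul_mem (T_cst hc2) (T.pow_mem T_x N)) h3)
  convert this using 1
  ring

/-- swap -/
def phi : P2 →+* PowerSeries (Polynomial ℝ) := (sw).comp (mapRingHom coP)

lemma coeff_phi (F : P2) (n j : ℕ) :
    (PowerSeries.coeff n (phi F)).coeff j = (F.coeff j).coeff n := by
  rw [phi, RingHom.comp_apply, coeff_sw, coe_mapRingHom, coeff_map]
  simp

def tr (N : ℕ) (F : PowerSeries (Polynomial ℝ)) : P2 :=
  ∑ n ∈ Finset.range N, C (X ^ n) * (PowerSeries.coeff n F).map C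

lemma coeff_tr (N : ℕ) (F : PowerSeries (Polynomial ℝ)) (n j : ℕ) :
    ((tr N F).coeff j).coeff n = if n < N then (PowerSeries.coeff n F).coeff j else 0 := by
  rw [tr, finsetSum_coeff, finsetSum_coeff]
  simp only [coeff_C_mul, coeff_map, coeff_mul_C, coeff_X_pow]
  simp

lemma phi_tr (N : ℕ) (F : PowerSeries (Polynomial ℝ)) : PowerSeries.X ^ N ∣ F - phi (tr N F) := by
  rw [PowerSeries.X_pow_dvd_iff]
  intro n hn
  ext1 j
  rw [map_sub, coeff_sub, coeff_phi, coeff_tr, if_pos hn, sub_self, coeff_zero]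

lemma phi_dvd (N : ℕ) (D : P2) (h : PowerSeries.X ^ N ∣ phi D) : C (X ^ N) ∣ D := by
  rw [PowerSeries.X_pow_dvd_iff] at h
  rw [C_dvd_iff_dvd_coeff]
  intro j
  rw [X_pow_dvd_iff]
  intro n hn
  rw [← coeff_phi, h n hn, coeff_zero]

end localZero
end Sat

end

noncomputable section
namespace Sat
open Polynomial

section localZero2

lemma dvd_shift_iff (l j : ℕ) (u : Polynomial ℝ) :
    X ^ (2 * j) ∣ X ^ l * u ↔ ∀ n, l + n < 2 * j → u.coeff n = 0 := by
  rw [X_pow_dvd_iff]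
  constructor
  · intro h n hn
    have := h (l + n) hn
    rwa [add_comm, coeff_X_pow_mul] at this
  · intro h d hd
    rw [coeff_X_pow_mul']
    split_ifs with hl
    · exact h _ (by omega)
    · rfl

lemma hensel_local (f : P2) (l : ℕ) (hl : ∀ j, X ^ (2 * j) ∣ X ^ l * f.coeff j)
    (h0 : ¬ (C X ∣ f)) (N : ℕ) (hN : 0 < N) :
    ∃ (e : ℕ) (P U : P2) (κ : ℝ), 2 * e ≤ l ∧ P.natDegree ≤ e ∧ 0 < κ ∧ C X ∣ U - cst κ ∧
      (∀ j, X ^ (2 * j) ∣ X ^ (l - 2 * e) * U.coeff j) ∧ C (X ^ N) ∣ f - P * U := by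
  simp only [dvd_shift_iff] at hl ⊢
  set p0 := PowerSeries.coeff 0 (phi f) with hp0
  have hp0ne : p0 ≠ 0 := by
    intro h
    apply h0
    have := phi_dvd 1 f (by
      rw [PowerSeries.X_pow_dvd_iff]
      intro m hm
      obtain rfl : m = 0 := by omega
      exact h)
    simpa using this
  set e := p0.natDegree with he
  set a := p0.leadingCoeff with ha
  have ha0 : a ≠ 0 := leadingCoeff_ne_zero.mpr hp0ne
  have hel : 2 * e ≤ l := by
    by_contra hcon
    have h1 := hl e 0 (by omega)
    rw [← coeff_phi] at h1
    exact ha0 h1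
  set p := p0 * C a⁻¹ with hp
  have hpm : p.Monic := monic_mul_leadingCoeff_inv hp0ne
  have hpe : p.natDegree = e := by
    rw [hp, natDegree_mul_C (inv_ne_zero ha0)]
  obtain ⟨P, Q, hPQ, hP0, hQ0, hPd⟩ := hensel (phi f) p (C a) hpm
    ⟨0, C a⁻¹, by rw [← C_mul, inv_mul_cancel₀ ha0]; simp⟩ (by
      rw [hp, mul_assoc, ← C_mul, inv_mul_cancel₀ ha0]; simp [hp0])
  have hPd' : ∀ n, (PowerSeries.coeff n P).natDegree ≤ e := by
    intro n
    rcases Nat.eq_zero_or_pos n with rfl | hn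
    · rw [hP0, hpe]
    · rw [← hpe]; exact natDegree_le_natDegree (hPd n hn).le
  have hfd : ∀ n, 2 * (PowerSeries.coeff n (phi f)).natDegree ≤ l + n := by
    intro n
    by_contra hcon
    push Not at hcon
    have h1 := hl (PowerSeries.coeff n (phi f)).natDegree n hcon
    rw [← coeff_phi, coeff_natDegree, leadingCoeff_eq_zero] at h1
    rw [h1] at hcon
    simp at hcon
  have hQd : ∀ n, 2 * (PowerSeries.coeff n Q).natDegree ≤ (l - 2 * e) + n := by
    intro n
    induction n using Nat.strong_induction_on with
    | _ n ih =>
      rcases n with _ | n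
      · rw [hQ0, natDegree_C]; omega
      · by_cases hQn : PowerSeries.coeff (n + 1) Q = 0
        · rw [hQn]; simp
        have h1 := coeff_mul_succ' P Q n
        rw [← hPQ, hP0] at h1
        have h2 : p * PowerSeries.coeff (n + 1) Q = PowerSeries.coeff (n + 1) (phi f) -
          ∑ i ∈ Finset.range (n + 1),
            PowerSeries.coeff (i + 1) P * PowerSeries.coeff (n + 1 - (i + 1)) Q := by
          rw [h1]; ring
        have h3 := congrArg natDegree h2
        rw [hpm.natDegree_mul' hQn, hpe] at h3
        have h4 : (PowerSeries.coeff (n + 1) (phi f) -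
          ∑ i ∈ Finset.range (n + 1),
            PowerSeries.coeff (i + 1) P * PowerSeries.coeff (n + 1 - (i + 1)) Q).natDegree ≤
            (l + (n + 1)) / 2 := by
          refine (natDegree_sub_le_of_le (m := (l + (n + 1)) / 2) (n := (l + (n + 1)) / 2)
            ?_ ?_).trans (max_self _).le
          · have := hfd (n + 1); omega
          · apply natDegree_sum_le_of_forall_le
            intro i hi
            rw [Finset.mem_range] at hi
            refine (natDegree_mul_le_of_le (hPd' (i + 1)) le_rfl).trans ?_
            have := ih (n + 1 - (i + 1)) (by omega)
            omega
        omega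
  set ε : ℝ := if 0 < a then 1 else -1 with hε
  have hεε : ε * ε = 1 := by rw [hε]; split_ifs <;> norm_num
  have hεa : 0 < ε * a := by
    rw [hε]; split_ifs with h
    · linarith
    · have : a < 0 := lt_of_le_of_ne (not_lt.mp h) ha0
      linarith
  refine ⟨e, cst ε * tr N P, cst ε * tr N Q, ε * a, hel, ?_, hεa, ?_, ?_, ?_⟩
  · refine (natDegree_C_mul_le _ _).trans ?_
    rw [natDegree_le_iff_coeff_eq_zero]
    intro j hj
    ext n
    rw [coeff_tr]
    split_ifs
    · rw [coeff_eq_zero_of_natDegree_lt (lt_of_le_of_lt (hPd' n) hj)]; simp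
    · simp
  · have := phi_dvd 1 (tr N Q - cst a) (by
      rw [PowerSeries.X_pow_dvd_iff]
      intro m hm
      obtain rfl : m = 0 := by omega
      ext1 j
      rw [coeff_phi, coeff_sub, coeff_sub, coeff_tr, if_pos hN, hQ0, cst, coeff_C, coeff_C]
      split_ifs <;> simp)
    rw [pow_one] at this
    rw [cst_mul, ← mul_sub]
    exact this.mul_left _
  · intro j n hn
    rw [cst, coeff_C_mul, coeff_C_mul, coeff_tr]
    split_ifs
    · rw [coeff_eq_zero_of_natDegree_lt, mul_zero]
      have := hQd n
      omega
    · simp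
  · have e1 : cst ε * tr N P * (cst ε * tr N Q) = tr N P * tr N Q := by
      have : cst ε * cst ε = 1 := by rw [← cst_mul, hεε, cst_one]
      linear_combination tr N P * tr N Q * this
    rw [e1]
    apply phi_dvd
    rw [map_sub, map_mul, hPQ]
    have : P * Q - phi (tr N P) * phi (tr N Q) =
      (P - phi (tr N P)) * Q + phi (tr N P) * (Q - phi (tr N Q)) := by ring
    rw [this]
    exact dvd_add ((phi_tr N P).mul_right _) ((phi_tr N Q).mul_left _)

lemma bd_sq (g : P2) : ∃ M > 0, ∀ u z : ℝ, 0 ≤ u → u ≤ 1 → 0 ≤ z → z ≤ 1 → |ev u z g| ≤ M := by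
  obtain ⟨M, hM⟩ := (isCompact_Icc (a := ((0:ℝ),(0:ℝ))) (b := ((1:ℝ),(1:ℝ)))).exists_bound_of_continuousOn
    (ev_cont g).continuousOn
  refine ⟨|M| + 1, by positivity, fun u z h1 h2 h3 h4 => ?_⟩
  have := hM (u, z) ⟨⟨h1, h3⟩, ⟨h2, h4⟩⟩
  rw [Real.norm_eq_abs] at this
  exact this.trans ((le_abs_self M).trans (by linarith))

/-- positivity of the distinguished factor -/
lemma factor_lower (f P U : P2) (κ c δ : ℝ) (hκ : 0 < κ) (hc : 0 < c) (hδ : 0 < δ) (K : ℕ)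
    (hU : C X ∣ U - cst κ) (hf : C (X ^ (K + 1)) ∣ f - P * U)
    (h : ∀ u z, 0 < u → u < δ → 0 ≤ z → z ≤ 1 → c * u ^ K ≤ ev u z f) :
    ∃ c' δ' : ℝ, 0 < c' ∧ 0 < δ' ∧ ∀ u z, 0 ≤ u → u < δ' → 0 ≤ z → z ≤ 1 →
      c' * u ^ K ≤ ev u z P := by
  obtain ⟨W, hW⟩ := hU
  obtain ⟨R, hR⟩ := hf
  obtain ⟨M1, hM1, hW1⟩ := bd_sq W
  obtain ⟨M2, hM2, hR1⟩ := bd_sq R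
  set δ' := min δ (min 1 (min (κ / (2 * M1)) (c / (2 * M2)))) with hδ'
  have hδ'p : 0 < δ' := by rw [hδ']; positivity
  have main : ∀ u z, 0 < u → u < δ' → 0 ≤ z → z ≤ 1 → c / (4 * κ) * u ^ K ≤ ev u z P := by
    intro u z hu hud hz hz1
    have d1 : u < δ := lt_of_lt_of_le hud (min_le_left _ _)
    have d2 := lt_of_lt_of_le hud (min_le_right _ _)
    have d3 : u < 1 := lt_of_lt_of_le d2 (min_le_left _ _)
    have d4 := lt_of_lt_of_le d2 (min_le_right _ _)
    have d5 := lt_of_lt_of_le d4 (min_le_left _ _)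
    have d6 := lt_of_lt_of_le d4 (min_le_right _ _)
    rw [lt_div_iff₀ (by positivity)] at d5 d6
    have w1 := hW1 u z hu.le d3.le hz hz1
    have r1 := hR1 u z hu.le d3.le hz hz1
    have f1 := h u z hu d1 hz hz1
    have eW := congrArg (ev u z) hW
    have eR := congrArg (ev u z) hR
    rw [map_sub, ev_cst, map_mul, ev_C, eval_X] at eW
    rw [map_sub, map_mul, map_mul, ev_C, eval_pow, eval_X] at eR
    rw [abs_le] at w1 r1
    set UU := ev u z U
    set PP := ev u z P
    have hU1 : κ / 2 < UU := by nlinarith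
    have hU2 : UU < 2 * κ := by nlinarith
    have hK : 0 < u ^ K := by positivity
    have hPU : c / 2 * u ^ K ≤ PP * UU := by
      have : u ^ (K + 1) * ev u z R ≤ c / 2 * u ^ K := by
        rw [pow_succ]
        have : u * ev u z R ≤ c / 2 := by nlinarith
        nlinarith
      nlinarith
    have hPP : 0 < PP := by
      by_contra hcon
      push Not at hcon
      have : 0 < c / 2 * u ^ K := by positivity
      nlinarith
    rw [div_mul_eq_mul_div, div_le_iff₀ (by positivity)]
    nlinarith
  refine ⟨c / (4 * κ), δ', by positivity, hδ'p, fun u z hu hud hz hz1 => ?_⟩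
  rcases eq_or_lt_of_le hu with rfl | hu0
  · have hcont : Continuous fun u : ℝ => ev u z P - c / (4 * κ) * u ^ K := by
      have := (ev_cont P).comp (Continuous.prodMk_left z)
      exact Continuous.sub this (by fun_prop)
    have h1 : Filter.Tendsto (fun u : ℝ => ev u z P - c / (4 * κ) * u ^ K)
      (nhdsWithin 0 (Set.Ioi 0)) (nhds (ev 0 z P - c / (4 * κ) * 0 ^ K)) :=
      (hcont.tendsto 0).mono_left nhdsWithin_le_nhds
    have h2 := ge_of_tendsto h1 (b := 0) (by
      filter_upwards [Ioo_mem_nhdsGT hδ'p] with u hu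
      have := main u z hu.1 hu.2 hz hz1
      linarith)
    linarith
  · exact main u z hu0 hud hz hz1

lemma local_zero (g : P2) (c δ : ℝ) (hc : 0 < c) (hδ : 0 < δ) (K : ℕ)
    (h : ∀ a b, inK a b → |a| < δ → c * |a| ^ K ≤ ev a b g) (N : ℕ) :
    ∃ C₀ : ℝ, 0 ≤ C₀ ∧ g + cst C₀ * C (X ^ 2) ^ N ∈ T := by
  have hb0 : blow g ≠ 0 := by
    intro hb
    set x := min δ 1 / 2
    have hx : 0 < x := by positivity
    have h1 := h x 0 ⟨hx.le, by have := min_le_right δ 1; simp only [x]; linarith, le_rfl, by positivity⟩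
      (by rw [abs_of_pos hx]; have := min_le_left δ 1; simp only [x]; linarith)
    have h2 := ev_blow g x 0
    rw [hb, map_zero, mul_zero] at h2
    rw [← h2, abs_of_pos hx] at h1
    have : 0 < c * x ^ K := by positivity
    linarith
  obtain ⟨l, f, hfX, hbf⟩ := WfDvdMonoid.max_power_factor' hb0
    (x := (C X : P2)) (by rw [isUnit_C]; exact not_isUnit_X)
  rw [← C_pow] at hbf
  set N' := max (K + 1) (2 * N) with hN'
  obtain ⟨e, P, U, κ, hel, hPd, hκ, hU, hUd, hfPU⟩ := hensel_local f l (by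
    intro j
    refine ⟨g.coeff j, ?_⟩
    have := coeff_blow g j
    rw [hbf, coeff_C_mul] at this
    rw [this]; ring) hfX N' (by omega)
  obtain ⟨c', δ', hc', hδ', hPl⟩ := factor_lower f P U κ c (min δ 1) hκ hc (by positivity) K hU
    ((_root_.map_dvd (C : Polynomial ℝ →+* P2) (pow_dvd_pow X (le_max_left (K + 1) (2 * N)))).trans hfPU) (by
      intro u z hu hu1 hz hz1
      have d1 := lt_of_lt_of_le hu1 (min_le_left _ _)
      have d2 := lt_of_lt_of_le hu1 (min_le_right _ _)
      have h1 := h u (u ^ 2 * z) ⟨hu.le, d2.le, by positivity, by nlinarith [sq_nonneg u]⟩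
        (by rwa [abs_of_pos hu])
      rw [← ev_blow, hbf, map_mul, ev_C, eval_pow, eval_X, abs_of_pos hu] at h1
      have h2 : u ^ l ≤ 1 := pow_le_one₀ hu.le d2.le
      have h3 : 0 < u ^ l := by positivity
      have h4 : 0 < c * u ^ K := by positivity
      have h5 : 0 < ev u z f := by
        by_contra hcon
        push Not at hcon
        nlinarith
      nlinarith)
  obtain ⟨t, ht, R, hR⟩ := stepC_end P e hPd 0 1 c' δ' (by norm_num) (by
      have := T_x
      convert this using 1
      simp [xx]) hc' hδ' K (by
      intro u z hu hu1 hz hz1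
      simpa using hPl u z hu hu1 hz hz1) (2 * N)
  rw [C_0, sub_zero] at hR
  -- the polynomial V
  choose v hv using hUd
  obtain ⟨V, hV⟩ : ∃ V : P2, blow V = C (X ^ (l - 2 * e)) * U := by
    refine ⟨∑ j ∈ Finset.range (U.natDegree + 1), monomial j (v j), ?_⟩
    ext1 j
    rw [coeff_blow, coeff_C_mul, finsetSum_coeff]
    simp only [coeff_monomial, Finset.sum_ite_eq', Finset.mem_range]
    split_ifs with hj
    · rw [hv]; ring
    · rw [coeff_eq_zero_of_natDegree_lt (by omega)]; simp
  obtain ⟨c1, hc1, hV1⟩ := unit_part V U _ κ hκ hV hU (2 * N)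
  set G := Hg yy (xx ^ 2) e P with hG
  obtain ⟨c2, hc2, hJ⟩ := J_mem (2 * N) (g - G * V) (by
    have e1 : blow (g - G * V) = C (X ^ l) * (f - P * U) := by
      have e2 : blow (g - G * V) = blow g - blow G * blow V := by simp [blow]
      have e3 : (C (X ^ l) : P2) = C (X ^ (2 * e)) * C (X ^ (l - 2 * e)) := by
        rw [← C_mul, ← pow_add]; congr 2; omega
      rw [e2, hbf, hV, hG, blow_Hg P e hPd, mul_sub]
      rw [e3]; ring
    rw [e1]
    exact ((_root_.map_dvd (C : Polynomial ℝ →+* P2) (pow_dvd_pow X (le_max_right (K + 1) (2 * N)))).trans hfPU).mul_left _)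
  set x2 : P2 := xx ^ (2 * N) with hx2
  have hx2' : (C (X ^ (2 * N)) : P2) = x2 := by rw [C_pow]; rfl
  rw [hx2'] at hR
  obtain ⟨c3, hc3, h3, -⟩ := T_bd' (R * V - cst c1 * t)
  refine ⟨c2 + c3, by positivity, ?_⟩
  have := T.add_mem (T.add_mem (T.mul_mem ht hV1) hJ) (T.mul_mem (T.pow_mem T_x (2 * N)) h3)
  rw [← hx2] at this
  convert this using 1
  have e5 : (C (X ^ 2) : P2) ^ N = x2 := by rw [← C_pow, ← pow_mul, hx2']
  rw [e5, cst_add, hR]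
  ring

end localZero2
end Sat

end

noncomputable section
namespace Sat
open Polynomial

lemma ev_eq_map (a b : ℝ) (f : P2) : ev a b f = (f.map (evalRingHom a)).eval b := by
  rw [ev_eval₂, eval_map]

lemma Icc_ball_infinite (a δ : ℝ) (h0 : 0 ≤ a) (h1 : a ≤ 1) (hδ : 0 < δ) :
    {x : ℝ | 0 ≤ x ∧ x ≤ 1 ∧ |x - a| < δ}.Infinite := by
  have h : max 0 (a - δ / 2) < min 1 (a + δ / 2) := by
    apply max_lt <;> apply lt_min <;> linarith
  apply (Set.Icc_infinite h).mono
  rintro x ⟨h2, h3⟩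
  have h4 := (max_le_iff.mp h2)
  have h5 := (le_min_iff.mp h3)
  exact ⟨h4.1, h5.1, by rw [abs_lt]; constructor <;> linarith [h4.2, h5.2]⟩

lemma P2_vanish (h : P2) (A B : Set ℝ) (hA : A.Infinite) (hB : B.Infinite)
    (hv : ∀ a ∈ A, ∀ b ∈ B, ev a b h = 0) : h = 0 := by
  ext1 j
  rw [coeff_zero]
  apply eq_zero_of_infinite_isRoot
  apply hA.mono
  intro a ha
  have h1 : h.map (evalRingHom a) = 0 := by
    apply eq_zero_of_infinite_isRoot
    apply hB.mono
    intro b hb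
    have := hv a ha b hb
    rw [ev_eq_map] at this
    exact this
  have h2 := congrArg (fun p => coeff p j) h1
  simpa using h2

lemma dens (g f : P2) (hg : g ≠ 0) (hg0 : ∀ a b, inK a b → 0 ≤ ev a b g)
    (hgf : ∀ a b, inK a b → 0 ≤ ev a b (g * f)) : ∀ a b, inK a b → 0 ≤ ev a b f := by
  intro a b hab
  by_contra hneg
  push Not at hneg
  obtain ⟨t, ht0, ht1, hbt⟩ : ∃ t : ℝ, 0 ≤ t ∧ t ≤ 1 ∧ b = a ^ 2 * t := by
    obtain ⟨h1, h2, h3, h4⟩ := hab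
    rcases h1.eq_or_lt with h | h
    · refine ⟨0, le_rfl, zero_le_one, ?_⟩
      rw [← h] at h4 ⊢
      simp at h4 ⊢
      linarith
    · refine ⟨b / a ^ 2, by positivity, (div_le_one (by positivity)).mpr h4, by field_simp⟩
  have hcont := ev_cont (blow f)
  have hopen : IsOpen {p : ℝ × ℝ | ev p.1 p.2 (blow f) < 0} := isOpen_lt hcont continuous_const
  have hmem : (a, t) ∈ {p : ℝ × ℝ | ev p.1 p.2 (blow f) < 0} := by
    show ev a t (blow f) < 0
    rw [ev_blow, ← hbt]; exact hneg
  obtain ⟨δ, hδ, hball⟩ := Metric.isOpen_iff.mp hopen _ hmem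
  have hz : blow g = 0 := by
    apply P2_vanish _ _ _ (Icc_ball_infinite a δ hab.1 hab.2.1 hδ)
      (Icc_ball_infinite t δ ht0 ht1 hδ)
    rintro x ⟨hx0, hx1, hx⟩ z ⟨hz0, hz1, hz⟩
    have h1 : (x, z) ∈ Metric.ball (a, t) δ := by
      rw [Metric.mem_ball, Prod.dist_eq]
      exact max_lt hx hz
    have h2 : ev x z (blow f) < 0 := hball h1
    rw [ev_blow] at h2 ⊢
    have hK : inK x (x ^ 2 * z) := ⟨hx0, hx1, by positivity, by nlinarith [sq_nonneg x]⟩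
    have h3 := hg0 _ _ hK
    have h4 := hgf _ _ hK
    rw [map_mul] at h4
    nlinarith
  apply hg
  ext1 j
  have := congrArg (fun p => coeff p j) hz
  simp only [coeff_blow, coeff_zero] at this
  rw [coeff_zero]
  rcases mul_eq_zero.mp this with h | h
  · exact h
  · exact absurd h (pow_ne_zero _ X_ne_zero)

lemma loj (f u v : P2) (D : Polynomial ℝ) (hD : D ≠ 0) (e : u * f + v * derivative f = C D)
    (h0 : f.coeff 0 ≠ 0) (h1 : f.eval (X ^ 2) ≠ 0) (hf : ∀ a b, inK a b → 0 ≤ ev a b f) :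
    ∃ (d : Polynomial ℝ) (c : ℝ), d ≠ 0 ∧ 0 < c ∧ ∀ a b, inK a b → c * |d.eval a| ≤ ev a b f := by
  set p0 := f.coeff 0 with hp0
  set p1 := f.eval (X ^ 2) with hp1
  obtain ⟨M0, hM0, b0⟩ := exists_upper (C (D * p1))
  obtain ⟨M1, hM1, b1⟩ := exists_upper (C (D * p0))
  obtain ⟨M2, hM2, b2⟩ := exists_upper (u * C (p0 * p1))
  refine ⟨D * p0 * p1, (M0 + M1 + M2)⁻¹, mul_ne_zero (mul_ne_zero hD h0) h1, by positivity, ?_⟩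
  intro a b hab
  obtain ⟨ha0, ha1, hb0, hb1⟩ := hab
  set F := f.map (evalRingHom a) with hF
  obtain ⟨m, hm, hmin⟩ := isCompact_Icc.exists_isMinOn (s := Set.Icc 0 (a ^ 2))
    ⟨b, hb0, hb1⟩ (F.continuous.continuousOn)
  have hK : inK a m := ⟨ha0, ha1, hm.1, hm.2⟩
  have hle : ev a m f ≤ ev a b f := by
    rw [ev_eq_map, ev_eq_map]; exact hmin ⟨hb0, hb1⟩
  have hpos := hf a m hK
  rw [inv_mul_le_iff₀ (by positivity)]
  suffices hs : ∃ M, 0 ≤ M ∧ M ≤ M0 + M1 + M2 ∧ |(D * p0 * p1).eval a| ≤ M * ev a m f by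
    obtain ⟨M, hM, hM', hs⟩ := hs
    calc _ ≤ M * ev a m f := hs
      _ ≤ (M0 + M1 + M2) * ev a b f := by gcongr
  by_cases hm0 : m = 0
  · refine ⟨M0, hM0.le, by linarith, ?_⟩
    have h2 : ev a m f = p0.eval a := by
      rw [ev_eq_map, hm0, ← coeff_zero_eq_eval_zero, coeff_map]; rfl
    have h3 := b0 a m hK
    rw [ev_C] at h3
    rw [h2] at hpos ⊢
    rw [eval_mul] at h3
    rw [eval_mul, eval_mul, show D.eval a * p0.eval a * p1.eval a =
      (D.eval a * p1.eval a) * p0.eval a by ring, abs_mul, abs_of_nonneg hpos]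
    gcongr
  by_cases hm1 : m = a ^ 2
  · refine ⟨M1, hM1.le, by linarith, ?_⟩
    have h2 : ev a m f = p1.eval a := by
      rw [ev_eq_map, hm1, hp1]
      have := eval_map_apply (p := f) (f := evalRingHom a) (X ^ 2)
      simpa using this
    have h3 := b1 a m hK
    rw [ev_C] at h3
    rw [h2] at hpos ⊢
    rw [eval_mul] at h3
    rw [eval_mul, eval_mul, abs_mul, abs_of_nonneg hpos]
    gcongr
  · refine ⟨M2, hM2.le, by linarith, ?_⟩
    have hlt0 : 0 < m := lt_of_le_of_ne hm.1 (Ne.symm hm0)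
    have hlt1 : m < a ^ 2 := lt_of_le_of_ne hm.2 hm1
    have hloc : IsLocalMin (fun y => F.eval y) m := hmin.isLocalMin (Icc_mem_nhds hlt0 hlt1)
    have hd := hloc.hasDerivAt_eq_zero (F.hasDerivAt m)
    rw [hF, derivative_map, ← ev_eq_map] at hd
    have h3 := congrArg (ev a m) e
    rw [map_add, map_mul, map_mul, hd, ev_C] at h3
    have h4 := b2 a m hK
    rw [map_mul, ev_C, eval_mul] at h4
    rw [eval_mul, eval_mul, ← h3, show (ev a m u * ev a m f + ev a m v * 0) * p0.eval a * p1.eval a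
      = (ev a m u * (p0.eval a * p1.eval a)) * ev a m f by ring, abs_mul, abs_of_nonneg hpos]
    gcongr

lemma globalize (f : P2) (d : Polynomial ℝ) (c : ℝ) (hd : d ≠ 0) (hc : 0 < c)
    (h : ∀ a b, inK a b → c * |d.eval a| ≤ ev a b f) : f ∈ T := by
  classical
  have hpsd : ∀ a b, inK a b → 0 ≤ ev a b f := fun a b hab =>
    le_trans (by positivity) (h a b hab)
  choose e cr δ hcr hδ hlow using poly_lower d hd
  set S : Finset ℝ := insert 0 (d.roots.toFinset.filter (fun r => 0 ≤ r ∧ r ≤ 1)) with hS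
  set k := S.sup e + 1 with hk
  have hS01 : ∀ r ∈ S, 0 ≤ r ∧ r ≤ 1 := by
    intro r hr
    rw [hS, Finset.mem_insert, Finset.mem_filter] at hr
    rcases hr with rfl | hr
    · norm_num
    · exact hr.2
  set q0 : Polynomial ℝ := ∏ s ∈ S, (X - C s) with hq0
  obtain ⟨c0, hc0, hg⟩ := many_glue f S k (k + 1) (by
    intro r hr
    have hq : q0 = (X - C r) * ∏ s ∈ S.erase r, (X - C s) := (Finset.mul_prod_erase _ _ hr).symm
    set q1 := ∏ s ∈ S.erase r, (X - C s) with hq1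
    obtain ⟨M, hM, hMb⟩ := exists_upper (C ((q1 ^ 2) ^ k))
    have hcc : 0 < c * cr r := mul_pos hc (hcr r)
    have hek : e r + 1 ≤ 2 * k := by
      have : e r ≤ S.sup e := Finset.le_sup hr
      omega
    have hbound : ∀ a b, inK a b → |a - r| < min (δ r) (c * cr r / (2 * M)) →
        (c * cr r / 2) * |a - r| ^ (e r) ≤ ev a b (f - C (q0 ^ 2) ^ k) := by
      intro a b hab har
      have h1 := lt_of_lt_of_le har (min_le_left _ _)
      have h2 := lt_of_lt_of_le har (min_le_right _ _)
      have h3 := hlow r a h1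
      have h4 := h a b hab
      have h5 := hMb a b hab
      rw [lt_div_iff₀ (by positivity)] at h2
      rw [ev_C] at h5
      have hr01 := hS01 r hr
      have har1 : |a - r| ≤ 1 := by
        rw [abs_le]; constructor <;> linarith [hab.1, hab.2.1]
      have h6 : |a - r| ^ (2 * k) ≤ |a - r| ^ (e r + 1) :=
        pow_le_pow_of_le_one (abs_nonneg _) har1 hek
      have h7 : ev a b (C (q0 ^ 2) ^ k) = |a - r| ^ (2 * k) * ((q1 ^ 2) ^ k).eval a := by
        rw [map_pow, ev_C, hq, pow_mul, sq_abs]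
        simp only [eval_pow, eval_mul, eval_sub, eval_X, eval_C]
        rw [mul_pow, mul_pow]
      have h8 : ev a b (C (q0 ^ 2) ^ k) ≤ |a - r| ^ (e r) * |a - r| * M := by
        rw [h7, ← pow_succ]
        exact (mul_le_mul_of_nonneg_left ((le_abs_self _).trans h5) (by positivity)).trans
          (mul_le_mul_of_nonneg_right h6 hM.le)
      have h9 : 0 ≤ |a - r| ^ (e r) := by positivity
      rw [map_sub]
      have h10 : c * (cr r * |a - r| ^ e r) ≤ c * |d.eval a| := by gcongr
      nlinarith
    have hδ' : 0 < min (δ r) (c * cr r / (2 * M)) := lt_min (hδ r) (by positivity)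
    rcases (hS01 r hr).1.eq_or_lt with h0 | h0
    · subst h0
      obtain ⟨C₀, hC, hm⟩ := local_zero (f - C (q0 ^ 2) ^ k) _ _ (half_pos hcc) hδ' (e 0) (by
        intro a b hab ha
        have := hbound a b hab (by simpa using ha)
        rwa [sub_zero] at this) (k + 1)
      refine ⟨C₀, hC, ?_⟩
      rw [C_0, sub_zero]; exact hm
    · exact local_pos _ r _ _ h0 (hS01 r hr).2 (half_pos hcc) hδ' (e r) hbound (k + 1))
    ⟨0, Finset.mem_insert_self _ _⟩
  refine final_glue f q0 k (k + 1) (by omega) (by omega) c0 hc0 hg hpsd ?_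
  intro a b hab hne
  refine lt_of_lt_of_le ?_ (h a b hab)
  apply mul_pos hc
  rw [abs_pos]
  intro hroot
  apply hne
  rw [hq0, eval_prod]
  apply Finset.prod_eq_zero (i := a)
  · rw [hS, Finset.mem_insert, Finset.mem_filter, Multiset.mem_toFinset, mem_roots hd]
    exact Or.inr ⟨hroot, hab.1, hab.2.1⟩
  · simp

lemma sq_dvd_of (f p : P2) (hp : Irreducible p) (hpd : p.natDegree ≠ 0) (h1 : p ∣ f)
    (h2 : p ∣ derivative f) : p ^ 2 ∣ f := by
  obtain ⟨h, rfl⟩ := h1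
  rw [derivative_mul] at h2
  have h3 : p ∣ derivative p * h := (dvd_add_left (dvd_mul_right p _)).mp h2
  rcases hp.prime.dvd_or_dvd h3 with h4 | h4
  · exfalso
    have h5 : derivative p ≠ 0 := fun h0 => hpd (derivative_eq_zero.mp h0)
    have h6 := natDegree_le_of_dvd h4 h5
    have h7 := natDegree_derivative_lt hpd
    omega
  · rw [pow_two]; exact mul_dvd_mul_left p h4

theorem main (n : ℕ) : ∀ f : P2, f.natDegree = n → (∀ a b, inK a b → 0 ≤ ev a b f) → f ∈ T := by
  induction n using Nat.strong_induction_on with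
  | _ n ih =>
  intro f hn hf
  by_cases hf0 : f = 0
  · rw [hf0]; exact T.zero_mem
  have strip : ∀ g : P2, g ∈ T → g.natDegree ≠ 0 → (∀ a b, inK a b → 0 ≤ ev a b g) → g ∣ f →
      f ∈ T := by
    rintro g hg hgd hg0 ⟨f1, rfl⟩
    have hne := mul_ne_zero_iff.mp hf0
    rw [natDegree_mul hne.1 hne.2] at hn
    exact T.mul_mem hg (ih _ (by omega) f1 rfl (dens g f1 hne.1 hg0 hf))
  by_cases h0 : f.coeff 0 = 0
  · exact strip yy T_y (by simp [yy]) (fun a b h => by rw [ev_yy]; exact h.2.2.1)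
      (X_dvd_iff.mpr h0)
  by_cases h1 : f.eval (X ^ 2) = 0
  · have hd : (X - C (X ^ 2) : P2) ∣ f := dvd_iff_isRoot.mpr h1
    have he : xx ^ 2 - yy = -(X - C (X ^ 2) : P2) := by simp [xx, yy]
    refine strip (xx ^ 2 - yy) T_xy ?_ (fun a b h => ?_) ?_
    · rw [he, natDegree_neg, natDegree_X_sub_C]; exact one_ne_zero
    · rw [map_sub, map_pow, ev_xx, ev_yy]; linarith [h.2.2.2]
    · rw [he]; exact (neg_dvd).mpr hd
  by_cases hsq : ∃ p : P2, Irreducible p ∧ p.natDegree ≠ 0 ∧ p ∣ f ∧ p ∣ derivative f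
  · obtain ⟨p, hp, hpd, hp1, hp2⟩ := hsq
    refine strip (p ^ 2) (T_sq p) ?_ (fun a b h => ?_) (sq_dvd_of f p hp hpd hp1 hp2)
    · rw [natDegree_pow]; omega
    · rw [map_pow]; positivity
  obtain ⟨u, v, D, hD, e⟩ := bezC f (derivative f) hf0
    (fun p hp hpd h1 h2 => hsq ⟨p, hp, hpd, h1, h2⟩)
  obtain ⟨d, c, hd, hc, hl⟩ := loj f u v D hD e h0 h1 hf
  exact globalize f d c hd hc hl

open MvPolynomial in
def psi : P2 →+* MvPolynomial (Fin 2) ℝ :=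
  Polynomial.eval₂RingHom (Polynomial.eval₂RingHom (MvPolynomial.C) (MvPolynomial.X 0))
    (MvPolynomial.X 1)

lemma psi_xx : psi xx = MvPolynomial.X 0 := by simp [psi, xx]
lemma psi_yy : psi yy = MvPolynomial.X 1 := by simp [psi, yy]
lemma psi_cst (r : ℝ) : psi (cst r) = MvPolynomial.C r := by simp [psi, cst]

lemma psi_surj (f : MvPolynomial (Fin 2) ℝ) : ∃ g, psi g = f := by
  induction f using MvPolynomial.induction_on with
  | C r => exact ⟨cst r, psi_cst r⟩
  | add p q hp hq =>
    obtain ⟨a, rfl⟩ := hp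
    obtain ⟨b, rfl⟩ := hq
    exact ⟨a + b, map_add _ _ _⟩
  | mul_X p i hp =>
    obtain ⟨a, rfl⟩ := hp
    fin_cases i
    · exact ⟨a * xx, by rw [map_mul, psi_xx]; rfl⟩
    · exact ⟨a * yy, by rw [map_mul, psi_yy]; rfl⟩

lemma eval_psi (p : Fin 2 → ℝ) (g : P2) : MvPolynomial.eval p (psi g) = ev (p 0) (p 1) g := by
  induction g using P2_induction with
  | hc r => rw [psi_cst, ev_cst, MvPolynomial.eval_C]
  | hx => rw [psi_xx, ev_xx, MvPolynomial.eval_X]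
  | hy => rw [psi_yy, ev_yy, MvPolynomial.eval_X]
  | hadd g h hg hh => rw [map_add, map_add, map_add, hg, hh]
  | hmul g h hg hh => rw [map_mul, map_mul, map_mul, hg, hh]

theorem final (f : MvPolynomial (Fin 2) ℝ)
    (hf : ∀ p : Fin 2 → ℝ, 0 ≤ p 0 → 0 ≤ 1 - p 0 → 0 ≤ p 1 → 0 ≤ (p 0) ^ 2 - p 1 →
      0 ≤ MvPolynomial.eval p f) :
    f ∈ Subsemiring.closure (({(MvPolynomial.X 0 : MvPolynomial (Fin 2) ℝ), 1 - MvPolynomial.X 0,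
      MvPolynomial.X 1, MvPolynomial.X 0 ^ 2 - MvPolynomial.X 1} : Set _) ∪
        {a | ∃ b, a = b ^ 2}) := by
  obtain ⟨g, rfl⟩ := psi_surj f
  have hg : g ∈ T := by
    refine main _ g rfl ?_
    rintro a b ⟨h1, h2, h3, h4⟩
    have := hf ![a, b] (by simpa using h1) (by simpa using h2) (by simpa using h3)
      (by simpa using h4)
    rw [eval_psi] at this
    simpa using this
  have hle : T ≤ (Subsemiring.closure (({(MvPolynomial.X 0 : MvPolynomial (Fin 2) ℝ),
      1 - MvPolynomial.X 0, MvPolynomial.X 1, MvPolynomial.X 0 ^ 2 - MvPolynomial.X 1} : Set _) ∪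
        {a | ∃ b, a = b ^ 2})).comap psi := by
    rw [T, Subsemiring.closure_le]
    rintro t ht
    show psi t ∈ Subsemiring.closure _
    apply Subsemiring.subset_closure
    rcases ht with ht | ⟨b, rfl⟩
    · left
      simp only [Set.mem_insert_iff, Set.mem_singleton_iff] at ht ⊢
      rcases ht with rfl | rfl | rfl | rfl
      · left; exact psi_xx
      · right; left; rw [map_sub, map_one, psi_xx]
      · right; right; left; exact psi_yy
      · right; right; right; rw [map_sub, map_pow, psi_xx, psi_yy]
    · right; exact ⟨psi b, map_pow _ _ _⟩
  exact hle hg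

end Sat

end

noncomputable section

open MvPolynomial

/-- The preordering of `ℝ[x,y]` generated by
`S = {x, 1 − x, y, x² − y}` is saturated: every polynomial nonnegative on the compact
set `K_S = {(a,b) : a ≥ 0, 1 − a ≥ 0, b ≥ 0, a² − b ≥ 0}` belongs to it. -/
theorem preordering_example_saturated (f : MvPolynomial (Fin 2) ℝ)
    (hf : ∀ p : Fin 2 → ℝ, 0 ≤ p 0 → 0 ≤ 1 - p 0 → 0 ≤ p 1 → 0 ≤ (p 0) ^ 2 - p 1 →
      0 ≤ eval p f) :
    f ∈ preorderingGen {(X 0 : MvPolynomial (Fin 2) ℝ), 1 - X 0, X 1,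
      X 0 ^ 2 - X 1} := by
  exact Sat.final f hf
end
end

section
/- Let G be the dihedral group of order 8 acting on ℝ[x,y] by the standard action (generated by the rotation x ↦ y, y ↦ −x and the reflection x ↦ y, y ↦ x). Then the invariant ring ℝ[x,y]^G is generated as an ℝ-algebra by u(x,y) = x² + y² and v(x,y) = x²y², and moreover u(x,y) and v(x,y) are algebraically independent over ℝ; consequently the ℝ-algebra homomorphism ℝ[u,v] → ℝ[x,y]^G sending f(u,v) to f(x² + y², x²y²) is an isomorphism. -/
noncomputable section

open MvPolynomial

/-- The substitution `f(u,v) ↦ f(x² + y², x²y²)` is the elementary symmetric substitution followed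
by `expand 2`. -/
lemma aeval_uv_eq (p : MvPolynomial (Fin 2) ℝ) :
    aeval ![(X 0 ^ 2 + X 1 ^ 2 : MvPolynomial (Fin 2) ℝ), X 0 ^ 2 * X 1 ^ 2] p =
      expand 2 ((esymmAlgHom (Fin 2) ℝ 2 p : symmetricSubalgebra (Fin 2) ℝ) :
        MvPolynomial (Fin 2) ℝ) := by
  have h2 : esymm (Fin 2) ℝ 2 = X 0 * X 1 := by
    have : Finset.powersetCard 2 (Finset.univ : Finset (Fin 2)) = {Finset.univ} := by decide
    simp [esymm, this]
  have : aeval ![(X 0 ^ 2 + X 1 ^ 2 : MvPolynomial (Fin 2) ℝ), X 0 ^ 2 * X 1 ^ 2] =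
      ((expand 2).comp (symmetricSubalgebra (Fin 2) ℝ).val).comp (esymmAlgHom (Fin 2) ℝ 2) := by
    ext1 i
    fin_cases i <;> simp [esymmAlgHom, h2]
  rw [this]
  rfl

lemma coeff_scale (c : Fin 2 → ℝ) (f : MvPolynomial (Fin 2) ℝ) (m : Fin 2 →₀ ℕ) :
    coeff m (aeval (fun i => C (c i) * X i : Fin 2 → MvPolynomial (Fin 2) ℝ) f) =
      (c 0 ^ m 0 * c 1 ^ m 1) * coeff m f := by
  induction f using MvPolynomial.induction_on' with
  | monomial d a =>
    have : aeval (fun i => C (c i) * X i : Fin 2 → MvPolynomial (Fin 2) ℝ) (monomial d a) =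
        C (c 0 ^ d 0 * c 1 ^ d 1) * monomial d a := by
      rw [aeval_monomial, monomial_eq, Finsupp.prod_fintype _ _ (by simp),
        Finsupp.prod_fintype _ _ (by simp)]
      simp only [Fin.prod_univ_two, C_mul, C_pow, algebraMap_eq]
      ring
    rw [this, coeff_C_mul, coeff_monomial]
    split_ifs with h
    · rw [h]
    · simp
  | add p q hp hq => rw [map_add, coeff_add, coeff_add, hp, hq, mul_add]

lemma exists_expand (f : MvPolynomial (Fin 2) ℝ) (h : ∀ m, coeff m f ≠ 0 → ∀ i, Even (m i)) :
    ∃ g, expand 2 g = f := by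
  refine ⟨∑ m ∈ f.support, monomial (m.mapRange (· / 2) (by simp)) (coeff m f), ?_⟩
  conv_rhs => rw [f.as_sum]
  rw [map_sum]
  refine Finset.sum_congr rfl fun m hm => ?_
  rw [expand_monomial]
  suffices hm2 : 2 • m.mapRange (· / 2) (by simp) = m by rw [hm2]
  ext i
  obtain ⟨k, hk⟩ := h m (mem_support_iff.mp hm) i
  simp only [Finsupp.smul_apply, Finsupp.mapRange_apply, smul_eq_mul]
  omega

/-- For the standard action of the dihedral group of order 8 on
`ℝ[x,y]` (generated by the rotation `a : x ↦ y, y ↦ −x` and the reflection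
`b : x ↦ y, y ↦ x`), the invariant ring `ℝ[x,y]^G` is generated as an `ℝ`-algebra by
`u = x² + y²` and `v = x²y²`, and `u, v` are algebraically independent over `ℝ`; hence
`ℝ[u,v] → ℝ[x,y]^G`, `f(u,v) ↦ f(x² + y², x²y²)`, is an isomorphism. (A polynomial is
`G`-invariant iff it is fixed by the two generators `a` and `b`.) -/
theorem invariant_ring_dihedral :
    AlgebraicIndependent ℝ
      ![(X 0 ^ 2 + X 1 ^ 2 : MvPolynomial (Fin 2) ℝ), X 0 ^ 2 * X 1 ^ 2] ∧
    (Algebra.adjoin ℝ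
        {(X 0 ^ 2 + X 1 ^ 2 : MvPolynomial (Fin 2) ℝ), X 0 ^ 2 * X 1 ^ 2} : Set _) =
      {f : MvPolynomial (Fin 2) ℝ |
        aeval ![(X 1 : MvPolynomial (Fin 2) ℝ), -X 0] f = f ∧
        aeval ![(X 1 : MvPolynomial (Fin 2) ℝ), X 0] f = f} := by
  constructor
  · rw [algebraicIndependent_iff_injective_aeval]
    intro p q h
    rw [aeval_uv_eq, aeval_uv_eq] at h
    exact esymmAlgHom_fin_injective ℝ le_rfl (Subtype.ext (expand_injective two_pos h))
  · apply Set.Subset.antisymm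
    · intro f hf
      have hle : Algebra.adjoin ℝ
          {(X 0 ^ 2 + X 1 ^ 2 : MvPolynomial (Fin 2) ℝ), X 0 ^ 2 * X 1 ^ 2} ≤
          AlgHom.equalizer (aeval ![(X 1 : MvPolynomial (Fin 2) ℝ), -X 0]) (AlgHom.id ℝ _) ⊓
          AlgHom.equalizer (aeval ![(X 1 : MvPolynomial (Fin 2) ℝ), X 0]) (AlgHom.id ℝ _) := by
        rw [Algebra.adjoin_le_iff]
        rintro g (rfl | rfl)
        · constructor <;> simp [AlgHom.mem_equalizer, add_comm]
        · constructor <;> simp [AlgHom.mem_equalizer, mul_comm]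
      exact hle hf
    · rintro f ⟨ha, hb⟩
      have e1 : aeval (fun i => C (![-1, 1] i) * X i : Fin 2 → MvPolynomial (Fin 2) ℝ) f = f := by
        have : (aeval (fun i => C (![-1, 1] i) * X i : Fin 2 → MvPolynomial (Fin 2) ℝ)) =
            (aeval ![(X 1 : MvPolynomial (Fin 2) ℝ), -X 0]).comp
              (aeval ![(X 1 : MvPolynomial (Fin 2) ℝ), X 0]) := by
          ext1 i
          fin_cases i <;> simp
        rw [this, AlgHom.comp_apply, hb, ha]
      have e2 : aeval (fun i => C (![1, -1] i) * X i : Fin 2 → MvPolynomial (Fin 2) ℝ) f = f := by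
        have : (aeval (fun i => C (![1, -1] i) * X i : Fin 2 → MvPolynomial (Fin 2) ℝ)) =
            (aeval ![(X 1 : MvPolynomial (Fin 2) ℝ), X 0]).comp
              (aeval ![(X 1 : MvPolynomial (Fin 2) ℝ), -X 0]) := by
          ext1 i
          fin_cases i <;> simp
        rw [this, AlgHom.comp_apply, ha, hb]
      obtain ⟨g, rfl⟩ := exists_expand f (by
        intro m hm i
        have c1 := coeff_scale ![-1, 1] f m
        have c2 := coeff_scale ![1, -1] f m
        rw [e1] at c1
        rw [e2] at c2
        by_contra hi
        rw [Nat.not_even_iff_odd] at hi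
        fin_cases i
        · have h0 : Odd (m 0) := hi
          simp [h0.neg_one_pow] at c1
          exact hm (by linarith)
        · have h0 : Odd (m 1) := hi
          simp [h0.neg_one_pow] at c2
          exact hm (by linarith))
      have hs : rename (Equiv.swap (0 : Fin 2) 1) g = g := by
        apply expand_injective (n := 2) two_pos
        have : (expand 2).comp (rename (Equiv.swap (0 : Fin 2) 1)) =
            (aeval ![(X 1 : MvPolynomial (Fin 2) ℝ), X 0]).comp (expand 2) := by
          ext1 i
          fin_cases i <;> simp
        exact (DFunLike.congr_fun this g).trans hb
      have hg : g.IsSymmetric := by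
        intro e
        have he : e = 1 ∨ e = Equiv.swap (0 : Fin 2) 1 := by
          revert e
          decide
        rcases he with rfl | rfl
        · exact rename_id_apply g
        · exact hs
      obtain ⟨p, hp⟩ := (esymmAlgHom_fin_bijective ℝ 2).2 ⟨g, hg⟩
      have key := aeval_uv_eq p
      rw [hp] at key
      change expand 2 g ∈ Algebra.adjoin ℝ _
      change _ = expand 2 g at key
      rw [← key, ← Matrix.range_cons_cons_empty _ _ ![], Algebra.adjoin_range_eq_range_aeval]
      exact ⟨p, rfl⟩
end
end

section
/- Let G be the dihedral group of order 8 acting on ℝ² by the standard linear action (generated by the rotation (x,y) ↦ (y,−x) and the reflection (x,y) ↦ (y,x)), and let π : ℝ² → ℝ² be the map π(x,y) = (x² + y², x²y²). Then two points p, q ∈ ℝ² satisfy π(p) = π(q) if and only if p and q lie in the same G-orbit. -/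
noncomputable section

/-- The rotation by 90 degrees, `(x,y) ↦ (y,−x)`, as a permutation of `ℝ²`. -/
def rot90 : Equiv.Perm (ℝ × ℝ) where
  toFun p := (p.2, -p.1)
  invFun p := (-p.2, p.1)
  left_inv p := by simp
  right_inv p := by simp

/-- The reflection `(x,y) ↦ (y,x)` as a permutation of `ℝ²`. -/
def reflSwap : Equiv.Perm (ℝ × ℝ) where
  toFun p := (p.2, p.1)
  invFun p := (p.2, p.1)
  left_inv p := by simp
  right_inv p := by simp

/-- For the standard action of the dihedral group of order 8 on `ℝ²`
(the group generated by the rotation `(x,y) ↦ (y,−x)` and the reflection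
`(x,y) ↦ (y,x)`), two points have the same image under the orbit map
`π(x,y) = (x² + y², x²y²)` if and only if they lie in the same orbit. -/
theorem orbit_map_fibers (p q : ℝ × ℝ) :
    (p.1 ^ 2 + p.2 ^ 2, p.1 ^ 2 * p.2 ^ 2) = (q.1 ^ 2 + q.2 ^ 2, q.1 ^ 2 * q.2 ^ 2) ↔
      ∃ g ∈ Subgroup.closure {rot90, reflSwap}, g p = q := by
  have hr : rot90 ∈ Subgroup.closure {rot90, reflSwap} := Subgroup.subset_closure (by simp)
  have hs : reflSwap ∈ Subgroup.closure {rot90, reflSwap} := Subgroup.subset_closure (by simp)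
  constructor
  · obtain ⟨x, y⟩ := p
    obtain ⟨u, v⟩ := q
    intro h
    simp only [Prod.mk.injEq] at h
    obtain ⟨h1, h2⟩ := h
    have h3 : (u ^ 2 - x ^ 2) * (u ^ 2 - y ^ 2) = 0 := by
      linear_combination (-u ^ 2) * h1 + h2
    rcases mul_eq_zero.mp h3 with h | h
    · have hv : v ^ 2 = y ^ 2 := by linarith
      rcases sq_eq_sq_iff_eq_or_eq_neg.mp (sub_eq_zero.mp h) with rfl | rfl <;>
        rcases sq_eq_sq_iff_eq_or_eq_neg.mp hv with rfl | rfl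
      · exact ⟨1, one_mem _, rfl⟩
      · exact ⟨rot90 * reflSwap, mul_mem hr hs, by simp [rot90, reflSwap]⟩
      · exact ⟨reflSwap * rot90, mul_mem hs hr, by simp [rot90, reflSwap]⟩
      · exact ⟨rot90 * rot90, mul_mem hr hr, by simp [rot90]⟩
    · have hv : v ^ 2 = x ^ 2 := by linarith
      rcases sq_eq_sq_iff_eq_or_eq_neg.mp (sub_eq_zero.mp h) with rfl | rfl <;>
        rcases sq_eq_sq_iff_eq_or_eq_neg.mp hv with rfl | rfl
      · exact ⟨reflSwap, hs, rfl⟩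
      · exact ⟨rot90, hr, rfl⟩
      · exact ⟨rot90 * rot90 * rot90, mul_mem (mul_mem hr hr) hr, by simp [rot90]⟩
      · exact ⟨rot90 * rot90 * reflSwap, mul_mem (mul_mem hr hr) hs,
          by simp [rot90, reflSwap]⟩
  · rintro ⟨g, hg, rfl⟩
    induction hg using Subgroup.closure_induction generalizing p with
    | mem g hg =>
      rcases hg with rfl | rfl <;> simp [rot90, reflSwap, add_comm, mul_comm]
    | one => rfl
    | mul a b _ _ iha ihb => exact (ihb p).trans (iha (b p))
    | inv a _ iha => simpa using (iha (a⁻¹ p)).symm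
end
end

section
/- Let S' = {2 − x² − y², (1 − x²)(1 − y²)} ⊆ ℝ[x,y]. Then the polynomial 1 − x does not belong to the preordering T_{S'} of ℝ[x,y] generated by S', even though 1 − x is nonnegative on K_{S'} = [−1,1]²; hence T_{S'} is not saturated. -/
noncomputable section

open MvPolynomial

/-- Every element of the preordering is nonnegative at `(1,1)`, and if it vanishes there,
its two partial derivatives at `(1,1)` agree. -/
lemma preordering_invariant (f : MvPolynomial (Fin 2) ℝ)
    (hf : f ∈ preorderingGen {(2 - X 0 ^ 2 - X 1 ^ 2 : MvPolynomial (Fin 2) ℝ),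
        (1 - X 0 ^ 2) * (1 - X 1 ^ 2)}) :
    0 ≤ eval (fun _ => (1 : ℝ)) f ∧ (eval (fun _ => (1 : ℝ)) f = 0 →
      eval (fun _ => (1 : ℝ)) (pderiv 0 f) = eval (fun _ => (1 : ℝ)) (pderiv 1 f)) := by
  have h01 : pderiv (R := ℝ) (0 : Fin 2) (X 1) = 0 := pderiv_X_of_ne (by decide)
  have h10 : pderiv (R := ℝ) (1 : Fin 2) (X 0) = 0 := pderiv_X_of_ne (by decide)
  have h2 : ∀ i : Fin 2, pderiv (R := ℝ) i 2 = 0 := fun i => by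
    exact pderiv_C (R := ℝ) (i := i) (a := 2)
  unfold preorderingGen at hf
  induction hf using Subsemiring.closure_induction with
  | mem a ha =>
    rcases ha with (rfl | rfl) | ⟨b, rfl⟩
    · constructor
      · norm_num
      · intro _
        simp [h01, h10, h2, pow_two, Derivation.leibniz]
    · constructor
      · norm_num
      · intro _
        simp [h01, h10, pow_two, Derivation.leibniz]
    · constructor
      · rw [map_pow]
        positivity
      · intro h
        have hb : eval (fun _ => (1 : ℝ)) b = 0 := by simpa using h
        simp [pow_two, Derivation.leibniz, hb]
  | zero => simp
  | one => simp
  | add a b _ _ iha ihb =>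
    obtain ⟨ha, ha'⟩ := iha
    obtain ⟨hb, hb'⟩ := ihb
    simp only [map_add]
    refine ⟨by positivity, fun h => ?_⟩
    rw [ha' (by linarith), hb' (by linarith)]
  | mul a b _ _ iha ihb =>
    obtain ⟨ha, ha'⟩ := iha
    obtain ⟨hb, hb'⟩ := ihb
    simp only [map_mul, Derivation.leibniz, map_add, smul_eq_mul]
    refine ⟨by positivity, fun h => ?_⟩
    rcases mul_eq_zero.mp h with h | h
    · rw [h, ha' h]
      ring
    · rw [h, hb' h]
      ring

/-- The polynomial `1 − x` is nonnegative on
`K = {(a,b) : 2 − a² − b² ≥ 0, (1 − a²)(1 − b²) ≥ 0} = [−1,1]²`, but it does not belong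
to the preordering of `ℝ[x,y]` generated by `2 − x² − y²` and `(1 − x²)(1 − y²)`; hence
this preordering is not saturated. -/
theorem not_saturated_example :
    (∀ p : Fin 2 → ℝ, 0 ≤ 2 - (p 0) ^ 2 - (p 1) ^ 2 →
      0 ≤ (1 - (p 0) ^ 2) * (1 - (p 1) ^ 2) → 0 ≤ eval p (1 - X 0 : MvPolynomial (Fin 2) ℝ)) ∧
    (1 - X 0 : MvPolynomial (Fin 2) ℝ) ∉
      preorderingGen {(2 - X 0 ^ 2 - X 1 ^ 2 : MvPolynomial (Fin 2) ℝ),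
        (1 - X 0 ^ 2) * (1 - X 1 ^ 2)} ∧
    preorderingGen {(2 - X 0 ^ 2 - X 1 ^ 2 : MvPolynomial (Fin 2) ℝ),
        (1 - X 0 ^ 2) * (1 - X 1 ^ 2)} ≠
      {f : MvPolynomial (Fin 2) ℝ | ∀ p : Fin 2 → ℝ,
        0 ≤ 2 - (p 0) ^ 2 - (p 1) ^ 2 → 0 ≤ (1 - (p 0) ^ 2) * (1 - (p 1) ^ 2) →
        0 ≤ eval p f} := by
  have h1 : ∀ p : Fin 2 → ℝ, 0 ≤ 2 - (p 0) ^ 2 - (p 1) ^ 2 →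
      0 ≤ (1 - (p 0) ^ 2) * (1 - (p 1) ^ 2) →
      0 ≤ eval p (1 - X 0 : MvPolynomial (Fin 2) ℝ) := by
    intro p hp hq
    simp only [map_sub, map_one, eval_X]
    by_contra hc
    have ha : 1 < p 0 ^ 2 := by nlinarith
    have hb : p 1 ^ 2 < 1 := by linarith
    nlinarith [mul_pos (sub_pos.mpr ha) (sub_pos.mpr hb)]
  have h2 : (1 - X 0 : MvPolynomial (Fin 2) ℝ) ∉
      preorderingGen {(2 - X 0 ^ 2 - X 1 ^ 2 : MvPolynomial (Fin 2) ℝ),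
        (1 - X 0 ^ 2) * (1 - X 1 ^ 2)} := by
    intro h
    have h10 : pderiv (R := ℝ) (1 : Fin 2) (X 0) = 0 := pderiv_X_of_ne (by decide)
    have := (preordering_invariant _ h).2 (by simp)
    simp [h10] at this
  refine ⟨h1, h2, fun h => h2 ?_⟩
  rw [h]
  exact h1
end
end
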